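/- Let L ≥ 1 be an integer. There is a constant C depending only on L such that the following holds. Let τ > 0, Λ > 0, A > 0, t₀ ∈ ℝ, and let v : ℝ×𝕋³ → ℝ³ be a smooth divergence-free vector field with sup_{(t,x)} ‖∇^{k+1} v‖ ≤ τ⁻¹ Λ^k for 0 ≤ k ≤ L. Let U : ℝ×𝕋³ → ℝ³ be a smooth vector field with supp U ⊆ [t₀−τ, t₀+τ]×𝕋³, with ∫_{𝕋³} U^l(t,x) dx = 0 for every t, and satisfying sup_t ‖∇^k U(t,·)‖_{L⁴(𝕋³)} ≤ A Λ^k for 0 ≤ k ≤ L and sup_t ‖∇^k (∂_t + v·∇)U(t,·)‖_{L⁴(𝕋³)} ≤ A τ⁻¹ Λ^k for 0 ≤ k ≤ L−1. Then there exists a symmetric tensor field Q^{jl} = Q^{lj} on ℝ×𝕋³, depending linearly on U, such that: ∂_j Q^{jl} = U^l; ∫_{𝕋³} Q^{jl}(t,x) dx = 0 for all t; supp Q ⊆ [t₀−3τ/2, t₀+3τ/2]×𝕋³; sup_t ‖∇^{k+1} Q(t,·)‖_{L⁴(𝕋³)} ≤ C A Λ^k for 0 ≤ k ≤ L; and sup_t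 ‖∇^{k+1} (∂_t + v·∇)Q(t,·)‖_{L⁴(𝕋³)} ≤ C A τ⁻¹ Λ^k for 0 ≤ k ≤ L−1. -/

import Mathlib

noncomputable section

open MeasureTheory

/-- Points of space ℝ³. -/
abbrev Spc : Type := Fin 3 → ℝ

/-- ℤ³-periodicity of a function on ℝ³. -/
def Per {α : Type*} (f : Spc → α) : Prop :=
  ∀ (x : Spc) (k : Fin 3 → ℤ), f (fun i => x i + (k i : ℝ)) = f x

/-- Spatial partial derivative in direction `j`. -/
def pd {E : Type*} [NormedAddCommGroup E] [NormedSpace ℝ E]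
    (j : Fin 3) (f : Spc → E) (x : Spc) : E :=
  fderiv ℝ f x (Pi.single j 1)

/-- Time derivative. -/
def pt {E : Type*} [NormedAddCommGroup E] [NormedSpace ℝ E]
    (f : ℝ → Spc → E) (t : ℝ) (x : Spc) : E :=
  deriv (fun s => f s x) t

/-- The fundamental domain [0,1)³ of the torus. -/
def Tdom : Set Spc := Set.univ.pi fun _ => Set.Ico (0 : ℝ) 1

/-- Material (advective) derivative `(∂ₜ + v·∇)f` along the vector field `v`. -/
def matD (v : ℝ → Spc → Spc) (f : ℝ → Spc → ℝ) (t : ℝ) (x : Spc) : ℝ :=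
  pt f t x + ∑ i, v t x i * pd i (f t) x

namespace TE
open scoped ComplexConjugate

abbrev Lat : Type := Fin 3 → ℤ

def wt (k : Lat) : ℝ := 1 + ∑ i, (k i : ℝ) ^ 2

lemma one_le_wt (k : Lat) : 1 ≤ wt k := by
  unfold wt
  have : 0 ≤ ∑ i, (k i : ℝ) ^ 2 := Finset.sum_nonneg fun i _ => sq_nonneg _
  linarith

lemma wt_pos (k : Lat) : 0 < wt k := lt_of_lt_of_le one_pos (one_le_wt k)

lemma wt_neg (k : Lat) : wt (-k) = wt k := by simp [wt]

lemma wt_add_le (k m : Lat) : wt (k + m) ≤ 2 * wt k * wt m := by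
  unfold wt
  simp only [Fin.sum_univ_three, Pi.add_apply, Int.cast_add]
  nlinarith [sq_nonneg ((k 0 : ℝ) - m 0), sq_nonneg ((k 1 : ℝ) - m 1), sq_nonneg ((k 2 : ℝ) - m 2),
    mul_nonneg (add_nonneg (add_nonneg (sq_nonneg (k 0 : ℝ)) (sq_nonneg (k 1 : ℝ))) (sq_nonneg (k 2 : ℝ)))
     (add_nonneg (add_nonneg (sq_nonneg (m 0 : ℝ)) (sq_nonneg (m 1 : ℝ))) (sq_nonneg (m 2 : ℝ)))]

lemma wt_le_sub (k m : Lat) : wt k ≤ 2 * wt (k - m) * wt m := by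
  have := wt_add_le (k - m) m
  simpa using this

lemma abs_le_wt (k : Lat) (j : Fin 3) : |(k j : ℝ)| ≤ wt k := by
  unfold wt
  have h : (k j : ℝ)^2 ≤ ∑ i, (k i : ℝ) ^ 2 :=
    Finset.single_le_sum (f := fun i => (k i : ℝ)^2) (fun i _ => sq_nonneg _) (Finset.mem_univ j)
  nlinarith [sq_abs (k j : ℝ), sq_nonneg (|(k j : ℝ)| - 1)]

lemma summable_one_div_int : Summable fun n : ℤ => (1 + (n : ℝ)^2)⁻¹ := by
  have h : Summable fun n : ℤ => 1 / (n : ℝ)^2 := Real.summable_one_div_int_pow.mpr one_lt_two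
  refine Summable.of_norm_bounded_eventually (g := fun n : ℤ => 1 / (n:ℝ)^2) h ?_
  have : ({0}ᶜ : Set ℤ) ∈ Filter.cofinite := (Set.finite_singleton 0).compl_mem_cofinite
  filter_upwards [this] with n hn
  have hn' : (0:ℝ) < (n:ℝ)^2 := by
    have : (n:ℝ) ≠ 0 := by simpa using hn
    positivity
  rw [Real.norm_of_nonneg (by positivity), one_div]
  apply inv_anti₀ hn'
  linarith

lemma summable_wt : Summable fun k : Lat => ((wt k)⁻¹) ^ 3 := by
  have h := summable_one_div_int
  have h2 : Summable fun p : ℤ × ℤ × ℤ => (1 + (p.1 : ℝ)^2)⁻¹ * ((1 + (p.2.1 : ℝ)^2)⁻¹ * (1 + (p.2.2 : ℝ)^2)⁻¹) :=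
    Summable.mul_of_nonneg h (Summable.mul_of_nonneg h h (fun n => by positivity) (fun n => by positivity))
      (fun n => by positivity) (fun n => by simp only [Pi.zero_apply]; positivity)
  let φ : Lat → ℤ × ℤ × ℤ := fun k => (k 0, k 1, k 2)
  have hφ : Function.Injective φ := by
    intro a b hab
    simp only [φ, Prod.mk.injEq] at hab
    funext i; fin_cases i
    · exact hab.1
    · exact hab.2.1
    · exact hab.2.2
  refine Summable.of_nonneg_of_le (fun k => pow_nonneg (inv_nonneg.2 (wt_pos k).le) _) (fun k => ?_)
    (h2.comp_injective hφ)
  have e : wt k = 1 + (k 0:ℝ)^2 + (k 1 :ℝ)^2 + (k 2:ℝ)^2 := by simp [wt, Fin.sum_univ_three]; ring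
  have p0 := sq_nonneg (k 0 : ℝ)
  have p1 := sq_nonneg (k 1 : ℝ)
  have p2 := sq_nonneg (k 2 : ℝ)
  have i0 : (wt k)⁻¹ ≤ (1 + (k 0:ℝ)^2)⁻¹ := inv_anti₀ (by linarith) (by linarith)
  have i1 : (wt k)⁻¹ ≤ (1 + (k 1:ℝ)^2)⁻¹ := inv_anti₀ (by linarith) (by linarith)
  have i2 : (wt k)⁻¹ ≤ (1 + (k 2:ℝ)^2)⁻¹ := inv_anti₀ (by linarith) (by linarith)
  have hw := inv_nonneg.2 (wt_pos k).le
  show _ ≤ (1 + (k 0:ℝ)^2)⁻¹ * ((1 + (k 1:ℝ)^2)⁻¹ * (1 + (k 2:ℝ)^2)⁻¹)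
  calc ((wt k)⁻¹)^3 = (wt k)⁻¹ * ((wt k)⁻¹ * (wt k)⁻¹) := by ring
    _ ≤ _ := mul_le_mul i0 (mul_le_mul i1 i2 hw (hw.trans i1)) (mul_nonneg hw hw) (hw.trans i0)

def chr (k : Lat) (x : Spc) : ℂ :=
  Complex.exp (((2 * Real.pi * ∑ i, (k i : ℝ) * x i : ℝ) : ℂ) * Complex.I)

lemma norm_chr (k : Lat) (x : Spc) : ‖chr k x‖ = 1 := Complex.norm_exp_ofReal_mul_I _

lemma chr_zero (x : Spc) : chr 0 x = 1 := by simp [chr]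

lemma chr_zero_right (k : Lat) : chr k 0 = 1 := by simp [chr]

lemma chr_add (k m : Lat) (x : Spc) : chr (k + m) x = chr k x * chr m x := by
  rw [chr, chr, chr, ← Complex.exp_add]
  congr 1
  rw [← add_mul, ← Complex.ofReal_add]
  congr 2
  simp only [Pi.add_apply, Int.cast_add, add_mul, Finset.sum_add_distrib]
  ring

lemma chr_add_right (k : Lat) (x y : Spc) : chr k (x + y) = chr k x * chr k y := by
  rw [chr, chr, chr, ← Complex.exp_add]
  congr 1
  rw [← add_mul, ← Complex.ofReal_add]
  congr 2
  simp only [Pi.add_apply, mul_add, Finset.sum_add_distrib]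

lemma chr_neg (k : Lat) (x : Spc) : chr (-k) x = conj (chr k x) := by
  rw [chr, chr, ← Complex.exp_conj, map_mul, Complex.conj_ofReal, Complex.conj_I]
  congr 1
  simp

lemma chr_neg_right (k : Lat) (x : Spc) : chr k (-x) = conj (chr k x) := by
  rw [← chr_neg, chr, chr]; simp

lemma chr_mul_neg (k : Lat) (x : Spc) : chr k x * chr (-k) x = 1 := by
  rw [← chr_add]; simp [chr_zero]

lemma chr_per (k : Lat) : Per (chr k) := by
  intro x n
  have : (fun i => x i + (n i : ℝ)) = x + (fun i => (n i : ℝ)) := rfl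
  rw [this, chr_add_right]
  have h1 : chr k (fun i => (n i : ℝ)) = 1 := by
    rw [chr, Complex.exp_eq_one_iff]
    refine ⟨∑ i, k i * n i, ?_⟩
    push_cast
    ring
  rw [h1, mul_one]

lemma chr_contDiff (k : Lat) : ContDiff ℝ (⊤ : ℕ∞) (chr k) := by
  unfold chr
  apply ContDiff.cexp
  apply ContDiff.mul _ contDiff_const
  apply Complex.ofRealCLM.contDiff.comp
  apply ContDiff.mul contDiff_const
  apply ContDiff.sum
  intro i _
  exact contDiff_const.mul (contDiff_apply ℝ ℝ i)

lemma chr_continuous (k : Lat) : Continuous (chr k) := (chr_contDiff k).continuous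

def lf (k : Lat) : Spc →L[ℝ] ℝ := ∑ i, (k i : ℝ) • (ContinuousLinearMap.proj i : Spc →L[ℝ] ℝ)

lemma lf_apply (k : Lat) (x : Spc) : lf k x = ∑ i, (k i : ℝ) * x i := by
  simp [lf]

lemma lf_single (k : Lat) (j : Fin 3) : lf k (Pi.single j 1) = k j := by
  rw [lf_apply]; simp [Pi.single_apply]

def chrD (k : Lat) (x : Spc) : Spc →L[ℝ] ℂ :=
  (2 * Real.pi * Complex.I * chr k x) • (Complex.ofRealCLM.comp (lf k))

lemma chr_hasFDerivAt (k : Lat) (x : Spc) : HasFDerivAt (chr k) (chrD k x) x := by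
  have h1 : HasFDerivAt (fun y : Spc => ((2 * Real.pi * lf k y : ℝ) : ℂ) * Complex.I)
      ((Complex.I) • (Complex.ofRealCLM.comp ((2 * Real.pi) • lf k))) x := by
    have := (Complex.ofRealCLM.hasFDerivAt (x := 2 * Real.pi * lf k x)).comp x
      (((lf k).hasFDerivAt (x := x)).const_mul (2 * Real.pi))
    exact this.mul_const Complex.I
  have h2 := h1.cexp
  have e : chr k = fun y : Spc => Complex.exp (((2 * Real.pi * lf k y : ℝ) : ℂ) * Complex.I) := by
    funext y; rw [chr, lf_apply]
  rw [e]
  refine h2.congr_fderiv ?_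
  apply ContinuousLinearMap.ext; intro v
  simp only [chrD, e, ContinuousLinearMap.smul_apply, ContinuousLinearMap.comp_apply, smul_eq_mul,
    Complex.ofRealCLM_apply]
  push_cast
  ring

lemma norm_chrD (k : Lat) (x : Spc) : ‖chrD k x‖ ≤ 20 * wt k := by
  have hl : ‖lf k‖ ≤ 3 * wt k := by
    refine ContinuousLinearMap.opNorm_le_bound _ (by have := wt_pos k; positivity) fun v => ?_
    rw [lf_apply]
    calc ‖∑ i, (k i : ℝ) * v i‖ ≤ ∑ i : Fin 3, ‖(k i : ℝ) * v i‖ := norm_sum_le _ _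
      _ ≤ ∑ i : Fin 3, wt k * ‖v‖ := by
        apply Finset.sum_le_sum
        intro i _
        rw [norm_mul]
        exact mul_le_mul (abs_le_wt k i) (norm_le_pi_norm v i) (norm_nonneg _) (wt_pos k).le
      _ = 3 * wt k * ‖v‖ := by simp; ring
  have h2 : ‖Complex.ofRealCLM.comp (lf k)‖ ≤ 3 * wt k := by
    refine (ContinuousLinearMap.opNorm_comp_le _ _).trans ?_
    simpa using hl
  rw [chrD, norm_smul]
  have h3 : ‖(2 * Real.pi * Complex.I * chr k x : ℂ)‖ = 2 * Real.pi := by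
    simp [norm_chr, abs_of_pos Real.pi_pos]
  rw [h3]
  have := Real.pi_lt_d2
  have := Real.pi_pos
  nlinarith [wt_pos k, norm_nonneg (Complex.ofRealCLM.comp (lf k))]

end TE

namespace TE
open scoped ComplexConjugate

abbrev Sq : Type := Lat → ℝ → ℂ

def RD (a : Sq) : Prop := ∀ s : ℕ, ∃ C : ℝ, ∀ k t, ‖a k t‖ * wt k ^ s ≤ C

def SSn : ℕ → Sq → Prop
  | 0, a => (∀ k, Continuous (a k)) ∧ RD a
  | n + 1, a => (∀ k, Differentiable ℝ (a k)) ∧ RD a ∧ SSn n (fun k => deriv (a k))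

def SS (a : Sq) : Prop := ∀ n, SSn n a

lemma SSn.rd {n : ℕ} {a : Sq} (h : SSn n a) : RD a := by
  cases n with
  | zero => exact h.2
  | succ n => exact h.2.1

lemma SSn.cont {n : ℕ} {a : Sq} (h : SSn n a) (k : Lat) : Continuous (a k) := by
  cases n with
  | zero => exact h.1 k
  | succ n => exact (h.1 k).continuous

lemma SSn.pred {n : ℕ} : ∀ {a : Sq}, SSn (n + 1) a → SSn n a := by
  induction n with
  | zero => intro a h; exact ⟨fun k => (h.1 k).continuous, h.2.1⟩
  | succ n ih => intro a h; exact ⟨h.1, h.2.1, ih h.2.2⟩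

lemma RD.add {a b : Sq} (ha : RD a) (hb : RD b) : RD (fun k t => a k t + b k t) := by
  intro s
  obtain ⟨C, hC⟩ := ha s
  obtain ⟨D, hD⟩ := hb s
  refine ⟨C + D, fun k t => ?_⟩
  have h1 := hC k t
  have h2 := hD k t
  have h3 := norm_add_le (a k t) (b k t)
  have h4 : 0 ≤ wt k ^ s := pow_nonneg (wt_pos k).le s
  nlinarith

lemma SSn.add {n : ℕ} : ∀ {a b : Sq}, SSn n a → SSn n b → SSn n (fun k t => a k t + b k t) := by
  induction n with
  | zero => intro a b ha hb; exact ⟨fun k => (ha.1 k).add (hb.1 k), ha.2.add hb.2⟩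
  | succ n ih =>
    intro a b ha hb
    refine ⟨fun k => (ha.1 k).add (hb.1 k), ha.2.1.add hb.2.1, ?_⟩
    have : (fun k => deriv (fun t => a k t + b k t)) = fun k t => deriv (a k) t + deriv (b k) t := by
      funext k t
      exact deriv_add ((ha.1 k) t) ((hb.1 k) t)
    rw [this]
    exact ih ha.2.2 hb.2.2

def PG (m : Lat → ℂ) : Prop := ∃ (C : ℝ) (p : ℕ), 0 ≤ C ∧ ∀ k, ‖m k‖ ≤ C * wt k ^ p

lemma RD.mult {m : Lat → ℂ} (hm : PG m) {a : Sq} (ha : RD a) : RD (fun k t => m k * a k t) := by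
  intro s
  obtain ⟨C, p, hC0, hC⟩ := hm
  obtain ⟨D, hD⟩ := ha (p + s)
  refine ⟨C * D, fun k t => ?_⟩
  rw [norm_mul]
  have hw := wt_pos k
  calc ‖m k‖ * ‖a k t‖ * wt k ^ s ≤ (C * wt k ^ p) * ‖a k t‖ * wt k ^ s := by
        gcongr; exact hC k
    _ = C * (‖a k t‖ * wt k ^ (p + s)) := by rw [pow_add]; ring
    _ ≤ C * D := by gcongr; exact hD k t

lemma SSn.mult {m : Lat → ℂ} (hm : PG m) {n : ℕ} : ∀ {a : Sq}, SSn n a →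
    SSn n (fun k t => m k * a k t) := by
  induction n with
  | zero => intro a ha; exact ⟨fun k => continuous_const.mul (ha.1 k), ha.2.mult hm⟩
  | succ n ih =>
    intro a ha
    refine ⟨fun k => (ha.1 k).const_mul _, ha.2.1.mult hm, ?_⟩
    have : (fun k => deriv (fun t => m k * a k t)) = fun k t => m k * deriv (a k) t := by
      funext k t
      exact deriv_const_mul _ ((ha.1 k) t)
    rw [this]
    exact ih ha.2.2

def cj (a : Sq) : Sq := fun k t => conj (a (-k) t)

lemma RD.cj {a : Sq} (ha : RD a) : RD (cj a) := by
  intro s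
  obtain ⟨C, hC⟩ := ha s
  refine ⟨C, fun k t => ?_⟩
  have := hC (-k) t
  rw [wt_neg] at this
  simpa [TE.cj] using this

lemma deriv_conj' (f : ℝ → ℂ) (hf : Differentiable ℝ f) (t : ℝ) :
    deriv (fun s => conj (f s)) t = conj (deriv f t) := by
  have h := (Complex.conjCLE.toContinuousLinearMap.hasFDerivAt (x := f t)).comp_hasDerivAt t (hf t).hasDerivAt
  exact h.deriv

lemma SSn.cj {n : ℕ} : ∀ {a : Sq}, SSn n a → SSn n (cj a) := by
  induction n with
  | zero => intro a ha; exact ⟨fun k => Complex.continuous_conj.comp (ha.1 (-k)), ha.2.cj⟩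
  | succ n ih =>
    intro a ha
    refine ⟨fun k => ?_, ha.2.1.cj, ?_⟩
    · exact Complex.conjCLE.toContinuousLinearMap.differentiable.comp (ha.1 (-k))
    · have : (fun k => deriv (TE.cj a k)) = TE.cj (fun k => deriv (a k)) := by
        funext k t
        exact deriv_conj' _ (ha.1 (-k)) t
      rw [this]
      exact ih ha.2.2

lemma RD.bound {a : Sq} (ha : RD a) (s : ℕ) :
    ∃ C : ℝ, 0 ≤ C ∧ ∀ k t, ‖a k t‖ * wt k ^ s ≤ C * ((wt k)⁻¹) ^ 3 := by
  obtain ⟨C, hC⟩ := ha (s + 3)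
  have h0 : 0 ≤ C := le_trans (by have := wt_pos 0; positivity) (hC 0 0)
  refine ⟨C, h0, fun k t => ?_⟩
  have hw := wt_pos k
  rw [inv_pow, ← div_eq_mul_inv, le_div_iff₀ (by positivity)]
  calc _ = ‖a k t‖ * wt k ^ (s+3) := by rw [pow_add]; ring
    _ ≤ C := hC k t

lemma RD.bound0 {a : Sq} (ha : RD a) :
    ∃ C : ℝ, 0 ≤ C ∧ ∀ k t, ‖a k t‖ ≤ C * ((wt k)⁻¹) ^ 3 := by
  simpa using ha.bound 0

lemma RD.summable_norm {a : Sq} (ha : RD a) (t : ℝ) : Summable (fun k => ‖a k t‖) := by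
  obtain ⟨C, _, hC⟩ := ha.bound0
  exact Summable.of_nonneg_of_le (fun k => norm_nonneg _) (fun k => hC k t) (summable_wt.mul_left C)

lemma RD.summable {a : Sq} (ha : RD a) (t : ℝ) (x : Spc) : Summable (fun k => a k t * chr k x) := by
  apply Summable.of_norm
  simpa [norm_chr] using ha.summable_norm t

def ev (a : Sq) (t : ℝ) (x : Spc) : ℂ := ∑' k, a k t * chr k x

lemma ev_add {a b : Sq} (ha : RD a) (hb : RD b) (t : ℝ) (x : Spc) :
    ev (fun k t => a k t + b k t) t x = ev a t x + ev b t x := by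
  rw [ev, ev, ev, ← (ha.summable t x).tsum_add (hb.summable t x)]
  congr 1; funext k; ring

lemma ev_smul (c : ℂ) (a : Sq) (t : ℝ) (x : Spc) :
    ev (fun k t => c * a k t) t x = c * ev a t x := by
  rw [ev, ev, ← tsum_mul_left]
  congr 1; funext k; ring

lemma ev_cj (a : Sq) (t : ℝ) (x : Spc) : ev (cj a) t x = conj (ev a t x) := by
  rw [ev, ev, Complex.conj_tsum, ← (Equiv.neg Lat).tsum_eq]
  congr 1; funext k
  simp [cj, chr_neg]

lemma ev_per (a : Sq) (t : ℝ) : Per (ev a t) := by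
  intro x k
  unfold ev
  congr 1; funext m
  rw [chr_per m x k]

def cv (a b : Sq) : Sq := fun k t => ∑' m, a m t * b (k - m) t

lemma cv_bound {a b : Sq} (ha : RD a) (hb : RD b) (s : ℕ) : ∃ C : ℝ, 0 ≤ C ∧ ∀ k m t,
    ‖a m t * b (k - m) t‖ * wt k ^ s ≤ C * ((wt m)⁻¹)^3 := by
  obtain ⟨C, hC0, hC⟩ := ha.bound s
  obtain ⟨D, hD⟩ := hb s
  have hD0 : 0 ≤ D := le_trans (by have := wt_pos 0; positivity) (hD 0 0)
  refine ⟨2 ^ s * C * D, by positivity, fun k m t => ?_⟩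
  have hw := wt_pos m
  have hw1 := wt_pos k
  have hw' := wt_pos (k - m)
  rw [norm_mul]
  calc ‖a m t‖ * ‖b (k - m) t‖ * wt k ^ s
      ≤ ‖a m t‖ * ‖b (k - m) t‖ * (2 * wt (k - m) * wt m) ^ s := by gcongr; exact wt_le_sub k m
    _ = 2 ^ s * ((‖a m t‖ * wt m ^ s) * (‖b (k - m) t‖ * wt (k - m) ^ s)) := by
        rw [mul_pow, mul_pow]; ring
    _ ≤ 2 ^ s * ((C * ((wt m)⁻¹)^3) * D) := by
        refine mul_le_mul_of_nonneg_left (mul_le_mul (hC m t) (hD _ t) (by positivity) (by positivity))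
          (by positivity)
    _ = _ := by ring

lemma cv_summable {a b : Sq} (ha : RD a) (hb : RD b) (k : Lat) (t : ℝ) :
    Summable fun m => a m t * b (k - m) t := by
  obtain ⟨C, _, hC⟩ := cv_bound ha hb 0
  refine Summable.of_norm_bounded (summable_wt.mul_left C) (fun m => ?_)
  simpa using hC k m t

lemma RD.cv {a b : Sq} (ha : RD a) (hb : RD b) : RD (cv a b) := by
  intro s
  obtain ⟨C, _, hC⟩ := cv_bound ha hb s
  refine ⟨∑' m, C * ((wt m)⁻¹)^3, fun k t => ?_⟩
  have hw := wt_pos k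
  have e : ‖TE.cv a b k t‖ * wt k ^ s = ‖∑' m, (a m t * b (k - m) t) * ((wt k ^ s : ℝ) : ℂ)‖ := by
    rw [tsum_mul_right, norm_mul, Complex.norm_real, Real.norm_of_nonneg (by positivity)]; rfl
  rw [e]
  refine tsum_of_norm_bounded (summable_wt.mul_left C).hasSum fun m => ?_
  rw [norm_mul, Complex.norm_real, Real.norm_of_nonneg (by positivity)]
  exact hC k m t

lemma cv_hasDerivAt {a b : Sq} (ha : SSn 1 a) (hb : SSn 1 b) (k : Lat) (t : ℝ) :
    HasDerivAt (cv a b k) (cv (fun k => deriv (a k)) b k t + cv a (fun k => deriv (b k)) k t) t := by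
  have ha' := ha.2.2.rd
  have hb' := hb.2.2.rd
  obtain ⟨C, _, hC⟩ := cv_bound ha' hb.rd 0
  obtain ⟨D, _, hD⟩ := cv_bound ha.rd hb' 0
  have key := hasDerivAt_tsum (𝕜 := ℝ) (g := fun m t => a m t * b (k - m) t)
    (g' := fun m t => deriv (a m) t * b (k - m) t + a m t * deriv (b (k - m)) t)
    (u := fun m => C * ((wt m)⁻¹)^3 + D * ((wt m)⁻¹)^3) (y₀ := t)
    ((summable_wt.mul_left C).add (summable_wt.mul_left D))
    (fun m y => ((ha.1 m) y).hasDerivAt.mul ((hb.1 (k - m)) y).hasDerivAt)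
    (fun m y => (norm_add_le _ _).trans (add_le_add (by simpa using hC k m y) (by simpa using hD k m y)))
    (cv_summable ha.rd hb.rd k t) t
  rw [Summable.tsum_add (cv_summable ha' hb.rd k t) (cv_summable ha.rd hb' k t)] at key
  exact key

lemma SSn.mono {n m : ℕ} (h : m ≤ n) {a : Sq} (ha : SSn n a) : SSn m a := by
  induction h with
  | refl => exact ha
  | step _ ih => exact ih ha.pred

lemma SSn.cv {n : ℕ} : ∀ {a b : Sq}, SSn n a → SSn n b → SSn n (cv a b) := by
  induction n with
  | zero =>
    intro a b ha hb
    refine ⟨fun k => ?_, ha.2.cv hb.2⟩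
    obtain ⟨C, _, hC⟩ := cv_bound ha.rd hb.rd 0
    exact continuous_tsum (fun m => (ha.1 m).mul (hb.1 (k - m))) (summable_wt.mul_left C)
      (fun m t => by simpa using hC k m t)
  | succ n ih =>
    intro a b ha hb
    have ha1 := ha.mono (m := 1) (by omega)
    have hb1 := hb.mono (m := 1) (by omega)
    refine ⟨fun k t => (cv_hasDerivAt ha1 hb1 k t).differentiableAt, ha.2.1.cv hb.2.1, ?_⟩
    have : (fun k => deriv (TE.cv a b k)) = fun k t => TE.cv (fun k => deriv (a k)) b k t +
        TE.cv a (fun k => deriv (b k)) k t := by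
      funext k t
      exact (cv_hasDerivAt ha1 hb1 k t).deriv
    rw [this]
    exact (ih ha.2.2 hb.pred).add (ih ha.pred hb.2.2)

lemma ev_cv {a b : Sq} (ha : RD a) (hb : RD b) (t : ℝ) (x : Spc) :
    ev (cv a b) t x = ev a t x * ev b t x := by
  have hs1 : Summable fun k => ‖a k t * chr k x‖ := (ha.summable t x).norm
  have hs2 : Summable fun k => ‖b k t * chr k x‖ := (hb.summable t x).norm
  rw [ev, ev, ev, tsum_mul_tsum_of_summable_norm hs1 hs2]
  let e : Lat × Lat ≃ Lat × Lat :=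
    { toFun := fun p => (p.2, p.1 - p.2)
      invFun := fun p => (p.1 + p.2, p.1)
      left_inv := fun p => by simp
      right_inv := fun p => by simp }
  have hsum := summable_mul_of_summable_norm hs1 hs2
  have h2 : Summable (fun c : Lat × Lat => a (e c).1 t * chr (e c).1 x * (b (e c).2 t * chr (e c).2 x)) :=
    e.summable_iff.mpr hsum
  rw [← e.tsum_eq, Summable.tsum_prod h2]
  congr 1; funext k
  rw [cv, ← tsum_mul_right]
  congr 1; funext m
  simp only [e, Equiv.coe_fn_mk]
  have : chr k x = chr m x * chr (k - m) x := by rw [← chr_add]; congr 1; abel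
  rw [this]; ring

def dsym (j : Fin 3) (k : Lat) : ℂ := 2 * Real.pi * Complex.I * (k j : ℂ)

lemma norm_dsym (j : Fin 3) (k : Lat) : ‖dsym j k‖ ≤ 7 * wt k := by
  have h : ‖dsym j k‖ = 2 * Real.pi * |(k j : ℝ)| := by
    simp [dsym, abs_of_pos Real.pi_pos]
  rw [h]
  have := Real.pi_lt_d2
  have := abs_le_wt k j
  have := abs_nonneg (k j : ℝ)
  nlinarith [Real.pi_pos]

lemma dsym_pg (j : Fin 3) : PG (dsym j) := ⟨7, 1, by norm_num, fun k => by simpa using norm_dsym j k⟩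

def termD (a : Sq) (k : Lat) (q : ℝ × Spc) : ℝ × Spc →L[ℝ] ℂ :=
  (ContinuousLinearMap.fst ℝ ℝ Spc).smulRight (deriv (a k) q.1 * chr k q.2) +
   ∑ j, (((ContinuousLinearMap.proj j : Spc →L[ℝ] ℝ).comp (ContinuousLinearMap.snd ℝ ℝ Spc)).smulRight
     (dsym j k * a k q.1 * chr k q.2))

def evD (a : Sq) (q : ℝ × Spc) : ℝ × Spc →L[ℝ] ℂ :=
  (ContinuousLinearMap.fst ℝ ℝ Spc).smulRight (ev (fun k => deriv (a k)) q.1 q.2) +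
   ∑ j, (((ContinuousLinearMap.proj j : Spc →L[ℝ] ℝ).comp (ContinuousLinearMap.snd ℝ ℝ Spc)).smulRight
     (ev (fun k t => dsym j k * a k t) q.1 q.2))

lemma hasFDerivAt_term (a : Sq) (ha : ∀ k, Differentiable ℝ (a k)) (k : Lat) (q : ℝ × Spc) :
    HasFDerivAt (fun q : ℝ × Spc => a k q.1 * chr k q.2) (termD a k q) q := by
  have h1 : HasFDerivAt (fun q : ℝ × Spc => a k q.1) _ q :=
    ((ha k) q.1).hasDerivAt.hasFDerivAt.comp q (hasFDerivAt_fst (𝕜 := ℝ) (E := ℝ) (F := Spc) (p := q))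
  have h2 : HasFDerivAt (fun q : ℝ × Spc => chr k q.2) _ q :=
    (chr_hasFDerivAt k q.2).comp q (hasFDerivAt_snd (𝕜 := ℝ) (E := ℝ) (F := Spc) (p := q))
  refine (h1.mul h2).congr_fderiv ?_
  apply ContinuousLinearMap.ext; intro w
  simp [termD, chrD, lf_apply, dsym, Fin.sum_univ_three]
  ring

lemma hasFDerivAt_ev {a : Sq} (ha : SSn 1 a) (q : ℝ × Spc) :
    HasFDerivAt (fun q : ℝ × Spc => ev a q.1 q.2) (evD a q) q := by
  have ha' := ha.2.2.rd
  obtain ⟨C, _, hC⟩ := ha'.bound0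
  obtain ⟨D, _, hD⟩ := ha.rd.bound 1
  have nb : ∀ (f : ℝ × Spc →L[ℝ] ℝ), ‖f‖ ≤ 1 → ∀ c : ℂ, ‖f.smulRight c‖ ≤ ‖c‖ := by
    intro f hf c
    rw [ContinuousLinearMap.norm_smulRight_apply]
    exact mul_le_of_le_one_left (norm_nonneg _) hf
  have hp : ∀ j, ‖(ContinuousLinearMap.proj j : Spc →L[ℝ] ℝ).comp (ContinuousLinearMap.snd ℝ ℝ Spc)‖ ≤ 1 := by
    intro j
    refine ContinuousLinearMap.opNorm_le_bound _ zero_le_one fun w => ?_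
    rw [one_mul]
    exact (norm_le_pi_norm w.2 j).trans (norm_snd_le w)
  have key := hasFDerivAt_tsum (𝕜 := ℝ) (f := fun k (q : ℝ × Spc) => a k q.1 * chr k q.2)
    (f' := termD a) (u := fun k => C * ((wt k)⁻¹)^3 + 21 * (D * ((wt k)⁻¹)^3)) (x₀ := q)
    ((summable_wt.mul_left C).add ((summable_wt.mul_left D).mul_left 21))
    (fun k q => hasFDerivAt_term a ha.1 k q) (fun k q => by
      refine (norm_add_le _ _).trans (add_le_add ?_ ?_)
      · refine (nb _ (ContinuousLinearMap.norm_fst_le ..) _).trans ?_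
        rw [norm_mul, norm_chr, mul_one]; exact hC k q.1
      · refine (norm_sum_le _ _).trans ?_
        calc _ ≤ ∑ j : Fin 3, 7 * (‖a k q.1‖ * wt k ^ 1) := by
              apply Finset.sum_le_sum
              intro j _
              refine (nb _ (hp j) _).trans ?_
              rw [norm_mul, norm_chr, mul_one, norm_mul]
              have := norm_dsym j k
              nlinarith [norm_nonneg (a k q.1)]
          _ = 21 * (‖a k q.1‖ * wt k ^ 1) := by simp; ring
          _ ≤ _ := mul_le_mul_of_nonneg_left (hD k q.1) (by norm_num))
    (ha.rd.summable q.1 q.2) q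
  refine key.congr_fderiv ?_
  refine HasSum.tsum_eq ?_
  have hL : ∀ (f : ℝ × Spc →L[ℝ] ℝ) (g : Lat → ℂ) , Summable g →
      HasSum (fun k => f.smulRight (g k)) (f.smulRight (∑' k, g k)) := by
    intro f g hg
    exact (ContinuousLinearMap.smulRightL ℝ (ℝ × Spc) ℂ f).hasSum hg.hasSum
  refine HasSum.add (hL _ _ (ha'.summable q.1 q.2)) (hasSum_sum fun j _ => hL _ _ ?_)
  exact (ha.rd.mult (dsym_pg j)).summable q.1 q.2

lemma continuous_ev {a : Sq} (ha : SSn 0 a) : Continuous (fun q : ℝ × Spc => ev a q.1 q.2) := by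
  obtain ⟨C, _, hC⟩ := ha.rd.bound0
  refine continuous_tsum (fun k => ?_) (summable_wt.mul_left C) (fun k q => ?_)
  · exact ((ha.1 k).comp continuous_fst).mul ((chr_continuous k).comp continuous_snd)
  · rw [norm_mul, norm_chr, mul_one]; exact hC k q.1

lemma contDiff_evn {n : ℕ} : ∀ {a : Sq}, SSn n a → ContDiff ℝ n (fun q : ℝ × Spc => ev a q.1 q.2) := by
  induction n with
  | zero => intro a ha; exact contDiff_zero.2 (continuous_ev ha)
  | succ n ih =>
    intro a ha
    have h1 := ha.mono (m := 1) (by omega)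
    rw [Nat.cast_add, Nat.cast_one, contDiff_succ_iff_hasFDerivAt]
    · refine ⟨evD a, ?_, hasFDerivAt_ev h1⟩
      have hR : ∀ (f : ℝ × Spc →L[ℝ] ℝ) (g : ℝ × Spc → ℂ), ContDiff ℝ n g →
          ContDiff ℝ n fun q => f.smulRight (g q) := by
        intro f g hg
        exact (ContinuousLinearMap.smulRightL ℝ (ℝ × Spc) ℂ f).contDiff.comp hg
      refine ContDiff.add (hR _ _ (ih ha.2.2)) (ContDiff.sum fun j _ => hR _ _ (ih ?_))
      exact (ha.pred).mult (dsym_pg j)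

lemma SS.contDiff {a : Sq} (ha : SS a) : ContDiff ℝ (⊤ : ℕ∞) (fun q : ℝ × Spc => ev a q.1 q.2) := by
  rw [contDiff_infty]
  exact fun n => contDiff_evn (ha n)

lemma pt_ev {a : Sq} (ha : SSn 1 a) (t : ℝ) (x : Spc) :
    HasDerivAt (fun s => ev a s x) (ev (fun k => deriv (a k)) t x) t := by
  have h := (hasFDerivAt_ev ha (t, x)).comp_hasDerivAt t ((hasDerivAt_id t).prodMk (hasDerivAt_const t x))
  have e : evD a (t, x) ((1 : ℝ), (0 : Spc)) = ev (fun k => deriv (a k)) t x := by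
    simp [evD]
  exact e ▸ h

lemma fd_ev {a : Sq} (ha : SSn 1 a) (t : ℝ) (x : Spc) :
    HasFDerivAt (fun y => ev a t y) ((evD a (t, x)).comp (ContinuousLinearMap.inr ℝ ℝ Spc)) x := by
  have h := (hasFDerivAt_ev ha (t, x)).comp x ((hasFDerivAt_const t x).prodMk (hasFDerivAt_id x))
  exact h

lemma pd_ev (a : Sq) (t : ℝ) (x : Spc) (j : Fin 3) :
    ((evD a (t, x)).comp (ContinuousLinearMap.inr ℝ ℝ Spc)) (Pi.single j 1) =
      ev (fun k t => dsym j k * a k t) t x := by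
  simp [evD, Pi.single_apply]

lemma SS.deriv {a : Sq} (ha : SS a) : SS (fun k => deriv (a k)) := fun n => (ha (n+1)).2.2
lemma SS.add {a b : Sq} (ha : SS a) (hb : SS b) : SS (fun k t => a k t + b k t) :=
  fun n => (ha n).add (hb n)
lemma SS.mult {m : Lat → ℂ} (hm : PG m) {a : Sq} (ha : SS a) : SS (fun k t => m k * a k t) :=
  fun n => (ha n).mult hm
lemma SS.cj {a : Sq} (ha : SS a) : SS (cj a) := fun n => (ha n).cj
lemma SS.cv {a b : Sq} (ha : SS a) (hb : SS b) : SS (cv a b) := fun n => (ha n).cv (hb n)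
lemma SS.rd {a : Sq} (ha : SS a) : RD a := (ha 0).rd

end TE

namespace TE
open scoped ComplexConjugate Pointwise

lemma Tdom_fd : IsAddFundamentalDomain (Submodule.span ℤ (Set.range (Pi.basisFun ℝ (Fin 3)))) Tdom
    (volume : Measure Spc) := by
  have := ZSpan.isAddFundamentalDomain (Pi.basisFun ℝ (Fin 3)) (volume : Measure Spc)
  rwa [ZSpan.fundamentalDomain_pi_basisFun] at this

lemma Per_vadd {α : Type*} {f : Spc → α} (hf : Per f)
    (g : Submodule.span ℤ (Set.range (Pi.basisFun ℝ (Fin 3)))) (x : Spc) : f (g +ᵥ x) = f x := by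
  have hg := ((Pi.basisFun ℝ (Fin 3)).mem_span_iff_repr_mem ℤ (g : Spc)).1 g.2
  choose n hn using hg
  have := hf x n
  rw [← this]
  congr 1
  funext i
  have h := hn i
  simp at h
  show (g : Spc) i + x i = _
  rw [← h]; simp [add_comm]

lemma Tdom_meas : MeasurableSet Tdom :=
  MeasurableSet.univ_pi fun _ => measurableSet_Ico

lemma Tdom_vol : volume Tdom = 1 := by
  rw [Tdom, Real.volume_pi_Ico]; simp

lemma Tdom_vol' : volume.real Tdom = 1 := by
  simp [Measure.real, Tdom_vol]

instance : IsFiniteMeasure (volume.restrict Tdom) := ⟨by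
  rw [Measure.restrict_apply_univ, Tdom_vol]; exact ENNReal.one_lt_top⟩

instance : IsProbabilityMeasure (volume.restrict Tdom) := ⟨by
  rw [Measure.restrict_apply_univ, Tdom_vol]⟩

lemma Tdom_sub : Tdom ⊆ Set.Icc (0 : Spc) 1 := by
  intro x hx
  refine ⟨fun i => (hx i trivial).1, fun i => (hx i trivial).2.le⟩

instance : VAddInvariantMeasure (Submodule.span ℤ (Set.range (Pi.basisFun ℝ (Fin 3)))) Spc volume :=
  ⟨fun c _ _ => measure_preimage_add volume (c : Spc) _⟩

lemma int_translate {E : Type*} [NormedAddCommGroup E] [NormedSpace ℝ E] {f : Spc → E} (hf : Per f)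
    (y : Spc) : ∫ x in Tdom, f (x + y) = ∫ x in Tdom, f x := by
  have h2 : IsAddFundamentalDomain (Submodule.span ℤ (Set.range (Pi.basisFun ℝ (Fin 3))))
    (y +ᵥ Tdom) (volume : Measure Spc) := Tdom_fd.vadd_of_comm y
  rw [Tdom_fd.setIntegral_eq h2 (fun g x => Per_vadd hf g x)]
  have h3 : (y +ᵥ Tdom) = (fun x => x + y) '' Tdom := by
    ext z
    simp only [Set.mem_vadd_set, Set.mem_image, vadd_eq_add, add_comm]
  rw [h3, (measurePreserving_add_right volume y).setIntegral_image_emb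
    (measurableEmbedding_addRight y)]

lemma cont_integrable {E : Type*} [NormedAddCommGroup E] {f : Spc → E}
    (hf : Continuous f) : IntegrableOn f Tdom :=
  (hf.continuousOn.integrableOn_compact isCompact_Icc).mono_set Tdom_sub

lemma int_chr_zero : ∫ x in Tdom, chr 0 x = 1 := by
  simp [chr_zero]

lemma int_chr {k : Lat} (hk : k ≠ 0) : ∫ x in Tdom, chr k x = 0 := by
  obtain ⟨j, hj⟩ : ∃ j, k j ≠ 0 := by
    by_contra h
    push Not at h
    exact hk (funext h)
  have hj' : (k j : ℝ) ≠ 0 := by exact_mod_cast hj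
  let y : Spc := Pi.single j (1 / (2 * (k j : ℝ)))
  have h1 := int_translate (chr_per k) y
  simp only [chr_add_right] at h1
  rw [integral_mul_const] at h1
  have h2 : chr k y = -1 := by
    rw [chr, ← lf_apply]
    have : lf k y = 1/2 := by
      simp only [lf_apply, y, Pi.single_apply, mul_ite, mul_zero, Finset.sum_ite_eq', Finset.mem_univ, if_true]
      field_simp
    rw [this]
    rw [show ((2 * Real.pi * (1/2) : ℝ) : ℂ) = Real.pi by push_cast; ring]
    exact Complex.exp_pi_mul_I
  rw [h2] at h1
  have : (2 : ℂ) * ∫ x in Tdom, chr k x = 0 := by linear_combination -h1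
  simpa using this

lemma int_ev {a : Sq} (ha : RD a) (t : ℝ) : ∫ x in Tdom, ev a t x = a 0 t := by
  unfold ev
  rw [← integral_tsum_of_summable_integral_norm]
  · rw [tsum_eq_single 0]
    · rw [integral_const_mul, int_chr_zero, mul_one]
    · intro k hk
      rw [integral_const_mul, int_chr hk, mul_zero]
  · intro k
    exact (cont_integrable (chr_continuous k)).const_mul _
  · simpa [norm_chr, Tdom_vol'] using ha.summable_norm t

lemma ev_shift (a : Sq) (k : Lat) (t : ℝ) (x : Spc) :
    ev a t x * chr (-k) x = ev (fun m t => a (m + k) t) t x := by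
  unfold ev
  rw [← tsum_mul_right, ← (Equiv.addRight k).tsum_eq]
  congr 1; funext m
  rw [mul_assoc, ← chr_add]
  simp

lemma RD.shift {a : Sq} (ha : RD a) (k : Lat) : RD (fun m t => a (m + k) t) := by
  intro s
  obtain ⟨C, hC⟩ := ha s
  refine ⟨(2 * wt k) ^ s * C, fun m t => ?_⟩
  have h1 : wt m ≤ (2 * wt k) * wt (m + k) := by
    have := wt_add_le (m + k) (-k)
    rw [wt_neg] at this
    simp only [add_neg_cancel_right] at this
    linarith
  have := wt_pos m
  have := wt_pos k
  calc ‖a (m + k) t‖ * wt m ^ s ≤ ‖a (m+k) t‖ * ((2 * wt k) * wt (m + k)) ^ s := by gcongr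
    _ = (2 * wt k) ^ s * (‖a (m+k) t‖ * wt (m+k) ^ s) := by rw [mul_pow]; ring
    _ ≤ _ := by gcongr; exact hC _ t

def hat (f : ℝ → Spc → ℂ) : Sq := fun k t => ∫ x in Tdom, f t x * chr (-k) x

lemma hat_ev {a : Sq} (ha : RD a) : hat (ev a) = a := by
  funext k t
  unfold hat
  simp only [ev_shift]
  rw [int_ev (ha.shift k)]
  simp

/-- smooth, periodic, with compact support in time -/
structure CS (f : ℝ → Spc → ℂ) : Prop where
  smooth : ContDiff ℝ (⊤ : ℕ∞) (fun q : ℝ × Spc => f q.1 q.2)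
  per : ∀ t, Per (f t)
  supp : ∃ R : ℝ, ∀ t, R ≤ |t| → ∀ x, f t x = 0

def pdc (j : Fin 3) (f : ℝ → Spc → ℂ) : ℝ → Spc → ℂ := fun t => pd j (f t)

lemma smooth_slice {E : Type*} [NormedAddCommGroup E] [NormedSpace ℝ E] {f : ℝ → Spc → E}
    (hf : ContDiff ℝ (⊤ : ℕ∞) (fun q : ℝ × Spc => f q.1 q.2))
    (t : ℝ) : ContDiff ℝ (⊤ : ℕ∞) (f t) :=
  hf.comp (contDiff_const.prodMk contDiff_id)

lemma pd_joint {E : Type*} [NormedAddCommGroup E] [NormedSpace ℝ E] {f : ℝ → Spc → E}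
    (hf : ContDiff ℝ (⊤ : ℕ∞) (fun q : ℝ × Spc => f q.1 q.2))
    (j : Fin 3) (t : ℝ) (x : Spc) :
    pd j (f t) x = fderiv ℝ (fun q : ℝ × Spc => f q.1 q.2) (t, x) (0, Pi.single j 1) := by
  have h1 : HasFDerivAt (fun q : ℝ × Spc => f q.1 q.2) _ (t, x) :=
    (hf.differentiable (by simp) (t, x)).hasFDerivAt
  have h := h1.comp x ((hasFDerivAt_const t x).prodMk (hasFDerivAt_id x))
  have h2 : HasFDerivAt (f t) _ x := h
  rw [pd, h2.fderiv]
  rfl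

lemma pt_joint {E : Type*} [NormedAddCommGroup E] [NormedSpace ℝ E] {f : ℝ → Spc → E}
    (hf : ContDiff ℝ (⊤ : ℕ∞) (fun q : ℝ × Spc => f q.1 q.2))
    (t : ℝ) (x : Spc) :
    HasDerivAt (fun s => f s x) (fderiv ℝ (fun q : ℝ × Spc => f q.1 q.2) (t, x) (1, 0)) t := by
  have h1 : HasFDerivAt (fun q : ℝ × Spc => f q.1 q.2) _ (t, x) :=
    (hf.differentiable (by simp) (t, x)).hasFDerivAt
  exact h1.comp_hasDerivAt t ((hasDerivAt_id t).prodMk (hasDerivAt_const t x))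

lemma pd_smooth {E : Type*} [NormedAddCommGroup E] [NormedSpace ℝ E] {f : ℝ → Spc → E}
    (hf : ContDiff ℝ (⊤ : ℕ∞) (fun q : ℝ × Spc => f q.1 q.2)) (j : Fin 3) :
    ContDiff ℝ (⊤ : ℕ∞) (fun q : ℝ × Spc => pd j (f q.1) q.2) := by
  simp only [pd_joint hf]
  exact (hf.fderiv_right (m := (⊤ : ℕ∞)) (by simp)).clm_apply contDiff_const

lemma pt_smooth {E : Type*} [NormedAddCommGroup E] [NormedSpace ℝ E] {f : ℝ → Spc → E}
    (hf : ContDiff ℝ (⊤ : ℕ∞) (fun q : ℝ × Spc => f q.1 q.2)) :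
    ContDiff ℝ (⊤ : ℕ∞) (fun q : ℝ × Spc => pt f q.1 q.2) := by
  have : (fun q : ℝ × Spc => pt f q.1 q.2) = fun q => fderiv ℝ (fun q : ℝ × Spc => f q.1 q.2) q (1, 0) := by
    funext q; exact (pt_joint hf q.1 q.2).deriv
  rw [this]
  exact (hf.fderiv_right (m := (⊤ : ℕ∞)) (by simp)).clm_apply contDiff_const

lemma pd_per {E : Type*} [NormedAddCommGroup E] [NormedSpace ℝ E] {g : Spc → E} (hg : Per g)
    (j : Fin 3) : Per (pd j g) := by
  intro x k
  have : g = fun y => g (y + fun i => (k i : ℝ)) := by funext y; exact (hg y k).symm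
  unfold pd
  have h2 : fderiv ℝ g x = fderiv ℝ g (x + fun i => (k i : ℝ)) := by
    conv_lhs => rw [this]
    exact fderiv_comp_add_right _
  rw [h2]; rfl

lemma pt_per {E : Type*} [NormedAddCommGroup E] [NormedSpace ℝ E] {f : ℝ → Spc → E}
    (hf : ∀ t, Per (f t)) (t : ℝ) : Per (pt f t) := by
  intro x k
  unfold pt
  congr 1; funext s
  exact hf s x k

lemma CS.pdc {f : ℝ → Spc → ℂ} (hf : CS f) (j : Fin 3) : CS (pdc j f) := by
  refine ⟨pd_smooth hf.smooth j, fun t => pd_per (hf.per t) j, ?_⟩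
  obtain ⟨R, hR⟩ := hf.supp
  refine ⟨R, fun t ht x => ?_⟩
  have : f t = fun _ => 0 := funext (hR t ht)
  simp [TE.pdc, pd, this]

lemma CS.pt {f : ℝ → Spc → ℂ} (hf : CS f) : CS (pt f) := by
  refine ⟨pt_smooth hf.smooth, pt_per hf.per, ?_⟩
  obtain ⟨R, hR⟩ := hf.supp
  refine ⟨R + 1, fun t ht x => ?_⟩
  have : (fun s => f s x) =ᶠ[nhds t] fun _ => 0 := by
    have ho : IsOpen {s : ℝ | R < |s|} := isOpen_lt continuous_const continuous_abs
    filter_upwards [ho.mem_nhds (show R < |t| by linarith)] with s hs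
    exact hR s (le_of_lt hs) x
  unfold _root_.pt
  rw [this.deriv_eq]; simp

lemma CS.sub {f g : ℝ → Spc → ℂ} (hf : CS f) (hg : CS g) : CS (fun t x => f t x - g t x) := by
  refine ⟨hf.smooth.sub hg.smooth, fun t x k => ?_, ?_⟩
  · show f t _ - g t _ = _
    rw [hf.per t x k, hg.per t x k]
  · obtain ⟨R, hR⟩ := hf.supp
    obtain ⟨R', hR'⟩ := hg.supp
    refine ⟨max R R', fun t ht x => ?_⟩
    rw [hR t (le_trans (le_max_left _ _) ht), hR' t (le_trans (le_max_right _ _) ht), sub_zero]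

lemma CS.smul {f : ℝ → Spc → ℂ} (hf : CS f) (c : ℂ) : CS (fun t x => c * f t x) := by
  refine ⟨contDiff_const.mul hf.smooth, fun t x k => ?_, ?_⟩
  · show c * f t _ = _
    rw [hf.per t x k]
  · obtain ⟨R, hR⟩ := hf.supp
    exact ⟨R, fun t ht x => by rw [hR t ht, mul_zero]⟩

lemma CS.bdd {f : ℝ → Spc → ℂ} (hf : CS f) : ∃ C : ℝ, ∀ t, ∀ x ∈ Set.Icc (0 : Spc) 1, ‖f t x‖ ≤ C := by
  obtain ⟨R, hR⟩ := hf.supp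
  obtain ⟨C, hC⟩ := ((isCompact_Icc (a := -R) (b := R)).prod (isCompact_Icc (a := (0 : Spc)) (b := 1))).exists_bound_of_continuousOn
    hf.smooth.continuous.continuousOn
  refine ⟨max C 0, fun t x hx => ?_⟩
  by_cases h : R ≤ |t|
  · rw [hR t h]; simp
  · push Not at h
    exact (hC (t, x) ⟨abs_le.1 h.le, hx⟩).trans (le_max_left _ _)

lemma hat_bdd {f : ℝ → Spc → ℂ} (hf : CS f) : ∃ C : ℝ, ∀ k t, ‖hat f k t‖ ≤ C := by
  obtain ⟨C, hC⟩ := hf.bdd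
  refine ⟨C, fun k t => ?_⟩
  have := norm_setIntegral_le_of_norm_le_const (μ := volume) (s := Tdom) (f := fun x => f t x * chr (-k) x)
    (C := C) (by rw [Tdom_vol]; exact ENNReal.one_lt_top) (fun x hx => by
      rw [norm_mul, norm_chr, mul_one]; exact hC t x (Tdom_sub hx))
  rwa [Tdom_vol', mul_one] at this

/-- differentiation under the integral over the fundamental domain -/
lemma hasDerivAt_int {E : Type*} [NormedAddCommGroup E] [NormedSpace ℝ E] {F F' : ℝ → Spc → E}
    (hF : Continuous (fun q : ℝ × Spc => F q.1 q.2))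
    (hF' : Continuous (fun q : ℝ × Spc => F' q.1 q.2))
    (hd : ∀ t x, HasDerivAt (fun s => F s x) (F' t x) t) (t : ℝ) :
    HasDerivAt (fun s => ∫ x in Tdom, F s x) (∫ x in Tdom, F' t x) t := by
  obtain ⟨C, hC⟩ := ((isCompact_Icc (a := t - 1) (b := t + 1)).prod (isCompact_Icc (a := (0 : Spc)) (b := 1))).exists_bound_of_continuousOn
    hF'.continuousOn
  have hs : ∀ s, Continuous (F s) := fun s => hF.comp (continuous_const.prodMk continuous_id)
  have hs' : ∀ s, Continuous (F' s) := fun s => hF'.comp (continuous_const.prodMk continuous_id)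
  refine (hasDerivAt_integral_of_dominated_loc_of_deriv_le (μ := volume.restrict Tdom) (s := Set.Icc (t-1) (t+1))
    (F := F) (F' := F') (bound := fun _ => C) (x₀ := t) (Icc_mem_nhds (by linarith) (by linarith)) ?_ ?_ ?_ ?_ ?_ ?_).2
  · exact Filter.Eventually.of_forall fun s => (cont_integrable (hs s)).aestronglyMeasurable
  · exact cont_integrable (hs t)
  · exact (cont_integrable (hs' t)).aestronglyMeasurable
  · rw [ae_restrict_iff' Tdom_meas]
    exact Filter.Eventually.of_forall fun x hx s hs => hC (s, x) ⟨hs, Tdom_sub hx⟩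
  · exact integrable_const C
  · exact Filter.Eventually.of_forall fun x s _ => hd s x

lemma int_pd {E : Type*} [NormedAddCommGroup E] [NormedSpace ℝ E] {g : Spc → E} (hg : ContDiff ℝ (⊤ : ℕ∞) g)
    (hp : Per g) (j : Fin 3) : ∫ x in Tdom, pd j g x = 0 := by
  have hc : Continuous (pd j g) := by
    unfold pd
    exact (hg.continuous_fderiv (by simp)).clm_apply continuous_const
  have h := hasDerivAt_int (F := fun s x => g (x + s • Pi.single j 1)) (F' := fun s x => pd j g (x + s • Pi.single j 1))
    (hg.continuous.comp (by fun_prop)) (hc.comp (by fun_prop)) (fun t x => by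
      have h1 : HasFDerivAt g _ (x + t • Pi.single j 1) := (hg.differentiable (by simp) _).hasFDerivAt
      have h2 : HasDerivAt (fun s : ℝ => x + s • (Pi.single j 1 : Spc)) (Pi.single j 1) t := by
        simpa using ((hasDerivAt_id t).smul_const (Pi.single j 1 : Spc)).const_add x
      exact h1.comp_hasDerivAt t h2) 0
  have h2 : (fun s : ℝ => ∫ x in Tdom, g (x + s • Pi.single j 1)) = fun _ => ∫ x in Tdom, g x := by
    funext s; exact int_translate hp _
  rw [h2] at h
  have h3 := h.unique (hasDerivAt_const (0:ℝ) (∫ x in Tdom, g x))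
  simpa using h3

lemma pd_mul {g h : Spc → ℂ} {x : Spc} (hg : DifferentiableAt ℝ g x) (hh : DifferentiableAt ℝ h x) (j : Fin 3) :
    pd j (fun y => g y * h y) x = g x * pd j h x + pd j g x * h x := by
  unfold pd
  rw [fderiv_fun_mul hg hh]
  simp; ring

lemma pd_chr (k : Lat) (j : Fin 3) (x : Spc) : pd j (chr k) x = dsym j k * chr k x := by
  rw [pd, (chr_hasFDerivAt k x).fderiv]
  simp [chrD, lf_single, dsym]
  ring

lemma dsym_neg (j : Fin 3) (k : Lat) : dsym j (-k) = - dsym j k := by simp [dsym]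

lemma hat_pd {f : ℝ → Spc → ℂ} (hf : CS f) (j : Fin 3) (k : Lat) (t : ℝ) :
    hat (pdc j f) k t = dsym j k * hat f k t := by
  have hsm := smooth_slice hf.smooth t
  have hc := chr_contDiff (-k)
  have h0 := int_pd (g := fun x => f t x * chr (-k) x) (hsm.mul hc)
    (fun x n => by show f t _ * chr (-k) _ = _; rw [hf.per t x n, chr_per (-k) x n]) j
  have h1 : ∀ x, pd j (fun x => f t x * chr (-k) x) x = pdc j f t x * chr (-k) x - dsym j k * (f t x * chr (-k) x) := by
    intro x
    rw [pd_mul (hsm.differentiable (by simp) x) (hc.differentiable (by simp) x), pd_chr, dsym_neg]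
    unfold pdc; ring
  simp only [h1] at h0
  rw [integral_sub, integral_const_mul] at h0
  · unfold hat; linear_combination h0
  · exact cont_integrable ((smooth_slice (hf.pdc j).smooth t).continuous.mul (chr_continuous _))
  · exact cont_integrable (continuous_const.mul (hsm.continuous.mul (chr_continuous _)))

lemma hat_pt {f : ℝ → Spc → ℂ} (hf : CS f) (k : Lat) (t : ℝ) :
    HasDerivAt (hat f k) (hat (pt f) k t) t := by
  refine hasDerivAt_int (F := fun s x => f s x * chr (-k) x) (F' := fun s x => pt f s x * chr (-k) x) ?_ ?_ ?_ t
  · exact hf.smooth.continuous.mul ((chr_continuous _).comp continuous_snd)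
  · exact hf.pt.smooth.continuous.mul ((chr_continuous _).comp continuous_snd)
  · intro t x
    have h := pt_joint hf.smooth t x
    have h2 : pt f t x = _ := h.deriv
    rw [h2]
    exact h.mul_const _

def lapw (f : ℝ → Spc → ℂ) : ℝ → Spc → ℂ := fun t x =>
  f t x - ((4 * Real.pi ^ 2 : ℝ) : ℂ)⁻¹ * pdc 0 (pdc 0 f) t x
   - ((4 * Real.pi ^ 2 : ℝ) : ℂ)⁻¹ * pdc 1 (pdc 1 f) t x - ((4 * Real.pi ^ 2 : ℝ) : ℂ)⁻¹ * pdc 2 (pdc 2 f) t x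

lemma CS.lapw {f : ℝ → Spc → ℂ} (hf : CS f) : CS (lapw f) :=
  ((hf.sub (((hf.pdc 0).pdc 0).smul _)).sub (((hf.pdc 1).pdc 1).smul _)).sub (((hf.pdc 2).pdc 2).smul _)

lemma hat_sub {f g : ℝ → Spc → ℂ} (hf : CS f) (hg : CS g) (k : Lat) (t : ℝ) :
    hat (fun t x => f t x - g t x) k t = hat f k t - hat g k t := by
  unfold hat
  rw [← integral_sub]
  · congr 1; funext x; ring
  · exact cont_integrable ((smooth_slice hf.smooth t).continuous.mul (chr_continuous _))
  · exact cont_integrable ((smooth_slice hg.smooth t).continuous.mul (chr_continuous _))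

lemma hat_smul (f : ℝ → Spc → ℂ) (c : ℂ) (k : Lat) (t : ℝ) :
    hat (fun t x => c * f t x) k t = c * hat f k t := by
  unfold hat
  rw [← integral_const_mul]
  congr 1; funext x; ring

lemma hat_lapw {f : ℝ → Spc → ℂ} (hf : CS f) (k : Lat) (t : ℝ) :
    hat (lapw f) k t = (wt k : ℂ) * hat f k t := by
  unfold lapw
  rw [hat_sub ((hf.sub (((hf.pdc 0).pdc 0).smul _)).sub (((hf.pdc 1).pdc 1).smul _)) (((hf.pdc 2).pdc 2).smul _),
    hat_sub (hf.sub (((hf.pdc 0).pdc 0).smul _)) (((hf.pdc 1).pdc 1).smul _),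
    hat_sub hf (((hf.pdc 0).pdc 0).smul _), hat_smul, hat_smul, hat_smul,
    hat_pd (hf.pdc 0), hat_pd (hf.pdc 1), hat_pd (hf.pdc 2), hat_pd hf, hat_pd hf, hat_pd hf]
  have hpi : (Real.pi : ℂ) ≠ 0 := by exact_mod_cast Real.pi_ne_zero
  simp only [dsym, wt, Fin.sum_univ_three]
  push_cast
  field_simp
  ring_nf
  simp only [Complex.I_sq]
  ring

lemma hat_rd {f : ℝ → Spc → ℂ} (hf : CS f) : RD (hat f) := by
  intro s
  induction s generalizing f with
  | zero => simpa using hat_bdd hf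
  | succ s ih =>
    obtain ⟨C, hC⟩ := ih hf.lapw
    refine ⟨C, fun k t => ?_⟩
    have := hC k t
    rw [hat_lapw hf, norm_mul, Complex.norm_real, Real.norm_of_nonneg (wt_pos k).le] at this
    rw [pow_succ]; linarith

lemma hat_ssn {n : ℕ} : ∀ {f : ℝ → Spc → ℂ}, CS f → SSn n (hat f) := by
  induction n with
  | zero =>
    intro f hf
    exact ⟨fun k => continuous_iff_continuousAt.2 fun t => (hat_pt hf k t).continuousAt, hat_rd hf⟩
  | succ n ih =>
    intro f hf
    refine ⟨fun k t => (hat_pt hf k t).differentiableAt, hat_rd hf, ?_⟩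
    have : (fun k => deriv (hat f k)) = hat (pt f) := by
      funext k t; exact (hat_pt hf k t).deriv
    rw [this]
    exact ih hf.pt

lemma inversion {g : Spc → ℂ} (hg : Continuous g) (hp : Per g)
    (hs : Summable fun k : Lat => ∫ x in Tdom, g x * chr (-k) x) (x : Spc) :
    g x = ∑' k : Lat, (∫ x in Tdom, g x * chr (-k) x) * chr k x := by
  let π : Spc → UnitAddTorus (Fin 3) := Pi.map (fun _ => (QuotientAddGroup.mk : ℝ → UnitAddCircle))
  have hπ : IsOpenQuotientMap π := IsOpenQuotientMap.piMap fun _ => QuotientAddGroup.isOpenQuotientMap_mk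
  let F : UnitAddTorus (Fin 3) → ℂ := fun y => g (fun i => (AddCircle.equivIco 1 0 (y i) : ℝ))
  have hF : ∀ x, F (π x) = g x := by
    intro x
    have h1 : ∀ i, (AddCircle.equivIco 1 0 (π x i) : ℝ) = x i + ((-⌊x i⌋ : ℤ) : ℝ) := by
      intro i
      have := AddCircle.coe_equivIco_mk_apply (p := (1:ℝ)) (x i)
      refine this.trans ?_
      rw [div_one, mul_one, ← Int.self_sub_floor]; push_cast; ring
    show g (fun i => _) = _
    simp only [h1]
    exact hp x (fun i => -⌊x i⌋)
  have hFc : Continuous F := by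
    rw [hπ.isQuotientMap.continuous_iff]
    have : F ∘ π = g := funext hF
    rw [this]; exact hg
  have hm : ∀ k y, UnitAddTorus.mFourier k (π y) = chr k y := by
    intro k y
    show ∏ i, fourier (k i) (π y i) = _
    have : ∀ i, (fourier (k i) (π y i) : ℂ) = Complex.exp (2 * Real.pi * Complex.I * (k i) * (y i) / (1:ℝ)) :=
      fun i => fourier_coe_apply
    simp only [this]
    rw [← Complex.exp_sum, chr]
    congr 1
    simp only [Fin.sum_univ_three]
    push_cast
    ring
  have hcoef : ∀ k, UnitAddTorus.mFourierCoeff F k = ∫ x in Tdom, g x * chr (-k) x := by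
    intro k
    rw [UnitAddTorus.mFourierCoeff_eq_integral F k 0]
    have hae : Tdom =ᵐ[volume] {x : Spc | ∀ i, x i ∈ Set.Ioc ((0 : Spc) i) ((0 : Spc) i + 1)} := by
      have e : {x : Spc | ∀ i, x i ∈ Set.Ioc ((0 : Spc) i) ((0 : Spc) i + 1)} =
          Set.univ.pi fun i => Set.Ioc ((0 : Spc) i) 1 := by ext; simp
      rw [e]
      exact Measure.univ_pi_Ico_ae_eq_Icc.trans Measure.univ_pi_Ioc_ae_eq_Icc.symm
    rw [setIntegral_congr_set hae]
    congr 1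
    funext y
    show UnitAddTorus.mFourier (-k) (π y) • F (π y) = _
    rw [hm, hF, smul_eq_mul, mul_comm]
  have h := UnitAddTorus.hasSum_mFourier_series_apply_of_summable (f := ⟨F, hFc⟩) (by
    show Summable (UnitAddTorus.mFourierCoeff F)
    rw [show UnitAddTorus.mFourierCoeff F = _ from funext hcoef]; exact hs) (π x)
  have h2 := h.tsum_eq
  rw [show (⟨F, hFc⟩ : C(UnitAddTorus (Fin 3), ℂ)) (π x) = g x from hF x] at h2
  rw [← h2]
  congr 1; funext k
  rw [hm]
  show UnitAddTorus.mFourierCoeff F k • chr k x = _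
  rw [hcoef, smul_eq_mul]

lemma CS.ss {f : ℝ → Spc → ℂ} (hf : CS f) : SS (hat f) := fun _ => hat_ssn hf

lemma CS.ev {f : ℝ → Spc → ℂ} (hf : CS f) (t : ℝ) (x : Spc) : f t x = ev (hat f) t x :=
  inversion (smooth_slice hf.smooth t).continuous (hf.per t) ((hat_rd hf).summable_norm t).of_norm x

end TE

namespace TE
open scoped ComplexConjugate

abbrev Fn : Type := ℝ → Spc → ℝ

def toC (f : Fn) : ℝ → Spc → ℂ := fun t x => (f t x : ℂ)

def IsS (f : Fn) : Prop := ∃ a, SS a ∧ toC f = ev a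

def co (f : Fn) : Sq := hat (toC f)

lemma IsS.of_ev {f : Fn} {a : Sq} (ha : SS a) (h : toC f = ev a) : IsS f ∧ co f = a := by
  refine ⟨⟨a, ha, h⟩, ?_⟩
  rw [co, h, hat_ev ha.rd]

lemma IsS.ss {f : Fn} (hf : IsS f) : SS (co f) := by
  obtain ⟨a, ha, h⟩ := hf
  rw [(IsS.of_ev ha h).2]; exact ha

lemma IsS.ev {f : Fn} (hf : IsS f) : toC f = ev (co f) := by
  obtain ⟨a, ha, h⟩ := hf
  rw [(IsS.of_ev ha h).2]; exact h

lemma IsS.ev' {f : Fn} (hf : IsS f) (t : ℝ) (x : Spc) : (f t x : ℂ) = TE.ev (co f) t x :=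
  congrFun (congrFun hf.ev t) x

lemma IsS.ext {f g : Fn} (hf : IsS f) (hg : IsS g) (h : ∀ k t, co f k t = co g k t) : f = g := by
  have h' : co f = co g := by funext k t; exact h k t
  funext t x
  have := hf.ev' t x
  rw [h', ← hg.ev' t x] at this
  exact_mod_cast this

lemma co_cj (f : Fn) (k : Lat) (t : ℝ) : co f (-k) t = conj (co f k t) := by
  unfold co hat
  rw [← integral_conj]
  congr 1; funext x
  simp [toC, chr_neg]

lemma IsS.contDiff {f : Fn} (hf : IsS f) : ContDiff ℝ (⊤ : ℕ∞) (fun q : ℝ × Spc => f q.1 q.2) := by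
  have h := hf.ss.contDiff
  have h2 := Complex.reCLM.contDiff.comp h
  have e : (fun q : ℝ × Spc => f q.1 q.2) = (Complex.reCLM ∘ fun q : ℝ × Spc => TE.ev (co f) q.1 q.2) := by
    funext q
    simp [← hf.ev']
  rw [e]; exact h2

lemma IsS.slice {f : Fn} (hf : IsS f) (t : ℝ) : ContDiff ℝ (⊤ : ℕ∞) (f t) := smooth_slice hf.contDiff t

lemma IsS.cont {f : Fn} (hf : IsS f) (t : ℝ) : Continuous (f t) := (hf.slice t).continuous

lemma IsS.per {f : Fn} (hf : IsS f) (t : ℝ) : Per (f t) := by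
  intro x k
  have := ev_per (co f) t x k
  rw [← hf.ev', ← hf.ev'] at this
  exact_mod_cast this

lemma IsS.integrable {f : Fn} (hf : IsS f) (t : ℝ) : IntegrableOn (f t) Tdom := cont_integrable (hf.cont t)

lemma co_zero (f : Fn) (t : ℝ) : co f 0 t = ((∫ x in Tdom, f t x : ℝ) : ℂ) := by
  unfold co hat
  simp only [neg_zero, chr_zero, mul_one, toC]
  exact integral_ofReal

/-- spatial derivative of a time dependent function -/
def dx (j : Fin 3) (f : Fn) : Fn := fun t => pd j (f t)

lemma IsS.diffAt {f : Fn} (hf : IsS f) (t : ℝ) (x : Spc) : DifferentiableAt ℝ (f t) x :=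
  (hf.slice t).differentiable (by simp) x

lemma IsS.hasDerivAt {f : Fn} (hf : IsS f) (t : ℝ) (x : Spc) : HasDerivAt (fun s => f s x) (pt f t x) t :=
  (pt_joint hf.contDiff t x).differentiableAt.hasDerivAt

lemma IsS.add' {f g : Fn} (hf : IsS f) (hg : IsS g) :
    IsS (f + g) ∧ co (f + g) = fun k t => co f k t + co g k t := by
  refine IsS.of_ev (hf.ss.add hg.ss) ?_
  funext t x
  rw [ev_add hf.ss.rd hg.ss.rd, ← hf.ev', ← hg.ev']
  simp [toC]

lemma pg_const (c : ℂ) : PG (fun _ => c) := ⟨‖c‖, 0, norm_nonneg _, fun k => by simp⟩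

lemma IsS.smul' {f : Fn} (hf : IsS f) (c : ℝ) :
    IsS (c • f) ∧ co (c • f) = fun k t => (c : ℂ) * co f k t := by
  refine IsS.of_ev (hf.ss.mult (pg_const c)) ?_
  funext t x
  rw [ev_smul, ← hf.ev']
  simp [toC]

lemma IsS.mul' {f g : Fn} (hf : IsS f) (hg : IsS g) :
    IsS (f * g) ∧ co (f * g) = cv (co f) (co g) := by
  refine IsS.of_ev (hf.ss.cv hg.ss) ?_
  funext t x
  rw [ev_cv hf.ss.rd hg.ss.rd, ← hf.ev', ← hg.ev']
  simp [toC]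

lemma IsS.dx' {f : Fn} (hf : IsS f) (j : Fin 3) :
    IsS (dx j f) ∧ co (dx j f) = fun k t => dsym j k * co f k t := by
  refine IsS.of_ev (hf.ss.mult (dsym_pg j)) ?_
  funext t x
  have h := fd_ev (hf.ss 1) t x
  have e : (fun y => TE.ev (co f) t y) = fun y => ((f t y : ℝ) : ℂ) := by
    funext y; exact (hf.ev' t y).symm
  rw [e] at h
  have h2 := (Complex.ofRealCLM.hasFDerivAt (x := f t x)).comp x (hf.diffAt t x).hasFDerivAt
  have h3 := h.unique h2
  rw [← pd_ev, h3]
  simp [toC, dx, pd]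

lemma IsS.pt' {f : Fn} (hf : IsS f) :
    IsS (pt f) ∧ co (pt f) = fun k => deriv (co f k) := by
  refine IsS.of_ev hf.ss.deriv ?_
  funext t x
  have h := pt_ev (hf.ss 1) t x
  have e : (fun s => TE.ev (co f) s x) = fun s => ((f s x : ℝ) : ℂ) := by
    funext s; exact (hf.ev' s x).symm
  rw [e] at h
  exact (hf.hasDerivAt t x).ofReal_comp.unique h

structure Sym (m : Lat → ℂ) : Prop where
  pg : PG m
  herm : ∀ k, m (-k) = conj (m k)

def Op (m : Lat → ℂ) (f : Fn) : Fn := fun t x => (ev (fun k t => m k * co f k t) t x).re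

lemma IsS.op' {m : Lat → ℂ} (hm : Sym m) {f : Fn} (hf : IsS f) :
    IsS (Op m f) ∧ co (Op m f) = fun k t => m k * co f k t := by
  refine IsS.of_ev (hf.ss.mult hm.pg) ?_
  funext t x
  have h := ev_cj (fun k t => m k * co f k t) t x
  have e : cj (fun k t => m k * co f k t) = fun k t => m k * co f k t := by
    funext k t
    simp [cj, hm.herm, co_cj]
  rw [e] at h
  exact (Complex.conj_eq_iff_re.1 h.symm)

lemma IsS.add {f g : Fn} (hf : IsS f) (hg : IsS g) : IsS (f + g) := (hf.add' hg).1
lemma IsS.smul {f : Fn} (hf : IsS f) (c : ℝ) : IsS (c • f) := (hf.smul' c).1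
lemma IsS.mul {f g : Fn} (hf : IsS f) (hg : IsS g) : IsS (f * g) := (hf.mul' hg).1
lemma IsS.dx {f : Fn} (hf : IsS f) (j : Fin 3) : IsS (dx j f) := (hf.dx' j).1
lemma IsS.pt {f : Fn} (hf : IsS f) : IsS (pt f) := hf.pt'.1
lemma IsS.op {m : Lat → ℂ} (hm : Sym m) {f : Fn} (hf : IsS f) : IsS (Op m f) := (hf.op' hm).1
lemma co_add {f g : Fn} (hf : IsS f) (hg : IsS g) (k : Lat) (t : ℝ) : co (f + g) k t = co f k t + co g k t := by
  rw [(hf.add' hg).2]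
lemma co_smul {f : Fn} (hf : IsS f) (c : ℝ) (k : Lat) (t : ℝ) : co (c • f) k t = c * co f k t := by
  rw [(hf.smul' c).2]
lemma co_dx {f : Fn} (hf : IsS f) (j : Fin 3) (k : Lat) (t : ℝ) : co (dx j f) k t = dsym j k * co f k t := by
  rw [(hf.dx' j).2]
lemma co_op {m : Lat → ℂ} (hm : Sym m) {f : Fn} (hf : IsS f) (k : Lat) (t : ℝ) :
    co (Op m f) k t = m k * co f k t := by
  rw [(hf.op' hm).2]
lemma co_pt {f : Fn} (hf : IsS f) (k : Lat) (t : ℝ) : co (pt f) k t = deriv (co f k) t := by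
  rw [hf.pt'.2]
lemma co_mul {f g : Fn} (hf : IsS f) (hg : IsS g) : co (f * g) = cv (co f) (co g) := (hf.mul' hg).2

lemma IsS.neg {f : Fn} (hf : IsS f) : IsS (-f) := by
  have := hf.smul (-1); simpa using this
lemma IsS.sub {f g : Fn} (hf : IsS f) (hg : IsS g) : IsS (f - g) := by
  rw [sub_eq_add_neg]; exact hf.add hg.neg
lemma co_neg {f : Fn} (hf : IsS f) (k : Lat) (t : ℝ) : co (-f) k t = - co f k t := by
  have := co_smul hf (-1) k t; simpa using this
lemma co_sub {f g : Fn} (hf : IsS f) (hg : IsS g) (k : Lat) (t : ℝ) : co (f - g) k t = co f k t - co g k t := by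
  rw [sub_eq_add_neg, co_add hf hg.neg, co_neg hg, sub_eq_add_neg]

lemma ss_zero : SS (fun _ _ => 0) := by
  intro n
  have : ∀ n, SSn n (fun _ _ => 0) := by
    intro n
    induction n with
    | zero => exact ⟨fun k => continuous_const, fun s => ⟨0, fun k t => by simp⟩⟩
    | succ n ih =>
      refine ⟨fun k => differentiable_const _, fun s => ⟨0, fun k t => by simp⟩, ?_⟩
      have e : (fun k : Lat => deriv (fun _ : ℝ => (0 : ℂ))) = fun _ _ => 0 := by funext k t; simp
      rw [e]; exact ih
  exact this n

lemma isS_zero : IsS 0 := ⟨_, ss_zero, by funext t x; simp [toC, ev]⟩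

lemma IsS.sum {ι : Type*} (s : Finset ι) {f : ι → Fn} (hf : ∀ i ∈ s, IsS (f i)) : IsS (∑ i ∈ s, f i) := by
  classical
  induction s using Finset.induction_on with
  | empty => simpa using isS_zero
  | insert i s hi ih =>
    rw [Finset.sum_insert hi]
    exact (hf i (Finset.mem_insert_self i s)).add (ih fun j hj => hf j (Finset.mem_insert_of_mem hj))

lemma co_zero' : co (0 : Fn) = fun _ _ => 0 := by
  funext k t; simp [co, hat, toC]

lemma co_sum {ι : Type*} (s : Finset ι) {f : ι → Fn} (hf : ∀ i ∈ s, IsS (f i)) (k : Lat) (t : ℝ) :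
    co (∑ i ∈ s, f i) k t = ∑ i ∈ s, co (f i) k t := by
  classical
  induction s using Finset.induction_on with
  | empty => simp [co_zero']
  | insert i s hi ih =>
    rw [Finset.sum_insert hi, Finset.sum_insert hi, co_add (hf i (Finset.mem_insert_self i s))
      (IsS.sum s fun j hj => hf j (Finset.mem_insert_of_mem hj)), ih fun j hj => hf j (Finset.mem_insert_of_mem hj)]

lemma isS_of_smooth {f : Fn} (hs : ContDiff ℝ (⊤ : ℕ∞) (fun q : ℝ × Spc => f q.1 q.2))
    (hp : ∀ t, Per (f t)) (hc : ∃ R : ℝ, ∀ t, R ≤ |t| → ∀ x, f t x = 0) : IsS f := by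
  have h : CS (toC f) := by
    refine ⟨Complex.ofRealCLM.contDiff.comp hs, fun t x k => ?_, ?_⟩
    · simp only [toC]; rw [hp t x k]
    · obtain ⟨R, hR⟩ := hc
      exact ⟨R, fun t ht x => by simp [toC, hR t ht x]⟩
  exact ⟨_, h.ss, by funext t x; exact h.ev t x⟩

/-! symbol calculus -/
lemma Sym.mul {m n : Lat → ℂ} (hm : Sym m) (hn : Sym n) : Sym (m * n) := by
  refine ⟨?_, fun k => by simp [hm.herm, hn.herm]⟩
  obtain ⟨C, p, h0, hC⟩ := hm.pg
  obtain ⟨D, q, h1, hD⟩ := hn.pg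
  refine ⟨C * D, p + q, by positivity, fun k => ?_⟩
  rw [Pi.mul_apply, norm_mul]
  have := wt_pos k
  calc _ ≤ (C * wt k ^ p) * (D * wt k ^ q) := by gcongr; exacts [hC k, hD k]
    _ = _ := by rw [pow_add]; ring

lemma Sym.add {m n : Lat → ℂ} (hm : Sym m) (hn : Sym n) : Sym (m + n) := by
  refine ⟨?_, fun k => by simp [hm.herm, hn.herm]⟩
  obtain ⟨C, p, h0, hC⟩ := hm.pg
  obtain ⟨D, q, h1, hD⟩ := hn.pg
  refine ⟨C + D, p + q, by positivity, fun k => ?_⟩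
  have h := one_le_wt k
  have e1 : wt k ^ p ≤ wt k ^ (p+q) := pow_le_pow_right₀ h (by omega)
  have e2 : wt k ^ q ≤ wt k ^ (p+q) := pow_le_pow_right₀ h (by omega)
  calc ‖m k + n k‖ ≤ ‖m k‖ + ‖n k‖ := norm_add_le _ _
    _ ≤ C * wt k ^ (p+q) + D * wt k ^ (p+q) := by
      gcongr
      · exact (hC k).trans (by gcongr)
      · exact (hD k).trans (by gcongr)
    _ = _ := by ring

lemma Sym.const (c : ℝ) : Sym (fun _ => (c : ℂ)) := ⟨pg_const c, fun k => by simp⟩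

lemma Sym.dsym (j : Fin 3) : Sym (dsym j) := ⟨dsym_pg j, fun k => by
  simp only [TE.dsym, map_mul, Complex.conj_ofReal, Complex.conj_I, map_intCast, Complex.conj_ofNat, Pi.neg_apply, Int.cast_neg]
  ring⟩

lemma Sym.smul {m : Lat → ℂ} (hm : Sym m) (c : ℝ) : Sym (fun k => (c : ℂ) * m k) := (Sym.const c).mul hm

lemma op_comp {m n : Lat → ℂ} (hm : Sym m) (hn : Sym n) {f : Fn} (hf : IsS f) :
    Op m (Op n f) = Op (m * n) f := by
  refine ((hf.op hn).op hm).ext (hf.op (hm.mul hn)) fun k t => ?_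
  rw [co_op hm (hf.op hn), co_op hn hf, co_op (hm.mul hn) hf]
  simp [mul_assoc]

lemma op_dsym {f : Fn} (hf : IsS f) (j : Fin 3) : dx j f = Op (dsym j) f :=
  (hf.dx j).ext (hf.op (Sym.dsym j)) fun k t => by rw [co_dx hf, co_op (Sym.dsym j) hf]

lemma op_congr {m n : Lat → ℂ} (h : ∀ k, m k = n k) : Op m = Op n := by rw [funext h]

lemma op_add {m : Lat → ℂ} (hm : Sym m) {f g : Fn} (hf : IsS f) (hg : IsS g) :
    Op m (f + g) = Op m f + Op m g :=
  ((hf.add hg).op hm).ext ((hf.op hm).add (hg.op hm)) fun k t => by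
    rw [co_op hm (hf.add hg), co_add hf hg, co_add (hf.op hm) (hg.op hm), co_op hm hf, co_op hm hg, mul_add]

lemma op_smul {m : Lat → ℂ} (hm : Sym m) {f : Fn} (hf : IsS f) (c : ℝ) :
    Op m (c • f) = c • Op m f :=
  ((hf.smul c).op hm).ext ((hf.op hm).smul c) fun k t => by
    rw [co_op hm (hf.smul c), co_smul hf, co_smul (hf.op hm), co_op hm hf]; ring

lemma op_neg {m : Lat → ℂ} (hm : Sym m) {f : Fn} (hf : IsS f) : Op m (-f) = - Op m f := by
  have := op_smul hm hf (-1); simpa using this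

lemma op_sub {m : Lat → ℂ} (hm : Sym m) {f g : Fn} (hf : IsS f) (hg : IsS g) :
    Op m (f - g) = Op m f - Op m g := by
  rw [sub_eq_add_neg, op_add hm hf hg.neg, op_neg hm hg, ← sub_eq_add_neg]

lemma op_sum {m : Lat → ℂ} (hm : Sym m) {ι : Type*} (s : Finset ι) {f : ι → Fn} (hf : ∀ i ∈ s, IsS (f i)) :
    Op m (∑ i ∈ s, f i) = ∑ i ∈ s, Op m (f i) :=
  ((IsS.sum s hf).op hm).ext (IsS.sum s fun i hi => (hf i hi).op hm) fun k t => by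
    rw [co_op hm (IsS.sum s hf), co_sum s hf, co_sum s fun i hi => (hf i hi).op hm, Finset.mul_sum]
    exact Finset.sum_congr rfl fun i hi => (co_op hm (hf i hi) k t).symm

lemma op_dx {m : Lat → ℂ} (hm : Sym m) {f : Fn} (hf : IsS f) (j : Fin 3) :
    Op m (dx j f) = dx j (Op m f) :=
  ((hf.dx j).op hm).ext ((hf.op hm).dx j) fun k t => by
    rw [co_op hm (hf.dx j), co_dx hf, co_dx (hf.op hm), co_op hm hf]; ring

lemma op_pt {m : Lat → ℂ} (hm : Sym m) {f : Fn} (hf : IsS f) :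
    pt (Op m f) = Op m (pt f) :=
  ((hf.op hm).pt).ext (hf.pt.op hm) fun k t => by
    rw [co_pt (hf.op hm), co_op hm hf.pt, co_pt hf, (hf.op' hm).2]
    exact deriv_const_mul _ ((hf.ss 1).1 k t)

lemma dx_comm {f : Fn} (hf : IsS f) (i j : Fin 3) : dx i (dx j f) = dx j (dx i f) :=
  ((hf.dx j).dx i).ext ((hf.dx i).dx j) fun k t => by
    rw [co_dx (hf.dx j), co_dx hf, co_dx (hf.dx i), co_dx hf]; ring

lemma pt_dx {f : Fn} (hf : IsS f) (j : Fin 3) : pt (dx j f) = dx j (pt f) := by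
  rw [op_dsym hf, op_dsym hf.pt, op_pt (Sym.dsym j) hf]

lemma dx_add {f g : Fn} (hf : IsS f) (hg : IsS g) (j : Fin 3) : dx j (f + g) = dx j f + dx j g := by
  rw [op_dsym (hf.add hg), op_dsym hf, op_dsym hg, op_add (Sym.dsym j) hf hg]
lemma dx_sub {f g : Fn} (hf : IsS f) (hg : IsS g) (j : Fin 3) : dx j (f - g) = dx j f - dx j g := by
  rw [op_dsym (hf.sub hg), op_dsym hf, op_dsym hg, op_sub (Sym.dsym j) hf hg]
lemma dx_neg {f : Fn} (hf : IsS f) (j : Fin 3) : dx j (-f) = - dx j f := by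
  rw [op_dsym hf.neg, op_dsym hf, op_neg (Sym.dsym j) hf]
lemma dx_smul {f : Fn} (hf : IsS f) (c : ℝ) (j : Fin 3) : dx j (c • f) = c • dx j f := by
  rw [op_dsym (hf.smul c), op_dsym hf, op_smul (Sym.dsym j) hf]
lemma dx_sum {ι : Type*} (s : Finset ι) {f : ι → Fn} (hf : ∀ i ∈ s, IsS (f i)) (j : Fin 3) :
    dx j (∑ i ∈ s, f i) = ∑ i ∈ s, dx j (f i) := by
  rw [op_dsym (IsS.sum s hf), op_sum (Sym.dsym j) s hf]
  exact Finset.sum_congr rfl fun i hi => (op_dsym (hf i hi) j).symm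
lemma dx_mul {f g : Fn} (hf : IsS f) (hg : IsS g) (j : Fin 3) : dx j (f * g) = dx j f * g + f * dx j g := by
  funext t x
  show pd j (f t * g t) x = pd j (f t) x * g t x + f t x * pd j (g t) x
  unfold pd
  rw [fderiv_mul (hf.diffAt t x) (hg.diffAt t x)]
  simp; ring
lemma pt_add {f g : Fn} (hf : IsS f) (hg : IsS g) : pt (f + g) = pt f + pt g := by
  funext t x
  exact ((hf.hasDerivAt t x).add (hg.hasDerivAt t x)).deriv
lemma pt_smul {f : Fn} (hf : IsS f) (c : ℝ) : pt (c • f) = c • pt f := by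
  funext t x
  exact ((hf.hasDerivAt t x).const_smul c).deriv
lemma pt_neg {f : Fn} (hf : IsS f) : pt (-f) = -pt f := by
  have := pt_smul hf (-1); simpa using this
lemma pt_sub {f g : Fn} (hf : IsS f) (hg : IsS g) : pt (f - g) = pt f - pt g := by
  rw [sub_eq_add_neg, pt_add hf hg.neg, pt_neg hg, ← sub_eq_add_neg]
lemma pt_mul {f g : Fn} (hf : IsS f) (hg : IsS g) : pt (f * g) = pt f * g + f * pt g := by
  funext t x
  exact ((hf.hasDerivAt t x).mul (hg.hasDerivAt t x)).deriv
lemma pt_sum {ι : Type*} (s : Finset ι) {f : ι → Fn} (hf : ∀ i ∈ s, IsS (f i)) :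
    pt (∑ i ∈ s, f i) = ∑ i ∈ s, pt (f i) := by
  classical
  induction s using Finset.induction_on with
  | empty =>
    funext t x
    simp [pt]
  | insert i s hi ih =>
    rw [Finset.sum_insert hi, Finset.sum_insert hi, pt_add (hf i (Finset.mem_insert_self i s))
      (IsS.sum s fun j hj => hf j (Finset.mem_insert_of_mem hj)), ih fun j hj => hf j (Finset.mem_insert_of_mem hj)]

lemma IsS.int_dx {f : Fn} (hf : IsS f) (j : Fin 3) (t : ℝ) : ∫ x in Tdom, TE.dx j f t x = 0 :=
  int_pd (hf.slice t) (hf.per t) j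

lemma IsS.hasDerivAt_int {f : Fn} (hf : IsS f) (t : ℝ) :
    HasDerivAt (fun s => ∫ x in Tdom, f s x) (∫ x in Tdom, _root_.pt f t x) t :=
  TE.hasDerivAt_int hf.contDiff.continuous hf.pt.contDiff.continuous hf.hasDerivAt t

end TE

namespace TE
open scoped ENNReal

abbrev mT : Measure Spc := volume.restrict Tdom

/-- L⁴ norm over the torus. -/
def n4 (g : Spc → ℝ) : ℝ := lpNorm g 4 mT

lemma memLp_cont {g : Spc → ℝ} (hg : Continuous g) (p : ℝ≥0∞) : MemLp g p mT := by
  obtain ⟨C, hC⟩ := (isCompact_Icc (a := (0 : Spc)) (b := 1)).exists_bound_of_continuousOn hg.continuousOn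
  refine MemLp.of_bound hg.aestronglyMeasurable C ?_
  filter_upwards [ae_restrict_mem Tdom_meas] with x hx
  exact hC x (Tdom_sub hx)

lemma n4_nonneg (g : Spc → ℝ) : 0 ≤ n4 g := lpNorm_nonneg

lemma n4_eq {g : Spc → ℝ} (hg : Continuous g) : n4 g = (∫ x in Tdom, g x ^ 4) ^ ((1 : ℝ) / 4) := by
  rw [n4, lpNorm_eq_integral_norm_rpow_toReal (by norm_num) (by norm_num) hg.aestronglyMeasurable]
  have : ((4 : ℝ≥0∞)).toReal = 4 := by norm_num
  rw [this]
  congr 1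
  · congr 1; funext x
    rw [show (4 : ℝ) = ((4 : ℕ) : ℝ) by norm_num, Real.rpow_natCast, Real.norm_eq_abs]
    exact Even.pow_abs (by decide) _
  · norm_num

lemma int4_nonneg (g : Spc → ℝ) : 0 ≤ ∫ x in Tdom, g x ^ 4 :=
  integral_nonneg fun x => by positivity

lemma n4_pow {g : Spc → ℝ} (hg : Continuous g) : n4 g ^ 4 = ∫ x in Tdom, g x ^ 4 := by
  rw [n4_eq hg, ← Real.rpow_natCast, ← Real.rpow_mul (int4_nonneg g)]
  norm_num

lemma n4_add {f g : Spc → ℝ} (hf : Continuous f) : n4 (f + g) ≤ n4 f + n4 g :=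
  lpNorm_add_le (memLp_cont hf 4) (by norm_num)

lemma n4_sub {f g : Spc → ℝ} (hf : Continuous f) : n4 (f - g) ≤ n4 f + n4 g :=
  lpNorm_sub_le (memLp_cont hf 4) (by norm_num)

lemma n4_neg (f : Spc → ℝ) : n4 (-f) = n4 f := lpNorm_neg _ _ _

lemma n4_smul (c : ℝ) (f : Spc → ℝ) : n4 (c • f) = |c| * n4 f := by
  rw [n4, lpNorm_const_smul]; rfl

lemma n4_zero : n4 0 = 0 := lpNorm_zero _ _

lemma n4_sum {ι : Type*} (s : Finset ι) {f : ι → Spc → ℝ} (hf : ∀ i ∈ s, Continuous (f i)) :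
    n4 (∑ i ∈ s, f i) ≤ ∑ i ∈ s, n4 (f i) := by
  classical
  induction s using Finset.induction_on with
  | empty => simp [n4_zero]
  | insert i s hi ih =>
    rw [Finset.sum_insert hi, Finset.sum_insert hi]
    refine (n4_add (hf i (Finset.mem_insert_self i s))).trans ?_
    gcongr
    exact ih fun j hj => hf j (Finset.mem_insert_of_mem hj)

lemma n4_le_of_int {g : Spc → ℝ} (hg : Continuous g) {B : ℝ} (hB : 0 ≤ B)
    (h : ∫ x in Tdom, g x ^ 4 ≤ B ^ 4) : n4 g ≤ B := by
  rw [← n4_pow hg] at h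
  exact le_of_pow_le_pow_left₀ (by norm_num) hB h

lemma n4_mono {f g : Spc → ℝ} (hf : Continuous f) (hg : Continuous g) (h : ∀ x, |f x| ≤ |g x|) :
    n4 f ≤ n4 g := by
  refine n4_le_of_int hf (n4_nonneg g) ?_
  rw [n4_pow hg]
  refine integral_mono (cont_integrable (hf.pow 4)) (cont_integrable (hg.pow 4)) fun x => ?_
  have := pow_le_pow_left₀ (abs_nonneg _) (h x) 4
  rwa [Even.pow_abs (by decide), Even.pow_abs (by decide)] at this

lemma n4_mul {f g : Spc → ℝ} (hf : Continuous f) (hg : Continuous g) {B : ℝ} (hB : 0 ≤ B) (h : ∀ x, |g x| ≤ B) :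
    n4 (g * f) ≤ B * n4 f := by
  have := n4_mono (hg.mul hf) (hf.const_smul B) (f := g * f) (g := B • f) fun x => by
    simp only [Pi.mul_apply, Pi.smul_apply, smul_eq_mul, abs_mul, abs_of_nonneg hB]
    exact mul_le_mul_of_nonneg_right (h x) (abs_nonneg _)
  rwa [n4_smul, abs_of_nonneg hB] at this

lemma n4_translate {f : Spc → ℝ} (hf : Continuous f) (hp : Per f) (y : Spc) :
    n4 (fun x => f (x + y)) = n4 f := by
  rw [n4_eq hf, n4_eq (show Continuous fun x => f (x + y) from hf.comp (continuous_add_const y))]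
  rw [int_translate (f := fun x => f x ^ 4) (fun x k => by simp only [hp x k]) y]

/-- Hölder with exponents 4/3 and 4. -/
lemma holder {g h : Spc → ℝ} (hg : Continuous g) (hh : Continuous h) :
    ∫ x in Tdom, |g x| ^ 3 * |h x| ≤ n4 g ^ 3 * n4 h := by
  have hpq : (4/3 : ℝ).HolderConjugate 4 := by
    rw [Real.holderConjugate_iff]; norm_num
  have := integral_mul_le_Lp_mul_Lq_of_nonneg (μ := mT) hpq (f := fun x => |g x| ^ 3) (g := fun x => |h x|)
    (Filter.Eventually.of_forall fun x => by positivity) (Filter.Eventually.of_forall fun x => by positivity)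
    (memLp_cont (hg.abs.pow 3) _) (memLp_cont hh.abs _)
  refine this.trans (le_of_eq ?_)
  have e1 : ∀ x, (|g x| ^ 3) ^ (4/3 : ℝ) = g x ^ 4 := by
    intro x
    rw [← Real.rpow_natCast, ← Real.rpow_mul (abs_nonneg _)]
    norm_num
    exact Even.pow_abs (by decide) _
  have e2 : ∀ x, |h x| ^ (4 : ℝ) = h x ^ 4 := by
    intro x
    rw [show (4 : ℝ) = ((4 : ℕ) : ℝ) by norm_num, Real.rpow_natCast]
    exact Even.pow_abs (by decide) _
  simp only [e1, e2]
  rw [n4_eq hh, n4_eq hg, ← Real.rpow_natCast _ 3, ← Real.rpow_mul (int4_nonneg g)]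
  norm_num

lemma holder' {g h : Spc → ℝ} (hg : Continuous g) (hh : Continuous h) :
    |∫ x in Tdom, g x ^ 3 * h x| ≤ n4 g ^ 3 * n4 h := by
  refine (abs_integral_le_integral_abs).trans (le_trans (le_of_eq ?_) (holder hg hh))
  congr 1; funext x; rw [abs_mul, abs_pow]

/-- Duality. -/
lemma n4_dual {g : Spc → ℝ} (hg : Continuous g) {M : ℝ} (hM : 0 ≤ M)
    (h : ∫ x in Tdom, g x ^ 4 ≤ M * n4 g ^ 3) : n4 g ≤ M := by
  rw [← n4_pow hg] at h
  rcases (n4_nonneg g).eq_or_lt with h0 | h0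
  · rw [← h0]; exact hM
  · have : n4 g * n4 g ^ 3 ≤ M * n4 g ^ 3 := by linarith [pow_succ' (n4 g) 3]
    exact le_of_mul_le_mul_right this (by positivity)

/-- Minkowski for integral operators. -/
lemma n4_minkowski {Ω : Type*} [MeasurableSpace Ω] {μ : Measure Ω} [SFinite μ] {φ : Spc → ℝ}
    (hφ : Continuous φ) {G : Ω → Spc → ℝ} (hG : AEStronglyMeasurable (Function.uncurry G) (μ.prod mT))
    (hGc : ∀ ω, Continuous (G ω)) {b : Ω → ℝ} (hb : Integrable b μ) (hb0 : ∀ ω, 0 ≤ b ω)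
    (hφG : ∀ x, φ x = ∫ ω, G ω x ∂μ)
    (hGb : ∀ᵐ ω ∂μ, n4 (G ω) ≤ b ω) {B : Ω → ℝ} (hB : Integrable B μ) (hBG : ∀ ω x, |G ω x| ≤ B ω) :
    n4 φ ≤ ∫ ω, b ω ∂μ := by
  refine n4_dual hφ (integral_nonneg hb0) ?_
  have hC : ∀ x, |φ x| ≤ ∫ ω, B ω ∂μ := fun x => by
    rw [hφG x]
    rw [← Real.norm_eq_abs]
    exact norm_integral_le_of_norm_le hB (Filter.Eventually.of_forall fun ω => hBG ω x)
  set C := ∫ ω, B ω ∂μ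
  have hC0 : 0 ≤ C := (abs_nonneg _).trans (hC 0)
  have key : Integrable (Function.uncurry fun ω x => φ x ^ 3 * G ω x) (μ.prod mT) := by
    refine Integrable.mono' (g := fun p => C ^ 3 * B p.1) ?_ ?_ ?_
    · exact (hB.comp_fst mT).const_mul _
    · refine AEStronglyMeasurable.mul ?_ hG
      exact ((hφ.pow 3).measurable.comp measurable_snd).aestronglyMeasurable
    · refine Filter.Eventually.of_forall fun p => ?_
      simp only [Function.uncurry, Real.norm_eq_abs, abs_mul, abs_pow]
      exact mul_le_mul (pow_le_pow_left₀ (abs_nonneg _) (hC _) 3) (hBG _ _) (abs_nonneg _) (by positivity)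
  have e : ∫ x in Tdom, φ x ^ 4 = ∫ ω, (∫ x in Tdom, φ x ^ 3 * G ω x) ∂μ := by
    rw [integral_integral_swap key]
    congr 1; funext x
    rw [integral_const_mul, ← hφG x]; ring
  rw [e, ← integral_mul_const]
  refine integral_mono_ae key.integral_prod_left (hb.mul_const _) ?_
  filter_upwards [hGb] with ω hω
  refine (le_abs_self _).trans ((holder' hφ (hGc ω)).trans ?_)
  rw [mul_comm]
  exact mul_le_mul_of_nonneg_right hω (pow_nonneg (n4_nonneg _) 3)
end TE

namespace TE
open scoped ENNReal ComplexConjugate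

lemma measurable_tsum {Ω : Type*} [MeasurableSpace Ω] {F : Lat → Ω → ℂ} (hF : ∀ k, Measurable (F k))
    (hs : ∀ ω, Summable fun k => F k ω) : Measurable fun ω => ∑' k, F k ω := by
  refine measurable_of_tendsto_metrizable' (Filter.atTop : Filter (Finset Lat))
    (f := fun s ω => ∑ k ∈ s, F k ω) (fun s => Finset.measurable_fun_sum s fun k _ => hF k) ?_
  rw [tendsto_pi_nhds]
  exact fun ω => (hs ω).hasSum

section
set_option linter.unusedSectionVars false
variable {Ω : Type*} [MeasurableSpace Ω] {μ : Measure Ω} {m : Lat → ℂ} {M : Ω → Lat → ℂ}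
  {f : Fn} {B : Ω → ℝ} {p : ℕ}

/-- weighted l¹ norm -/
def l1 (p : ℕ) (f : Fn) (t : ℝ) : ℝ := ∑' k, wt k ^ p * ‖co f k t‖

lemma l1_nonneg (p : ℕ) (f : Fn) (t : ℝ) : 0 ≤ l1 p f t :=
  tsum_nonneg fun k => mul_nonneg (pow_nonneg (wt_pos k).le p) (norm_nonneg _)

lemma l1_summable (hf : IsS f) (t : ℝ) : Summable fun k => wt k ^ p * ‖co f k t‖ := by
  obtain ⟨C, _, hC⟩ := hf.ss.rd.bound p
  refine Summable.of_nonneg_of_le (fun k => mul_nonneg (pow_nonneg (wt_pos k).le p) (norm_nonneg _))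
    (fun k => ?_) (summable_wt.mul_left C)
  rw [mul_comm]; exact hC k t

lemma op_term (hB : ∀ ω k, ‖M ω k‖ ≤ B ω * wt k ^ p) (t : ℝ) (ω : Ω) (k : Lat) (x : Spc) :
    ‖M ω k * co f k t * chr k x‖ ≤ B ω * (wt k ^ p * ‖co f k t‖) := by
  rw [norm_mul, norm_mul, norm_chr, mul_one, ← mul_assoc]
  exact mul_le_mul_of_nonneg_right (hB ω k) (norm_nonneg _)

lemma op_bd (hf : IsS f) (hB : ∀ ω k, ‖M ω k‖ ≤ B ω * wt k ^ p) (t : ℝ) (ω : Ω) (x : Spc) :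
    |Op (M ω) f t x| ≤ B ω * l1 p f t := by
  refine (Complex.abs_re_le_norm _).trans ?_
  rw [ev, l1, ← tsum_mul_left]
  exact tsum_of_norm_bounded ((l1_summable hf t).mul_left (B ω)).hasSum fun k => op_term hB t ω k x

lemma IsS.abs_le (hf : IsS f) (t : ℝ) (x : Spc) : |f t x| ≤ l1 0 f t := by
  have h := hf.ev' t x
  rw [← Real.norm_eq_abs, ← Complex.norm_real, h, TE.ev, l1]
  refine tsum_of_norm_bounded (l1_summable hf t).hasSum fun k => ?_
  rw [norm_mul, norm_chr]; simp

lemma op_int' (hM : ∀ ω, Sym (M ω)) (hf : IsS f)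
    (hme : ∀ k, Measurable fun ω => M ω k) (hBi : Integrable B μ) (hB : ∀ ω k, ‖M ω k‖ ≤ B ω * wt k ^ p)
    (hmM : ∀ k, m k = ∫ ω, M ω k ∂μ) (t : ℝ) (x : Spc) :
    Integrable (fun ω => Op (M ω) f t x) μ ∧ Op m f t x = ∫ ω, Op (M ω) f t x ∂μ := by
  have hs := (l1_summable (p := p) hf t)
  have hi : ∀ k, Integrable (fun ω => M ω k * co f k t * chr k x) μ := fun k => by
    refine Integrable.mul_const (Integrable.mul_const ?_ _) _
    exact (hBi.mul_const (wt k ^ p)).mono' (hme k).aestronglyMeasurable (Filter.Eventually.of_forall fun ω => hB ω k)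
  have hno : ∀ ω k, ‖M ω k * co f k t * chr k x‖ ≤ B ω * (wt k ^ p * ‖co f k t‖) :=
    fun ω k => op_term hB t ω k x
  have hsum : Summable fun k => ∫ ω, ‖M ω k * co f k t * chr k x‖ ∂μ := by
    refine Summable.of_nonneg_of_le (fun k => integral_nonneg fun ω => norm_nonneg _) (fun k => ?_)
      (hs.mul_left (∫ ω, B ω ∂μ))
    rw [← integral_mul_const]
    exact integral_mono (hi k).norm (hBi.mul_const _) fun ω => hno ω k
  have h1 := hasSum_integral_of_summable_integral_norm hi hsum
  have h2 : ev (fun k t => m k * co f k t) t x = ∫ ω, ev (fun k t => M ω k * co f k t) t x ∂μ := by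
    unfold ev
    rw [← h1.tsum_eq]
    congr 1; funext k
    rw [integral_mul_const, integral_mul_const, ← hmM k]
  have hintg : Integrable (fun ω => ev (fun k t => M ω k * co f k t) t x) μ := by
    refine Integrable.mono' (hBi.mul_const (∑' k, wt k ^ p * ‖co f k t‖)) ?_ ?_
    · refine Measurable.aestronglyMeasurable ?_
      refine measurable_tsum (fun k => ((hme k).mul_const _).mul_const _) fun ω => ?_
      exact ((hf.ss.rd.mult (hM ω).pg).summable t x)
    · refine Filter.Eventually.of_forall fun ω => ?_
      rw [ev, ← tsum_mul_left]
      exact tsum_of_norm_bounded (hs.mul_left (B ω)).hasSum fun k => hno ω k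
  refine ⟨hintg.re, ?_⟩
  rw [Op, h2]
  exact (integral_re hintg).symm

lemma op_meas (hM : ∀ ω, Sym (M ω)) (hf : IsS f) (hme : ∀ k, Measurable fun ω => M ω k) (t : ℝ) :
    Measurable (Function.uncurry fun ω x => Op (M ω) f t x) := by
  refine Complex.measurable_re.comp ?_
  refine measurable_tsum (F := fun k (p : Ω × Spc) => M p.1 k * co f k t * chr k p.2) (fun k => ?_) fun p => ?_
  · exact (((hme k).comp measurable_fst).mul_const _).mul ((chr_continuous k).measurable.comp measurable_snd)
  · exact ((hf.ss.rd.mult (hM p.1).pg).summable t p.2)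

lemma n4_op_int [SFinite μ] (hm : Sym m) (hM : ∀ ω, Sym (M ω)) (hf : IsS f)
    (hme : ∀ k, Measurable fun ω => M ω k) (hBi : Integrable B μ) (hB : ∀ ω k, ‖M ω k‖ ≤ B ω * wt k ^ p)
    (hmM : ∀ k, m k = ∫ ω, M ω k ∂μ) (t : ℝ) {b : Ω → ℝ} (hb : Integrable b μ) (hb0 : ∀ ω, 0 ≤ b ω)
    (h : ∀ᵐ ω ∂μ, n4 (Op (M ω) f t) ≤ b ω) :
    n4 (Op m f t) ≤ ∫ ω, b ω ∂μ :=
  n4_minkowski ((hf.op hm).cont t) (op_meas hM hf hme t).aestronglyMeasurable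
    (fun ω => (hf.op (hM ω)).cont t) hb hb0
    (fun x => (op_int' hM hf hme hBi hB hmM t x).2) h (hBi.mul_const _) (fun ω x => op_bd hf hB t ω x)

/-- commutator of multiplication by `g` with the multiplier `m` -/
def comm (m : Lat → ℂ) (g f : Fn) : Fn := g * Op m f - Op m (g * f)

lemma IsS.comm (hm : Sym m) {g : Fn} (hg : IsS g) (hf : IsS f) : IsS (comm m g f) :=
  (hg.mul (hf.op hm)).sub ((hg.mul hf).op hm)

lemma n4_comm_int [SFinite μ] (hm : Sym m) (hM : ∀ ω, Sym (M ω)) {g : Fn} (hg : IsS g) (hf : IsS f)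
    (hme : ∀ k, Measurable fun ω => M ω k) (hBi : Integrable B μ) (hB : ∀ ω k, ‖M ω k‖ ≤ B ω * wt k ^ p)
    (hmM : ∀ k, m k = ∫ ω, M ω k ∂μ) (t : ℝ) {b : Ω → ℝ} (hb : Integrable b μ) (hb0 : ∀ ω, 0 ≤ b ω)
    (h : ∀ᵐ ω ∂μ, n4 (comm (M ω) g f t) ≤ b ω) :
    n4 (comm m g f t) ≤ ∫ ω, b ω ∂μ := by
  have hgf := hg.mul hf
  refine n4_minkowski ((IsS.comm hm hg hf).cont t) (G := fun ω x => TE.comm (M ω) g f t x) (Measurable.aestronglyMeasurable ?_)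
    (fun ω => (IsS.comm (hM ω) hg hf).cont t) hb hb0 (fun x => ?_) h
    ((hBi.mul_const (l1 0 g t * l1 p f t + l1 p (g * f) t))) (fun ω x => ?_)
  · exact (((hg.cont t).measurable.comp measurable_snd).mul (op_meas hM hf hme t)).sub (op_meas hM hgf hme t)
  · obtain ⟨i1, e1⟩ := op_int' hM hf hme hBi hB hmM t x
    obtain ⟨i2, e2⟩ := op_int' hM hgf hme hBi hB hmM t x
    show g t x * Op m f t x - Op m (g * f) t x = ∫ ω, (g t x * Op (M ω) f t x - Op (M ω) (g * f) t x) ∂μ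
    rw [integral_sub (i1.const_mul _) i2, integral_const_mul, e1, e2]
  · show |g t x * Op (M ω) f t x - Op (M ω) (g * f) t x| ≤ _
    refine (abs_sub _ _).trans ?_
    rw [abs_mul, mul_add]
    have h1 := op_bd hf hB t ω x
    have h2 := op_bd hgf hB t ω x
    have h3 := hg.abs_le t x
    have := mul_le_mul h3 h1 (abs_nonneg _) (l1_nonneg _ _ _)
    linarith
end

abbrev E3 : Type := EuclideanSpace ℝ (Fin 3)

def dt (k : Lat) (θ : E3) : ℝ := ∑ i, (k i : ℝ) * θ i

lemma dt_neg (k : Lat) (θ : E3) : dt (-k) θ = - dt k θ := by simp [dt]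
lemma dt_sub (k m : Lat) (θ : E3) : dt (k - m) θ = dt k θ - dt m θ := by
  simp [dt, sub_mul, Finset.sum_sub_distrib]

def sg (θ : E3) (k : Lat) : ℂ := -Complex.I * (Real.sign (dt k θ) : ℝ)

lemma norm_sg (θ : E3) (k : Lat) : ‖sg θ k‖ ≤ 1 := by
  rw [sg, norm_mul]
  rcases Real.sign_apply_eq (dt k θ) with h | h | h <;> simp [h]

lemma sg_sym (θ : E3) : Sym (sg θ) := by
  refine ⟨⟨1, 0, zero_le_one, fun k => by simpa using norm_sg θ k⟩, fun k => ?_⟩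
  rw [sg, sg, dt_neg, Real.sign_neg]
  simp

lemma cv_supp {a b : Sq} {θ : E3} (ha : ∀ k t, dt k θ ≤ 0 → a k t = 0) (hb : ∀ k t, dt k θ ≤ 0 → b k t = 0) :
    ∀ k t, dt k θ ≤ 0 → cv a b k t = 0 := by
  intro k t hk
  rw [cv, ← tsum_zero (β := Lat) (α := ℂ)]
  congr 1; funext m
  rcases le_or_gt (dt m θ) 0 with h | h
  · rw [ha m t h, zero_mul]
  · rw [hb (k - m) t (by rw [dt_sub]; linarith), mul_zero]

lemma hilb {θ : E3} (hθ : ∀ k : Lat, k ≠ 0 → dt k θ ≠ 0) {f : Fn} (hf : IsS f) (h0 : ∀ t, co f 0 t = 0) (t : ℝ) :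
    n4 (Op (sg θ) f t) ≤ 3 * n4 (f t) := by
  set g := Op (sg θ) f
  have hg : IsS g := hf.op (sg_sym θ)
  set c : Sq := fun k t => co f k t + Complex.I * co g k t
  have hc : RD c := hf.ss.rd.add (hg.ss.rd.mult (pg_const _))
  have hcs : ∀ k t, dt k θ ≤ 0 → c k t = 0 := by
    intro k t hk
    simp only [c]
    rw [co_op (sg_sym θ) hf]
    by_cases hk0 : k = 0
    · rw [hk0, h0]; simp
    · have : dt k θ < 0 := lt_of_le_of_ne hk (hθ k hk0)
      rw [sg, Real.sign_of_neg this]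
      push_cast
      linear_combination (co f k t) * Complex.I_mul_I
  have hI := int_ev ((hc.cv hc).cv (hc.cv hc)) t
  rw [cv_supp (cv_supp hcs hcs) (cv_supp hcs hcs) 0 t (by simp [dt])] at hI
  have hF : ∀ x, ev (cv (cv c c) (cv c c)) t x = ((f t x : ℂ) + Complex.I * g t x) ^ 4 := by
    intro x
    rw [ev_cv (hc.cv hc) (hc.cv hc), ev_cv hc hc, ev_add hf.ss.rd (hg.ss.rd.mult (pg_const _)), ev_smul,
      ← hf.ev', ← hg.ev']
    ring
  simp only [hF] at hI
  have hcf := hf.cont t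
  have hcg := hg.cont t
  have hintg : IntegrableOn (fun x => ((f t x : ℂ) + Complex.I * g t x) ^ 4) Tdom :=
    cont_integrable (by fun_prop)
  have h1 := integral_re hintg
  rw [hI] at h1
  have h2 : ∀ x, RCLike.re (((f t x : ℂ) + Complex.I * g t x) ^ 4) = f t x ^ 4 - 6 * f t x ^ 2 * g t x ^ 2 + g t x ^ 4 := by
    intro x
    have : ((f t x : ℂ) + Complex.I * g t x) ^ 4 = ((f t x ^ 4 - 6 * f t x ^ 2 * g t x ^ 2 + g t x ^ 4 : ℝ) : ℂ)
      + ((4 * f t x ^ 3 * g t x - 4 * f t x * g t x ^ 3 : ℝ) : ℂ) * Complex.I := by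
      push_cast
      linear_combination (6 * (f t x : ℂ)^2 * (g t x : ℂ)^2 + 4 * (f t x : ℂ) * (g t x : ℂ)^3 * Complex.I + (g t x : ℂ)^4 * (Complex.I^2 - 1)) * Complex.I_sq
    rw [this, RCLike.re_eq_complex_re, Complex.add_re, Complex.ofReal_re, Complex.re_ofReal_mul, Complex.I_re]
    ring
  simp only [h2] at h1
  have h3 : ∫ x in Tdom, (g t x ^ 4 - 36 * f t x ^ 4) ≤ ∫ x in Tdom, 2 * (f t x ^ 4 - 6 * f t x ^ 2 * g t x ^ 2 + g t x ^ 4) := by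
    refine integral_mono (cont_integrable (by fun_prop)) (cont_integrable (by fun_prop)) fun x => ?_
    dsimp only
    nlinarith [sq_nonneg (g t x ^ 2 - 6 * f t x ^ 2), sq_nonneg (f t x ^ 2)]
  rw [integral_const_mul, h1, integral_sub (cont_integrable (by fun_prop)) (cont_integrable (by fun_prop)),
    integral_const_mul] at h3
  refine n4_le_of_int hcg (mul_nonneg (by norm_num) (n4_nonneg _)) ?_
  rw [mul_pow, n4_pow hcf]
  have := int4_nonneg (f t)
  simp at h3
  linarith
end TE

namespace TE
open scoped ENNReal ComplexConjugate RealInnerProductSpace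

lemma dt_inner (k : Lat) (θ : E3) : dt k θ = ⟪(WithLp.toLp 2 fun i => (k i : ℝ) : E3), θ⟫ := by
  rw [dt, PiLp.inner_apply]
  refine Finset.sum_congr rfl fun i _ => ?_
  simp [mul_comm]

lemma generic : ∀ᵐ θ : E3, ∀ k : Lat, k ≠ 0 → dt k θ ≠ 0 := by
  rw [ae_all_iff]
  intro k
  by_cases hk : k = 0
  · simp [hk]
  let ξ : E3 := WithLp.toLp 2 fun i => (k i : ℝ)
  have hξ : ξ ≠ 0 := by
    intro h
    apply hk
    funext i
    have := congrArg (fun y : E3 => y i) h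
    simpa [ξ] using this
  have h := Measure.addHaar_submodule (volume : Measure E3) (LinearMap.ker (innerSL ℝ ξ : E3 →L[ℝ] ℝ).toLinearMap) (by
    intro h
    have : ξ ∈ LinearMap.ker (innerSL ℝ ξ : E3 →L[ℝ] ℝ).toLinearMap := by rw [h]; trivial
    simp at this
    exact hξ this)
  rw [measure_eq_zero_iff_ae_notMem] at h
  filter_upwards [h] with θ hθ _
  rw [dt_inner]
  simpa using hθ

abbrev mB : Measure E3 := volume.restrict (Metric.ball 0 1)

def Wv (ξ : E3) : E3 := ∫ θ, Real.sign ⟪ξ, θ⟫ • θ ∂mB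

lemma meas_sign : Measurable Real.sign := by
  unfold Real.sign
  exact Measurable.ite measurableSet_Iio measurable_const (Measurable.ite measurableSet_Ioi measurable_const measurable_const)

lemma abs_sign_le (r : ℝ) : |Real.sign r| ≤ 1 := by
  rcases Real.sign_apply_eq r with h | h | h <;> simp [h]

lemma integrable_norm_mB : Integrable (fun θ : E3 => ‖θ‖) mB := by
  refine IntegrableOn.mono_set ?_ Metric.ball_subset_closedBall
  exact continuous_norm.continuousOn.integrableOn_compact (isCompact_closedBall _ _)

lemma Wv_integrable (ξ : E3) : Integrable (fun θ => Real.sign ⟪ξ, θ⟫ • θ) mB := by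
  refine Integrable.mono' integrable_norm_mB ?_ ?_
  · refine Measurable.aestronglyMeasurable ?_
    exact (meas_sign.comp (by fun_prop)).smul measurable_id
  · refine Filter.Eventually.of_forall fun θ => ?_
    rw [norm_smul]
    exact mul_le_of_le_one_left (norm_nonneg _) (abs_sign_le _)

lemma Wv_iso (ρ : E3 ≃ₗᵢ[ℝ] E3) (ξ : E3) : Wv (ρ ξ) = ρ (Wv ξ) := by
  unfold Wv
  have hmp := ρ.measurePreserving
  have h := hmp.setIntegral_preimage_emb ρ.toHomeomorph.toMeasurableEquiv.measurableEmbedding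
    (fun θ => Real.sign ⟪ρ ξ, θ⟫ • θ) (Metric.ball 0 1)
  have hb : (ρ ⁻¹' Metric.ball 0 1) = Metric.ball 0 1 := by
    ext x; simp
  rw [hb] at h
  rw [← h]
  simp only [LinearIsometryEquiv.inner_map_map, ← map_smul]
  exact (ρ.toContinuousLinearEquiv.toContinuousLinearMap.integral_comp_comm (Wv_integrable ξ))

lemma sign_mul_of_pos {s : ℝ} (hs : 0 < s) (r : ℝ) : Real.sign (s * r) = Real.sign r := by
  rcases lt_trichotomy r 0 with h | h | h
  · rw [Real.sign_of_neg h, Real.sign_of_neg (mul_neg_of_pos_of_neg hs h)]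
  · rw [h, mul_zero]
  · rw [Real.sign_of_pos h, Real.sign_of_pos (mul_pos hs h)]

lemma Wv_smul {s : ℝ} (hs : 0 < s) (ξ : E3) : Wv (s • ξ) = Wv ξ := by
  unfold Wv
  congr 1; funext θ
  rw [real_inner_smul_left, sign_mul_of_pos hs]

lemma Wv_exists : ∃ c : ℝ, 0 < c ∧ ∀ ξ : E3, ξ ≠ 0 → Wv ξ = (c / ‖ξ‖) • ξ := by
  let e : E3 := EuclideanSpace.single 0 1
  have he : ‖e‖ = 1 := by simp [e]
  have h1 : Wv e ∈ (Submodule.span ℝ {e}) := by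
    rw [← Submodule.reflection_eq_self_iff, ← Wv_iso]
    congr 1
    rw [Submodule.reflection_eq_self_iff]
    exact Submodule.mem_span_singleton_self e
  obtain ⟨c, hc⟩ := Submodule.mem_span_singleton.1 h1
  have hc2 : c = ∫ θ, |⟪e, θ⟫| ∂mB := by
    have : ⟪e, Wv e⟫ = c := by rw [← hc, real_inner_smul_right, real_inner_self_eq_norm_sq, he]; simp
    rw [← this, Wv, ← integral_inner (Wv_integrable e)]
    congr 1; funext θ
    rw [real_inner_smul_right]
    rcases lt_trichotomy ⟪e, θ⟫ 0 with h | h | h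
    · rw [Real.sign_of_neg h, abs_of_neg h]; ring
    · rw [h]; simp
    · rw [Real.sign_of_pos h, abs_of_pos h]; ring
  have hcpos : 0 < c := by
    rw [hc2]
    have hintg : Integrable (fun θ : E3 => |⟪e, θ⟫|) mB := by
      refine IntegrableOn.mono_set ?_ Metric.ball_subset_closedBall
      exact (by fun_prop : Continuous fun θ : E3 => |⟪e, θ⟫|).continuousOn.integrableOn_compact (isCompact_closedBall _ _)
    rw [integral_pos_iff_support_of_nonneg (fun θ => abs_nonneg _) hintg]
    rw [Measure.restrict_apply' measurableSet_ball]
    refine IsOpen.measure_pos _ ?_ ⟨(1/2 : ℝ) • e, ?_, ?_⟩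
    · refine IsOpen.inter ?_ Metric.isOpen_ball
      exact (isOpen_ne_fun (by fun_prop) continuous_const)
    · simp [real_inner_smul_right, he]
    · simp [norm_smul, he]; norm_num
  refine ⟨c, hcpos, fun ξ hξ => ?_⟩
  have hn : 0 < ‖ξ‖ := norm_pos_iff.2 hξ
  set u := ‖ξ‖⁻¹ • ξ
  have hu : ‖u‖ = 1 := by simp [u, norm_smul, hn.ne']
  have hξu : ξ = ‖ξ‖ • u := by simp [u, smul_smul, hn.ne']
  have hr := Submodule.reflection_sub (v := e) (w := u) (by rw [he, hu])
  have : Wv u = c • u := by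
    conv_lhs => rw [← hr]
    rw [Wv_iso, ← hc, map_smul, hr]
  rw [hξu, Wv_smul hn, this, norm_smul, hu, smul_smul]
  congr 1
  simp; field_simp

def kn (k : Lat) : ℝ := ‖(WithLp.toLp 2 fun i => (k i : ℝ) : E3)‖

lemma kn_sq (k : Lat) : kn k ^ 2 = ∑ i, (k i : ℝ) ^ 2 := by
  rw [kn, EuclideanSpace.norm_sq_eq]; simp

lemma kn_neg (k : Lat) : kn (-k) = kn k := by
  have := kn_sq (-k)
  simp only [Pi.neg_apply, Int.cast_neg, neg_sq] at this
  rw [← kn_sq k] at this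
  exact (sq_eq_sq₀ (norm_nonneg _) (norm_nonneg _)).1 this

/-- symbol of Riesz transform -/
def rz (j : Fin 3) (k : Lat) : ℂ := Complex.I * ((k j : ℝ) / kn k : ℝ)

lemma abs_le_kn (k : Lat) (j : Fin 3) : |(k j : ℝ)| ≤ kn k := by
  have := kn_sq k
  have h2 : (k j : ℝ)^2 ≤ ∑ i, (k i : ℝ) ^ 2 :=
    Finset.single_le_sum (f := fun i => (k i : ℝ)^2) (fun i _ => sq_nonneg _) (Finset.mem_univ j)
  exact abs_le_of_sq_le_sq (by linarith) (norm_nonneg _ : 0 ≤ kn k)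

lemma norm_rz (j : Fin 3) (k : Lat) : ‖rz j k‖ ≤ 1 := by
  rw [rz, norm_mul, Complex.norm_I, one_mul, Complex.norm_real, Real.norm_eq_abs, abs_div, abs_of_nonneg (show 0 ≤ kn k from norm_nonneg _)]
  exact div_le_one_of_le₀ (abs_le_kn k j) (norm_nonneg _)

lemma rz_sym (j : Fin 3) : Sym (rz j) := by
  refine ⟨⟨1, 0, zero_le_one, fun k => by simpa using norm_rz j k⟩, fun k => ?_⟩
  rw [rz, rz, kn_neg]
  simp [neg_div]

lemma int_le_n4 {f : Spc → ℝ} (hf : Continuous f) : |∫ x in Tdom, f x| ≤ n4 f := by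
  have h := holder' (g := fun _ => 1) continuous_const hf
  have : n4 (fun _ => (1:ℝ)) = 1 := by rw [n4_eq continuous_const]; simp
  rw [this] at h
  simpa using h

lemma isS_mean {f : Fn} (hf : IsS f) : ∃ g, IsS g ∧ (∀ t, co g 0 t = 0) ∧ (∀ k, k ≠ 0 → co g k = co f k) ∧
    ∀ t, n4 (g t) ≤ 2 * n4 (f t) := by
  have hs : Sym (fun k : Lat => if k = 0 then (1 : ℂ) else 0) := by
    refine ⟨⟨1, 0, zero_le_one, fun k => by by_cases h : k = 0 <;> simp [h]⟩, fun k => by by_cases h : k = 0 <;> simp [h]⟩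
  have hg := hf.op hs
  refine ⟨f - Op (fun k : Lat => if k = 0 then (1 : ℂ) else 0) f, hf.sub hg, fun t => ?_, fun k hk => ?_, fun t => ?_⟩
  · rw [co_sub hf hg, co_op hs hf]; simp
  · funext t; rw [co_sub hf hg, co_op hs hf]; simp [hk]
  · have h1 : Op (fun k : Lat => if k = 0 then (1 : ℂ) else 0) f t = (∫ x in Tdom, f t x) • (fun _ => (1 : ℝ)) := by
      funext x
      rw [Op, ev, tsum_eq_single 0 (fun k hk => by simp [hk])]
      simp [co_zero, chr_zero]
    have : n4 (fun _ => (1:ℝ)) = 1 := by rw [n4_eq continuous_const]; simp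
    have h2 := n4_sub (f := f t) (g := Op (fun k : Lat => if k = 0 then (1 : ℂ) else 0) f t) (hf.cont t)
    rw [h1, n4_smul, this, ← h1] at h2
    have := int_le_n4 (hf.cont t)
    exact h2.trans (by linarith)

theorem riesz1 : ∃ C : ℝ, 0 < C ∧ ∀ (j : Fin 3) (f : Fn), IsS f → ∀ t, n4 (Op (rz j) f t) ≤ C * n4 (f t) := by
  obtain ⟨c, hc, hW⟩ := Wv_exists
  refine ⟨(∫ θ : E3, ‖θ‖ * c⁻¹ * 6 ∂mB) + 1, ?_, ?_⟩
  · have : 0 ≤ (∫ θ : E3, ‖θ‖ * c⁻¹ * 6 ∂mB) := integral_nonneg fun θ => by positivity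
    linarith
  intro j f hf t
  obtain ⟨g, hg, hg0, hgk, hgn⟩ := isS_mean hf
  have e : Op (rz j) f = Op (rz j) g := by
    refine (hf.op (rz_sym j)).ext (hg.op (rz_sym j)) fun k t => ?_
    rw [co_op (rz_sym j) hf, co_op (rz_sym j) hg]
    by_cases hk : k = 0
    · simp [hk, rz]
    · rw [hgk k hk]
  rw [e]
  have hsy : ∀ θ : E3, Sym (fun k => ((-c⁻¹ * θ j : ℝ) : ℂ) * sg θ k) := fun θ => (sg_sym θ).smul _
  have := n4_op_int (μ := mB) (m := rz j) (M := fun θ k => ((-c⁻¹ * θ j : ℝ) : ℂ) * sg θ k) (f := g)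
    (B := fun θ => ‖θ‖ * c⁻¹ * 6) (p := 0) (rz_sym j) hsy hg ?_ ?_ ?_ ?_ t
    (b := fun θ => ‖θ‖ * c⁻¹ * 6 * n4 (f t)) ?_ ?_ ?_
  · rw [integral_mul_const] at this
    refine this.trans ?_
    have := n4_nonneg (f t)
    nlinarith
  · intro k
    refine Measurable.mul (Complex.measurable_ofReal.comp (by fun_prop)) ?_
    unfold sg
    refine measurable_const.mul (Complex.measurable_ofReal.comp (meas_sign.comp ?_))
    unfold dt
    fun_prop
  · exact (integrable_norm_mB.mul_const _).mul_const _
  · intro θ k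
    rw [norm_mul, pow_zero, mul_one]
    have h1 : ‖((-c⁻¹ * θ j : ℝ) : ℂ)‖ ≤ ‖θ‖ * c⁻¹ := by
      rw [Complex.norm_real, norm_mul, norm_neg, Real.norm_of_nonneg (by positivity), mul_comm]
      exact mul_le_mul_of_nonneg_right (PiLp.norm_apply_le θ j) (by positivity)
    have h2 := norm_sg θ k
    have h3 : 0 ≤ ‖θ‖ * c⁻¹ := by positivity
    calc _ ≤ ‖θ‖ * c⁻¹ * 1 := mul_le_mul h1 h2 (norm_nonneg _) h3
      _ ≤ _ := by nlinarith
  · intro k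
    by_cases hk : k = 0
    · simp [hk, rz, sg, dt]
    set ξ : E3 := WithLp.toLp 2 fun i => (k i : ℝ) with hξ
    have hξ0 : ξ ≠ 0 := by
      intro h
      apply hk
      funext i
      have := congrArg (fun y : E3 => y i) h
      simpa [ξ] using this
    have h1 := congrArg (fun y : E3 => y j) (hW ξ hξ0)
    have h2 : (Wv ξ) j = ∫ θ, Real.sign ⟪ξ, θ⟫ * θ j ∂mB := by
      have := (EuclideanSpace.proj j : E3 →L[ℝ] ℝ).integral_comp_comm (Wv_integrable ξ)
      exact this.symm
    have h3 : ∀ θ : E3, ((-c⁻¹ * θ j : ℝ) : ℂ) * sg θ k = Complex.I * ((c⁻¹ * (Real.sign ⟪ξ, θ⟫ * θ j) : ℝ) : ℂ) := by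
      intro θ
      rw [sg, dt_inner]
      push_cast
      ring
    simp only [h3]
    rw [integral_const_mul, integral_complex_ofReal, integral_const_mul, ← h2]
    simp only at h1
    rw [h1, rz]
    congr 2
    show (k j : ℝ) / ‖ξ‖ = c⁻¹ * (c / ‖ξ‖ * (k j : ℝ))
    field_simp
  · exact ((integrable_norm_mB.mul_const _).mul_const _).mul_const _
  · intro θ; have := n4_nonneg (f t); positivity
  · filter_upwards [ae_restrict_of_ae generic] with θ hθ
    have h1 := hilb hθ hg hg0 t
    have h2 : Op (fun k => ((-c⁻¹ * θ j : ℝ) : ℂ) * sg θ k) g = (-c⁻¹ * θ j) • Op (sg θ) g := by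
      refine (hg.op (hsy θ)).ext ((hg.op (sg_sym θ)).smul _) fun k t => ?_
      rw [co_op (hsy θ) hg, co_smul (hg.op (sg_sym θ)), co_op (sg_sym θ) hg]
      ring
    rw [h2]
    show n4 ((-c⁻¹ * θ j) • (Op (sg θ) g t)) ≤ _
    rw [n4_smul, abs_mul, abs_neg, abs_of_pos (inv_pos.2 hc)]
    have h3 := hgn t
    have h4 : |θ j| ≤ ‖θ‖ := PiLp.norm_apply_le θ j
    have h5 : n4 (Op (sg θ) g t) ≤ 6 * n4 (f t) := by linarith
    calc c⁻¹ * |θ j| * n4 (Op (sg θ) g t) ≤ c⁻¹ * ‖θ‖ * (6 * n4 (f t)) :=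
          mul_le_mul (mul_le_mul_of_nonneg_left h4 (by positivity)) h5 (n4_nonneg _) (by positivity)
      _ = _ := by ring

/-- symbol k_i k_j/|k|² -/
def rr (i j : Fin 3) (k : Lat) : ℂ := (((k i : ℝ) * (k j : ℝ) / kn k ^ 2 : ℝ) : ℂ)

lemma rr_eq (i j : Fin 3) (k : Lat) : rr i j k = -(rz i k * rz j k) := by
  rw [rr, rz, rz]
  push_cast
  linear_combination ((k i : ℂ) * (k j : ℂ) / (kn k : ℂ) ^ 2) * Complex.I_mul_I

lemma rr_sym (i j : Fin 3) : Sym (rr i j) := by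
  have h := ((rz_sym i).mul (rz_sym j)).smul (-1)
  have : rr i j = fun k => ((-1 : ℝ) : ℂ) * (rz i * rz j) k := by
    funext k; rw [rr_eq]; simp
  rw [this]; exact h

theorem riesz2 : ∃ C : ℝ, 1 ≤ C ∧ ∀ (i j : Fin 3) (f : Fn), IsS f → ∀ t, n4 (Op (rr i j) f t) ≤ C * n4 (f t) := by
  obtain ⟨C, hC, h⟩ := riesz1
  refine ⟨C * C + 1, by nlinarith, fun i j f hf t => ?_⟩
  have e : Op (rr i j) f = - Op (rz i) (Op (rz j) f) := by
    refine (hf.op (rr_sym i j)).ext ((hf.op (rz_sym j)).op (rz_sym i)).neg fun k t => ?_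
    rw [co_op (rr_sym i j) hf, co_neg ((hf.op (rz_sym j)).op (rz_sym i)), co_op (rz_sym i) (hf.op (rz_sym j)),
      co_op (rz_sym j) hf, rr_eq]
    ring
  rw [e]
  show n4 (-(Op (rz i) (Op (rz j) f) t)) ≤ _
  rw [n4_neg]
  have h1 := h i _ (hf.op (rz_sym j)) t
  have h2 := h j _ hf t
  have := n4_nonneg (f t)
  nlinarith
end TE

namespace TE
open scoped ComplexConjugate

def BdO (m : Lat → ℂ) (a : ℝ) : Prop := ∀ f, IsS f → ∀ t, n4 (Op m f t) ≤ a * n4 (f t)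
def BdC (m : Lat → ℂ) (c : ℝ) : Prop := ∀ g f, IsS g → IsS f → ∀ t B, 0 ≤ B → (∀ i x, |dx i g t x| ≤ B) →
  n4 (comm m g f t) ≤ c * B * n4 (f t)

lemma BdO.mul {m n : Lat → ℂ} {a b : ℝ} (hm : Sym m) (hn : Sym n) (ha : 0 ≤ a) (h1 : BdO m a) (h2 : BdO n b) :
    BdO (m * n) (a * b) := by
  intro f hf t
  rw [← op_comp hm hn hf, mul_assoc]
  exact (h1 _ (hf.op hn) t).trans (mul_le_mul_of_nonneg_left (h2 f hf t) ha)

lemma comm_mul {m n : Lat → ℂ} (hm : Sym m) (hn : Sym n) {g f : Fn} (hg : IsS g) (hf : IsS f) :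
    comm (m * n) g f = comm m g (Op n f) + Op m (comm n g f) := by
  unfold comm
  rw [op_sub hm (hg.mul (hf.op hn)) ((hg.mul hf).op hn), op_comp hm hn hf, op_comp hm hn (hg.mul hf)]
  abel

lemma BdC.mul {m n : Lat → ℂ} {a b c d : ℝ} (hm : Sym m) (hn : Sym n) (ha : 0 ≤ a) (hc : 0 ≤ c)
    (h1 : BdO m a) (h2 : BdO n b) (h3 : BdC m c) (h4 : BdC n d) : BdC (m * n) (c * b + a * d) := by
  intro g f hg hf t B hB h
  rw [comm_mul hm hn hg hf]
  have e1 := h3 g _ hg (hf.op hn) t B hB h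
  have e2 := h1 _ (IsS.comm hn hg hf) t
  have e3 := h4 g f hg hf t B hB h
  have e4 := h2 f hf t
  refine (n4_add ((IsS.comm hm hg (hf.op hn)).cont t)).trans ?_
  have e5 : c * B * n4 (Op n f t) ≤ c * B * (b * n4 (f t)) := mul_le_mul_of_nonneg_left e4 (by positivity)
  have e6 : a * n4 (comm n g f t) ≤ a * (d * B * n4 (f t)) := mul_le_mul_of_nonneg_left e3 ha
  linarith

lemma BdO.mono {m : Lat → ℂ} {a b : ℝ} (h : BdO m a) (hab : a ≤ b) : BdO m b := fun f hf t =>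
  (h f hf t).trans (mul_le_mul_of_nonneg_right hab (n4_nonneg _))
lemma BdC.mono {m : Lat → ℂ} {a b : ℝ} (h : BdC m a) (hab : a ≤ b) : BdC m b := fun g f hg hf t B hB hh =>
  (h g f hg hf t B hB hh).trans (mul_le_mul_of_nonneg_right (mul_le_mul_of_nonneg_right hab hB) (n4_nonneg _))

lemma fderiv_bd {g : Spc → ℝ} {B : ℝ} (h : ∀ i x, |pd i g x| ≤ B) (x : Spc) : ‖fderiv ℝ g x‖ ≤ 3 * B := by
  have hB : 0 ≤ B := (abs_nonneg _).trans (h 0 x)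
  refine ContinuousLinearMap.opNorm_le_bound _ (by positivity) fun v => ?_
  have e : v = ∑ i, v i • (Pi.single i (1:ℝ) : Spc) := by
    funext j
    simp [Finset.sum_apply, Pi.single_apply]
  have : fderiv ℝ g x v = ∑ i, v i * pd i g x := by
    conv_lhs => rw [e]
    simp [map_sum, pd]
  rw [this]
  calc ‖∑ i, v i * pd i g x‖ ≤ ∑ i : Fin 3, ‖v‖ * B := by
        refine norm_sum_le_of_le _ fun i _ => ?_
        rw [norm_mul]
        exact mul_le_mul (norm_le_pi_norm v i) (h i x) (norm_nonneg _) (norm_nonneg _)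
    _ = 3 * B * ‖v‖ := by simp; ring

lemma lip_bd {g : Fn} (hg : IsS g) {t B : ℝ} (h : ∀ i x, |dx i g t x| ≤ B) (x y : Spc) :
    |g t x - g t (x + y)| ≤ 3 * B * ‖y‖ := by
  have := Convex.norm_image_sub_le_of_norm_fderiv_le (𝕜 := ℝ) (f := g t) (s := Set.univ) (C := 3 * B) (x := x + y) (y := x)
    (fun z _ => hg.diffAt t z) (fun z _ => fderiv_bd h z) convex_univ trivial trivial
  simpa using this

def trm (w : ℝ) (y : Spc) (k : Lat) : ℂ := (w : ℂ) * chr k y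

lemma trm_sym (w : ℝ) (y : Spc) : Sym (trm w y) := by
  refine ⟨⟨|w|, 0, abs_nonneg _, fun k => by simp [trm, norm_chr]⟩, fun k => by simp [trm, chr_neg]⟩

lemma op_trm (w : ℝ) (y : Spc) {f : Fn} (hf : IsS f) (t : ℝ) (x : Spc) : Op (trm w y) f t x = w * f t (x + y) := by
  have h1 : ((Op (trm w y) f t x : ℝ) : ℂ) = _ := (hf.op (trm_sym w y)).ev' t x
  have h2 := hf.ev' t (x + y)
  apply Complex.ofReal_injective
  rw [h1, Complex.ofReal_mul, h2, ev, ev, ← tsum_mul_left]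
  congr 1
  funext k
  rw [co_op (trm_sym w y) hf, chr_add_right, trm]
  ring

section
variable {Ω : Type*} [MeasurableSpace Ω] {μ : Measure Ω} [SFinite μ] {m : Lat → ℂ} {w : Ω → ℝ} {y : Ω → Spc}

lemma bdo_trm (hm : Sym m) (hw : Measurable w) (hy : Measurable y) (hwi : Integrable w μ)
    (hmM : ∀ k, m k = ∫ ω, trm (w ω) (y ω) k ∂μ) : BdO m (∫ ω, |w ω| ∂μ) := by
  intro f hf t
  rw [← integral_mul_const]
  refine n4_op_int (p := 0) (B := fun ω => |w ω|) hm (fun ω => trm_sym (w ω) (y ω)) hf (fun k => ?_) hwi.abs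
    (fun ω k => by simp [trm, norm_chr]) hmM t (hwi.abs.mul_const _)
    (fun ω => mul_nonneg (abs_nonneg _) (n4_nonneg _)) (Filter.Eventually.of_forall fun ω => ?_)
  · exact (Complex.measurable_ofReal.comp hw).mul ((chr_continuous k).measurable.comp hy)
  · have : Op (trm (w ω) (y ω)) f t = w ω • fun x => f t (x + y ω) := by
      funext x; rw [op_trm _ _ hf]; rfl
    rw [this, n4_smul, n4_translate (hf.cont t) (hf.per t)]

lemma bdc_trm (hm : Sym m) (hw : Measurable w) (hy : Measurable y) (hwi : Integrable w μ)
    (hwy : Integrable (fun ω => |w ω| * ‖y ω‖) μ)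
    (hmM : ∀ k, m k = ∫ ω, trm (w ω) (y ω) k ∂μ) : BdC m (3 * ∫ ω, |w ω| * ‖y ω‖ ∂μ) := by
  intro g f hg hf t B hB hgB
  rw [mul_comm 3, mul_assoc, mul_assoc, ← integral_mul_const]
  refine n4_comm_int (p := 0) (B := fun ω => |w ω|) hm (fun ω => trm_sym (w ω) (y ω)) hg hf (fun k => ?_) hwi.abs
    (fun ω k => by simp [trm, norm_chr]) hmM t (hwy.mul_const _)
    (fun ω => mul_nonneg (by positivity) (by have := n4_nonneg (f t); positivity)) (Filter.Eventually.of_forall fun ω => ?_)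
  · exact (Complex.measurable_ofReal.comp hw).mul ((chr_continuous k).measurable.comp hy)
  · have e : comm (trm (w ω) (y ω)) g f t = w ω • ((fun x => g t x - g t (x + y ω)) * fun x => f t (x + y ω)) := by
      funext x
      show g t x * Op _ f t x - Op _ (g * f) t x = _
      rw [op_trm _ _ hf, op_trm _ _ (hg.mul hf)]
      show _ = w ω * ((g t x - g t (x + y ω)) * f t (x + y ω))
      simp only [Pi.mul_apply]
      ring
    have c1 : Continuous fun x => f t (x + y ω) := (hf.cont t).comp (continuous_add_const _)
    have c2 : Continuous fun x => g t x - g t (x + y ω) := (hg.cont t).sub ((hg.cont t).comp (continuous_add_const _))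
    rw [e, n4_smul]
    have h1 := n4_mul c1 c2 (B := 3 * B * ‖y ω‖) (by positivity) (fun x => lip_bd hg hgB x _)
    rw [n4_translate (hf.cont t) (hf.per t)] at h1
    calc _ ≤ |w ω| * (3 * B * ‖y ω‖ * n4 (f t)) := mul_le_mul_of_nonneg_left h1 (abs_nonneg _)
      _ = _ := by ring
end

open ProbabilityTheory in
lemma gauss0 (ξ : ℝ) : ∫ z, Complex.exp (ξ * z * Complex.I) ∂(gaussianReal 0 1) = ((Real.exp (-ξ ^ 2 / 2) : ℝ) : ℂ) := by
  rw [← charFun_apply_real, charFun_gaussianReal]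
  push_cast
  congr 1
  simp
  ring

open ProbabilityTheory in
lemma gauss1 (ξ : ℝ) : ∫ z : ℝ, (z : ℂ) * Complex.exp (ξ * z * Complex.I) ∂(gaussianReal 0 1) =
    Complex.I * ξ * ((Real.exp (-ξ ^ 2 / 2) : ℝ) : ℂ) := by
  have h1 := iteratedDeriv_charFun (μ := gaussianReal 0 1) (n := 1) (t := ξ) (by simpa using memLp_id_gaussianReal (μ := 0) (v := 1) 1)
  rw [iteratedDeriv_one] at h1
  have h2 : charFun (gaussianReal 0 1) = fun ξ : ℝ => ((Real.exp (-ξ ^ 2 / 2) : ℝ) : ℂ) := by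
    funext ξ; rw [charFun_apply_real, gauss0]
  have h3 : HasDerivAt (fun ξ : ℝ => ((Real.exp (-ξ ^ 2 / 2) : ℝ) : ℂ)) ((Real.exp (-ξ ^ 2 / 2) * (-ξ) : ℝ) : ℂ) ξ := by
    apply HasDerivAt.ofReal_comp
    apply HasDerivAt.exp
    have := ((hasDerivAt_id ξ).pow 2).neg.div_const 2
    refine this.congr_deriv ?_
    simp; ring
  rw [h2, h3.deriv] at h1
  simp only [pow_one] at h1
  have h4 := congrArg (fun z => -Complex.I * z) h1
  simp only [← mul_assoc, neg_mul, Complex.I_mul_I, neg_neg, one_mul] at h4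
  rw [← h4]
  push_cast
  ring

def Eg (s : ℝ) (i : Fin 3) (k : Lat) : ℂ := ((Real.exp (-2 * Real.pi ^ 2 * s ^ 2 * (k i : ℝ) ^ 2) : ℝ) : ℂ)

lemma real_sym {r : Lat → ℝ} (h : ∀ k, |r k| ≤ 1) (h' : ∀ k, r (-k) = r k) : Sym (fun k => (r k : ℂ)) :=
  ⟨⟨1, 0, zero_le_one, fun k => by simpa using h k⟩, fun k => by simp [h']⟩

lemma Eg_sym (s : ℝ) (i : Fin 3) : Sym (Eg s i) := by
  refine real_sym (fun k => ?_) fun k => by simp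
  rw [abs_of_pos (Real.exp_pos _), Real.exp_le_one_iff]
  have : 0 ≤ Real.pi ^ 2 * s ^ 2 * (k i : ℝ) ^ 2 := by positivity
  linarith

lemma chr_single (k : Lat) (i : Fin 3) (a : ℝ) : chr k (Pi.single i a) = Complex.exp (((2 * Real.pi * k i * a : ℝ) : ℂ) * Complex.I) := by
  rw [chr]
  congr 3
  rw [Finset.sum_eq_single i (by intro j _ hj; simp [hj]) (by simp)]
  simp; ring

open ProbabilityTheory in
lemma eg_bounds : ∃ K : ℝ, 1 ≤ K ∧ ∀ s : ℝ, 0 < s → ∀ i, BdO (Eg s i) 1 ∧ BdC (Eg s i) (K * s) ∧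
    BdO (dsym i * Eg s i) (K / s) ∧ BdC (dsym i * Eg s i) K := by
  set c1 := ∫ z : ℝ, |z| ∂(gaussianReal 0 1) with hc1
  set c2 := ∫ z : ℝ, z ^ 2 ∂(gaussianReal 0 1) with hc2
  have i1 : Integrable (fun z : ℝ => z) (gaussianReal 0 1) := by
    have := memLp_id_gaussianReal (μ := 0) (v := 1) 1
    exact memLp_one_iff_integrable.1 (by simpa [Function.id_def] using this)
  have i2 : Integrable (fun z : ℝ => z ^ 2) (gaussianReal 0 1) := by
    have := memLp_id_gaussianReal (μ := 0) (v := 1) 2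
    exact MemLp.integrable_sq (f := id) (by simpa using this)
  have p1 : 0 ≤ c1 := integral_nonneg fun z => abs_nonneg _
  have p2 : 0 ≤ c2 := integral_nonneg fun z => sq_nonneg _
  refine ⟨3 * c1 + 3 * c2 + 1, by linarith, fun s hs i => ?_⟩
  have hy : Measurable fun z : ℝ => (Pi.single i (s * z) : Spc) := by
    refine measurable_pi_lambda _ fun j => ?_
    by_cases h : j = i
    · subst h; simp only [Pi.single_eq_same]; fun_prop
    · simp [h]
  have hny : ∀ z : ℝ, ‖(Pi.single i (s * z) : Spc)‖ = s * |z| := fun z => by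
    rw [Pi.norm_single, norm_mul, Real.norm_of_nonneg hs.le, Real.norm_eq_abs]
  have e0 : ∀ k, Eg s i k = ∫ z, trm 1 (Pi.single i (s * z)) k ∂(gaussianReal 0 1) := by
    intro k
    have := gauss0 (2 * Real.pi * k i * s)
    rw [Eg]
    rw [show -2 * Real.pi ^ 2 * s ^ 2 * (k i : ℝ) ^ 2 = -(2 * Real.pi * k i * s) ^ 2 / 2 by ring, ← this]
    congr 1; funext z
    rw [trm, chr_single]
    push_cast
    rw [one_mul]
    congr 1; ring
  have e1 : ∀ k, (dsym i * Eg s i) k = ∫ z, trm (z / s) (Pi.single i (s * z)) k ∂(gaussianReal 0 1) := by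
    intro k
    have := gauss1 (2 * Real.pi * k i * s)
    rw [Pi.mul_apply, Eg]
    rw [show -2 * Real.pi ^ 2 * s ^ 2 * (k i : ℝ) ^ 2 = -(2 * Real.pi * k i * s) ^ 2 / 2 by ring]
    have h2 : ∀ z : ℝ, trm (z / s) (Pi.single i (s * z)) k = (s : ℂ)⁻¹ * ((z : ℂ) * Complex.exp (((2 * Real.pi * k i * s : ℝ) : ℂ) * z * Complex.I)) := by
      intro z
      rw [trm, chr_single]
      push_cast
      rw [div_eq_mul_inv, mul_comm (z : ℂ), mul_assoc]
      congr 3; ring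
    simp only [h2]
    rw [integral_const_mul, this, dsym]
    have : (s : ℂ) ≠ 0 := by exact_mod_cast hs.ne'
    push_cast
    field_simp
  refine ⟨?_, ?_, ?_, ?_⟩
  · have := bdo_trm (Eg_sym s i) (w := fun _ => 1) measurable_const hy (integrable_const _) e0
    simpa using this
  · have := bdc_trm (Eg_sym s i) (w := fun _ => 1) measurable_const hy (integrable_const _)
      (by simp only [hny, abs_one, one_mul]; exact i1.abs.const_mul _) e0
    simp only [hny, abs_one, one_mul] at this
    rw [integral_const_mul, ← hc1] at this
    exact this.mono (by nlinarith)
  · have := bdo_trm ((Sym.dsym i).mul (Eg_sym s i)) (w := fun z => z / s) (measurable_id.div_const s) hy (i1.div_const s) e1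
    simp only [abs_div, abs_of_pos hs] at this
    rw [integral_div, ← hc1] at this
    exact this.mono (by gcongr; linarith)
  · have h3 : ∀ z : ℝ, |z / s| * (s * |z|) = z ^ 2 := fun z => by
      rw [abs_div, abs_of_pos hs, ← sq_abs z]; field_simp
    have := bdc_trm ((Sym.dsym i).mul (Eg_sym s i)) (w := fun z => z / s) (measurable_id.div_const s) hy (i1.div_const s)
      (by simp only [hny, h3]; exact i2) e1
    simp only [hny, h3] at this
    exact this.mono (by linarith)

def Gg (s : ℝ) (k : Lat) : ℂ := ((Real.exp (-2 * Real.pi ^ 2 * s ^ 2 * kn k ^ 2) : ℝ) : ℂ)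
def Fg (s : ℝ) (k : Lat) : ℂ := ((Real.exp (-4 * Real.pi ^ 2 * s ^ 2 * kn k ^ 2) : ℝ) : ℂ)

lemma Gg_eq (s : ℝ) (i : Fin 3) : Gg s = Eg s i * (Eg s (i + 1) * Eg s (i + 2)) := by
  funext k
  simp only [Pi.mul_apply, Gg, Eg, kn_sq, ← Complex.ofReal_mul, ← Real.exp_add, Fin.sum_univ_three]
  congr 2
  fin_cases i <;> simp <;> ring

lemma Fg_eq (s : ℝ) : Fg s = Gg s * Gg s := by
  funext k
  simp only [Pi.mul_apply, Gg, Fg, ← Complex.ofReal_mul, ← Real.exp_add]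
  congr 2
  ring

lemma Gg_sym (s : ℝ) : Sym (Gg s) := by
  rw [Gg_eq s 0]; exact (Eg_sym _ _).mul ((Eg_sym _ _).mul (Eg_sym _ _))
lemma Fg_sym (s : ℝ) : Sym (Fg s) := by
  rw [Fg_eq]; exact (Gg_sym _).mul (Gg_sym _)

lemma fg_bounds : ∃ K : ℝ, 1 ≤ K ∧ ∀ s : ℝ, 0 < s → BdO (Fg s) 1 ∧ (∀ i, BdO (dsym i * Fg s) (K / s)) ∧
    (∀ i, BdC (dsym i * Fg s) K) ∧ ∀ i j, BdC (dsym i * dsym j * Fg s) (K / s) := by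
  obtain ⟨K, hK, H⟩ := eg_bounds
  have key : ∀ s : ℝ, 0 < s → BdO (Gg s) 1 ∧ BdC (Gg s) (3 * K * s) ∧ ∀ i, BdO (dsym i * Gg s) (K / s) ∧
      BdC (dsym i * Gg s) (K + 2 * K ^ 2) := by
    intro s hs
    have hO := fun i => (H s hs i).1
    have hC := fun i => (H s hs i).2.1
    have hKs : 0 ≤ K * s := by positivity
    have b1 : ∀ i j, BdO (Eg s i * Eg s j) 1 := fun i j => by
      simpa using BdO.mul (Eg_sym s i) (Eg_sym s j) zero_le_one (hO i) (hO j)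
    have b2 : ∀ i j, BdC (Eg s i * Eg s j) (2 * (K * s)) := fun i j => by
      have := BdC.mul (Eg_sym s i) (Eg_sym s j) zero_le_one hKs (hO i) (hO j) (hC i) (hC j)
      exact this.mono (by linarith)
    have sy := fun i j => (Eg_sym s i).mul (Eg_sym s j)
    refine ⟨?_, ?_, fun i => ⟨?_, ?_⟩⟩
    · rw [Gg_eq s 0]
      simpa using BdO.mul (Eg_sym s 0) (sy _ _) zero_le_one (hO 0) (b1 _ _)
    · rw [Gg_eq s 0]
      have := BdC.mul (Eg_sym s 0) (sy _ _) zero_le_one hKs (hO 0) (b1 _ _) (hC 0) (b2 (0+1) (0+2))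
      exact this.mono (by linarith)
    · rw [Gg_eq s i, ← mul_assoc]
      simpa using BdO.mul ((Sym.dsym i).mul (Eg_sym s i)) (sy _ _) (by positivity) (H s hs i).2.2.1 (b1 _ _)
    · rw [Gg_eq s i, ← mul_assoc]
      have := BdC.mul ((Sym.dsym i).mul (Eg_sym s i)) (sy _ _) (by positivity) (by positivity) (H s hs i).2.2.1 (b1 _ _)
        (H s hs i).2.2.2 (b2 (i+1) (i+2))
      refine this.mono (le_of_eq ?_)
      field_simp
  refine ⟨2 * K * (K + 2 * K ^ 2) + K + 5 * K ^ 2, by nlinarith [sq_nonneg K], fun s hs => ?_⟩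
  obtain ⟨g1, g2, g3⟩ := key s hs
  have hK2 : 0 ≤ K := by linarith
  refine ⟨?_, fun i => ?_, fun i => ?_, fun i j => ?_⟩
  · rw [Fg_eq]; simpa using BdO.mul (Gg_sym s) (Gg_sym s) zero_le_one g1 g1
  · rw [Fg_eq, ← mul_assoc]
    have := BdO.mul ((Sym.dsym i).mul (Gg_sym s)) (Gg_sym s) (by positivity) (g3 i).1 g1
    refine this.mono ?_
    rw [mul_one]
    gcongr
    have : 0 ≤ 2 * K * (K + 2 * K ^ 2) + 5 * K ^ 2 := by positivity
    linarith
  · rw [Fg_eq, ← mul_assoc]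
    have := BdC.mul ((Sym.dsym i).mul (Gg_sym s)) (Gg_sym s) (by positivity) (by positivity) (g3 i).1 g1 (g3 i).2 g2
    refine this.mono ?_
    have e : K / s * (3 * K * s) = 3 * K ^ 2 := by field_simp
    rw [e]
    have : 0 ≤ 2 * K * (K + 2 * K ^ 2) := by positivity
    linarith
  · have e : dsym i * dsym j * Fg s = (dsym i * Gg s) * (dsym j * Gg s) := by rw [Fg_eq]; ring
    rw [e]
    have := BdC.mul ((Sym.dsym i).mul (Gg_sym s)) ((Sym.dsym j).mul (Gg_sym s)) (by positivity) (by positivity) (g3 i).1 (g3 j).1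
      (g3 i).2 (g3 j).2
    refine this.mono ?_
    rw [le_div_iff₀ hs]
    have : ((K + 2 * K ^ 2) * (K / s) + K / s * (K + 2 * K ^ 2)) * s = 2 * K * (K + 2 * K ^ 2) := by field_simp; ring
    rw [this]
    have : 0 ≤ K + 5 * K ^ 2 := by positivity
    linarith

/-- the averaged heat symbol: `H = ∫₀¹ exp(-4π² r |k|²/Λ²) dr`. -/
def Hr (Λ : ℝ) (k : Lat) : ℝ := ∫ r in Set.Ioc (0:ℝ) 1, Real.exp (-4 * Real.pi ^ 2 * (√r / Λ) ^ 2 * kn k ^ 2)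
def Hs (Λ : ℝ) (k : Lat) : ℂ := (Hr Λ k : ℂ)

lemma hexp_le (s : ℝ) (k : Lat) : Real.exp (-4 * Real.pi ^ 2 * s ^ 2 * kn k ^ 2) ≤ 1 := by
  rw [Real.exp_le_one_iff]
  have : 0 ≤ Real.pi ^ 2 * s ^ 2 * kn k ^ 2 := by positivity
  linarith

lemma Hs_sym (Λ : ℝ) : Sym (Hs Λ) := by
  refine real_sym (fun k => ?_) fun k => by simp [Hr, kn_neg]
  have := norm_setIntegral_le_of_norm_le_const (μ := volume) (s := Set.Ioc (0:ℝ) 1) (C := 1)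
    (f := fun r => Real.exp (-4 * Real.pi ^ 2 * (√r / Λ) ^ 2 * kn k ^ 2)) (by simp)
    (fun r _ => by rw [Real.norm_of_nonneg (Real.exp_pos _).le]; exact hexp_le _ _)
  simpa [Hr, Measure.real] using this

lemma Hs_eq {Λ : ℝ} (hΛ : 0 < Λ) (k : Lat) : 4 * Real.pi ^ 2 * (kn k : ℂ) ^ 2 * Hs Λ k = Λ ^ 2 * (1 - Fg (1 / Λ) k) := by
  rw [Hs, Fg]
  suffices h : 4 * Real.pi ^ 2 * (kn k) ^ 2 * Hr Λ k = Λ ^ 2 * (1 - Real.exp (-4 * Real.pi ^ 2 * (1 / Λ) ^ 2 * kn k ^ 2)) by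
    exact_mod_cast congrArg (fun x : ℝ => (x : ℂ)) h
  set a := 4 * Real.pi ^ 2 * (kn k) ^ 2 / Λ ^ 2 with ha
  have e1 : Hr Λ k = ∫ r in (0:ℝ)..1, Real.exp (-a * r) := by
    rw [Hr, intervalIntegral.integral_of_le zero_le_one]
    refine setIntegral_congr_fun measurableSet_Ioc fun r hr => ?_
    show Real.exp _ = Real.exp _
    rw [div_pow, Real.sq_sqrt hr.1.le]
    congr 1
    rw [ha]; ring
  have e2 : ∫ r in (0:ℝ)..1, a * Real.exp (-a * r) = 1 - Real.exp (-a) := by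
    have hd : ∀ x ∈ Set.uIcc (0:ℝ) 1, HasDerivAt (fun r => -Real.exp (-a * r)) (a * Real.exp (-a * x)) x := by
      intro x _
      have := ((hasDerivAt_id x).const_mul (-a)).exp.neg
      refine this.congr_deriv ?_
      simp; ring
    rw [intervalIntegral.integral_eq_sub_of_hasDerivAt hd (Continuous.intervalIntegrable (by fun_prop) _ _)]
    simp; ring
  rw [intervalIntegral.integral_const_mul, ← e1] at e2
  rw [show -4 * Real.pi ^ 2 * (1 / Λ) ^ 2 * kn k ^ 2 = -a by rw [ha]; ring, ← e2, ha]
  field_simp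

lemma h_bounds : ∃ K : ℝ, 1 ≤ K ∧ ∀ Λ : ℝ, 0 < Λ → ∀ i j, BdC (dsym i * dsym j * Hs Λ) (K * Λ) := by
  obtain ⟨K, hK, H⟩ := fg_bounds
  refine ⟨2 * K, by linarith, fun Λ hΛ i j g f hg hf t B hB hgB => ?_⟩
  have hintg : Integrable (fun r : ℝ => r ^ (-(1/2) : ℝ)) (volume.restrict (Set.Ioc (0:ℝ) 1)) := by
    have := intervalIntegral.intervalIntegrable_rpow' (a := 0) (b := 1) (r := -(1/2)) (by norm_num)
    rwa [intervalIntegrable_iff_integrableOn_Ioc_of_le zero_le_one] at this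
  have hval : ∫ r in Set.Ioc (0:ℝ) 1, r ^ (-(1/2) : ℝ) = 2 := by
    rw [← intervalIntegral.integral_of_le zero_le_one, integral_rpow (by norm_num)]
    norm_num
  have hval' : ∫ r in Set.Ioc (0:ℝ) 1, |r ^ (-(1/2) : ℝ)| = 2 := by
    refine Eq.trans ?_ hval
    refine setIntegral_congr_fun measurableSet_Ioc fun r hr => ?_
    exact abs_of_nonneg (Real.rpow_nonneg hr.1.le _)
  have hsy := fun r : ℝ => ((Sym.dsym i).mul (Sym.dsym j)).mul (Fg_sym (√r / Λ))
  have hm := ((Sym.dsym i).mul (Sym.dsym j)).mul (Hs_sym Λ)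
  have n0 := n4_nonneg (f t)
  have := n4_comm_int (μ := volume.restrict (Set.Ioc (0:ℝ) 1)) (p := 2) (B := fun _ => 49)
    (b := fun r => |r ^ (-(1/2) : ℝ)| * (K * Λ * B * n4 (f t)) * 1) hm hsy hg hf (fun k => ?_) (integrable_const _) (fun r k => ?_) (fun k => ?_) t
    ((hintg.abs.mul_const _).mul_const _) ?_ ?_
  · refine this.trans (le_of_eq ?_)
    rw [integral_mul_const, integral_mul_const, hval']
    ring
  · simp only [Pi.mul_apply, Fg]
    refine measurable_const.mul (Complex.measurable_ofReal.comp ?_)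
    have : Measurable fun r : ℝ => √r := Real.continuous_sqrt.measurable
    fun_prop
  · simp only [Pi.mul_apply, norm_mul]
    have h1 := norm_dsym i k
    have h2 := norm_dsym j k
    have h3 : ‖Fg (√r / Λ) k‖ ≤ 1 := by
      rw [Fg, Complex.norm_real, Real.norm_of_nonneg (Real.exp_pos _).le]; exact hexp_le _ _
    have hw := one_le_wt k
    calc _ ≤ (7 * wt k) * (7 * wt k) * 1 := by gcongr
      _ = _ := by ring
  · simp only [Pi.mul_apply]
    rw [integral_const_mul, Hs, Hr]
    congr 1
    rw [← integral_complex_ofReal]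
    rfl
  · intro r
    positivity
  · filter_upwards [ae_restrict_mem measurableSet_Ioc] with r hr
    have hs : 0 < √r / Λ := div_pos (Real.sqrt_pos.2 hr.1) hΛ
    refine ((H _ hs).2.2.2 i j g f hg hf t B hB hgB).trans (le_of_eq ?_)
    rw [abs_of_nonneg (Real.rpow_nonneg hr.1.le _), Real.rpow_neg hr.1.le, ← Real.sqrt_eq_rpow]
    field_simp

end TE

namespace TE
open scoped ComplexConjugate

section ode
variable {X : Type*} [NormedAddCommGroup X] [NormedSpace ℝ X] [CompleteSpace X]

def dys (B : ℝ → X →L[ℝ] X) (f : ℝ → X) (ts : ℝ) : ℕ → ℝ → X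
  | 0 => fun t => ∫ s in ts..t, f s
  | n + 1 => fun t => ∫ s in ts..t, B s (dys B f ts n s)

lemma lin_ode {B : ℝ → X →L[ℝ] X} (hB : Continuous fun p : ℝ × X => B p.1 p.2) {M : ℝ} (hM : ∀ t, ‖B t‖ ≤ M)
    {f : ℝ → X} (hf : Continuous f) {K : ℝ} (hK : ∀ t, ‖f t‖ ≤ K) (ts : ℝ) :
    ∃ a : ℝ → X, a ts = 0 ∧ ∀ t, HasDerivAt a (B t (a t) + f t) t := by
  have hM0 : 0 ≤ M := (norm_nonneg _).trans (hM 0)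
  have hK0 : 0 ≤ K := (norm_nonneg _).trans (hK 0)
  have hc : ∀ n, Continuous (dys B f ts n) := by
    intro n
    induction n with
    | zero => exact intervalIntegral.continuous_primitive (fun a b => hf.intervalIntegrable a b) ts
    | succ n ih =>
      have : Continuous fun s => B s (dys B f ts n s) := hB.comp (continuous_id.prodMk ih)
      exact intervalIntegral.continuous_primitive (fun a b => this.intervalIntegrable a b) ts
  have hc' : ∀ n, Continuous fun s => B s (dys B f ts n s) := fun n => hB.comp (continuous_id.prodMk (hc n))
  have hd0 : ∀ t, HasDerivAt (dys B f ts 0) (f t) t := fun t =>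
    intervalIntegral.integral_hasDerivAt_right (hf.intervalIntegrable _ _) (hf.stronglyMeasurableAtFilter _ _) hf.continuousAt
  have hd : ∀ n t, HasDerivAt (dys B f ts (n + 1)) (B t (dys B f ts n t)) t := fun n t =>
    intervalIntegral.integral_hasDerivAt_right ((hc' n).intervalIntegrable _ _) ((hc' n).stronglyMeasurableAtFilter _ _) (hc' n).continuousAt
  have hb : ∀ n t, ‖dys B f ts n t‖ ≤ K * M ^ n * |t - ts| ^ (n + 1) / (n + 1).factorial := by
    intro n
    induction n with
    | zero =>
      intro t
      have := intervalIntegral.norm_integral_le_of_norm_le_const (a := ts) (b := t) (f := f) (C := K) (fun s _ => hK s)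
      simpa [dys] using this
    | succ n ih =>
      intro t
      have h1 : ‖∫ s in ts..t, B s (dys B f ts n s)‖ ≤ ∫ s in Set.uIoc ts t, ‖B s (dys B f ts n s)‖ :=
        intervalIntegral.norm_integral_le_integral_norm_uIoc
      have h2 : ∫ s in Set.uIoc ts t, ‖B s (dys B f ts n s)‖ ≤
          ∫ s in Set.uIoc ts t, |s - ts| ^ (n + 1) * (K * M ^ (n + 1) / (n + 1).factorial) := by
        refine setIntegral_mono ?_ ?_ fun s => ?_
        · exact (hc' n).norm.integrableOn_uIoc
        · have : Continuous fun s : ℝ => |s - ts| ^ (n + 1) * (K * M ^ (n + 1) / (n + 1).factorial) := by fun_prop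
          exact this.integrableOn_uIoc
        · refine ((B s).le_opNorm _).trans ?_
          refine (mul_le_mul (hM s) (ih s) (norm_nonneg _) hM0).trans (le_of_eq ?_)
          ring
      rw [integral_mul_const, integral_pow_abs_sub_uIoc] at h2
      refine (h1.trans h2).trans (le_of_eq ?_)
      rw [Nat.factorial_succ (n + 1)]
      push_cast
      field_simp
  have hsum : ∀ R : ℝ, 0 ≤ R → Summable fun n : ℕ => K * R * ((M * R) ^ n / n.factorial) := fun R _ =>
    (Real.summable_pow_div_factorial (M * R)).mul_left _
  have hb' : ∀ R : ℝ, 0 ≤ R → ∀ n t, |t - ts| ≤ R → ‖dys B f ts n t‖ ≤ K * R * ((M * R) ^ n / n.factorial) := by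
    intro R hR n t ht
    refine (hb n t).trans ?_
    have e : K * R * ((M * R) ^ n / n.factorial) = K * M ^ n * R ^ (n + 1) / n.factorial := by rw [mul_pow]; ring
    rw [e]
    have : (n.factorial : ℝ) ≤ (n + 1).factorial := by exact_mod_cast Nat.factorial_le (Nat.le_succ n)
    gcongr
  have hs : ∀ t, Summable fun n => dys B f ts n t := fun t =>
    Summable.of_norm_bounded (hsum _ (abs_nonneg _)) fun n => hb' _ (abs_nonneg _) n t le_rfl
  refine ⟨fun t => ∑' n, dys B f ts n t, ?_, fun t => ?_⟩
  · have : ∀ n, dys B f ts n ts = 0 := fun n => by cases n <;> simp [dys]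
    simp [this]
  · set R := |t - ts| + 1
    have hR : 0 ≤ R := by positivity
    set g' : ℕ → ℝ → X := fun n s => match n with
      | 0 => f s
      | n + 1 => B s (dys B f ts n s)
    have hg : ∀ n s, HasDerivAt (dys B f ts n) (g' n s) s := by
      intro n s
      cases n with
      | zero => exact hd0 s
      | succ n => exact hd n s
    set u : ℕ → ℝ := fun n => match n with
      | 0 => K
      | n + 1 => M * (K * R * ((M * R) ^ n / n.factorial))
    have hu : Summable u := (summable_nat_add_iff 1).1 ((hsum R hR).mul_left M)
    have hopen : IsOpen (Metric.ball ts R) := Metric.isOpen_ball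
    have hmem : t ∈ Metric.ball ts R := by rw [Metric.mem_ball, Real.dist_eq]; simp [R]
    have h1 := hasDerivAt_tsum_of_isPreconnected (u := u) (g := dys B f ts) (g' := g') (t := Metric.ball ts R) (y₀ := t) (y := t) hu hopen
      (convex_ball ts R).isPreconnected (fun n s _ => hg n s) (fun n s hs => ?_) hmem (hs t) hmem
    · refine h1.congr_deriv ?_
      have hs' : Summable fun n => g' n t := by
        refine (summable_nat_add_iff 1).1 ?_
        exact (B t).summable (hs t)
      rw [hs'.tsum_eq_zero_add, (B t).map_tsum (hs t), add_comm]
    · have hs2 : |s - ts| ≤ R := by rw [Metric.mem_ball, Real.dist_eq] at hs; exact hs.le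
      cases n with
      | zero => exact hK s
      | succ n => exact ((B s).le_opNorm _).trans (mul_le_mul (hM s) (hb' R hR n s hs2) (norm_nonneg _) hM0)

end ode

/-- two-sided Gronwall with a primitive `Φ` of the rate -/
lemma gron {y y' Φ φ : ℝ → ℝ} {C K ts : ℝ} (hy : ∀ t, HasDerivAt y (y' t) t) (hΦ : ∀ t, HasDerivAt Φ (φ t) t)
    (hmo : Monotone Φ) (h : ∀ t, |y' t| ≤ C * φ t * (y t + K)) (h0 : y ts = 0) (t : ℝ) :
    y t + K ≤ K * Real.exp (C * |Φ t - Φ ts|) := by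
  rcases le_total ts t with hle | hle
  · have hm : Antitone fun s => (y s + K) * Real.exp (-(C * (Φ s - Φ ts))) := by
      have hd : ∀ s, HasDerivAt (fun s => (y s + K) * Real.exp (-(C * (Φ s - Φ ts))))
          (y' s * Real.exp (-(C * (Φ s - Φ ts))) + (y s + K) * (Real.exp (-(C * (Φ s - Φ ts))) * (-(C * φ s)))) s := fun s =>
        ((hy s).add_const K).mul ((((hΦ s).sub_const _).const_mul C).neg.exp)
      refine antitone_of_deriv_nonpos (fun s => (hd s).differentiableAt) fun s => ?_
      rw [(hd s).deriv]
      have := (abs_le.1 (h s)).2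
      have e := Real.exp_pos (-(C * (Φ s - Φ ts)))
      nlinarith
    have := hm hle
    simp only [sub_self, mul_zero, neg_zero, Real.exp_zero, mul_one, h0, zero_add] at this
    rw [Real.exp_neg, ← div_eq_mul_inv, div_le_iff₀ (Real.exp_pos _)] at this
    have h1 : Φ ts ≤ Φ t := hmo hle
    rwa [abs_of_nonneg (by linarith)]
  · have hm : Monotone fun s => (y s + K) * Real.exp ((C * (Φ s - Φ ts))) := by
      have hd : ∀ s, HasDerivAt (fun s => (y s + K) * Real.exp ((C * (Φ s - Φ ts))))
          (y' s * Real.exp ((C * (Φ s - Φ ts))) + (y s + K) * (Real.exp ((C * (Φ s - Φ ts))) * ((C * φ s)))) s := fun s =>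
        ((hy s).add_const K).mul ((((hΦ s).sub_const _).const_mul C).exp)
      refine monotone_of_deriv_nonneg (fun s => (hd s).differentiableAt) fun s => ?_
      rw [(hd s).deriv]
      have := (abs_le.1 (h s)).1
      have e := Real.exp_pos ((C * (Φ s - Φ ts)))
      nlinarith
    have := hm hle
    simp only [sub_self, mul_zero, Real.exp_zero, mul_one, h0, zero_add] at this
    have h1 : Φ t ≤ Φ ts := hmo hle
    rw [abs_of_nonpos (by linarith), ← neg_sub, neg_neg] 
    have e := Real.exp_pos ((C * (Φ t - Φ ts)))
    rw [← div_le_iff₀ (Real.exp_pos _), div_eq_mul_inv, ← Real.exp_neg]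
    rwa [show -(C * (Φ ts - Φ t)) = C * (Φ t - Φ ts) by ring]

end TE

namespace TE
open scoped ComplexConjugate

lemma sqrt_wt_sub (k m : Lat) : √(wt k) ≤ √(wt m) + √(wt (k - m)) := by
  have hm := wt_pos m
  have hd := wt_pos (k - m)
  apply Real.sqrt_le_left (by positivity) |>.2 
  rw [add_sq, Real.sq_sqrt hm.le, Real.sq_sqrt hd.le, mul_assoc, ← Real.sqrt_mul hm.le]
  have h1 : ∑ i, (m i : ℝ) * ((k - m) i : ℝ) ≤ √(wt m * wt (k - m)) := by
    apply Real.le_sqrt_of_sq_le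
    refine (Finset.sum_mul_sq_le_sq_mul_sq _ _ _).trans ?_
    have e1 : ∑ i, (m i : ℝ) ^ 2 ≤ wt m := by unfold wt; linarith
    have e2 : ∑ i, (((k - m) i : ℤ) : ℝ) ^ 2 ≤ wt (k - m) := by unfold wt; linarith
    exact mul_le_mul e1 e2 (Finset.sum_nonneg fun i _ => sq_nonneg _) hm.le
  have h2 : wt k = wt m + 2 * (∑ i, (m i : ℝ) * ((k - m) i : ℝ)) + (wt (k - m) - 1) := by
    unfold wt
    simp only [Fin.sum_univ_three, Pi.sub_apply, Int.cast_sub]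
    ring
  linarith

lemma wt_sub_comm (k m : Lat) : wt (m - k) = wt (k - m) := by rw [← wt_neg, neg_sub]

lemma wt_diff (k m : Lat) : |wt k - wt m| ≤ wt (k - m) * (√(wt k) + √(wt m)) := by
  have h1 := sqrt_wt_sub k m
  have h2 := sqrt_wt_sub m k
  rw [wt_sub_comm] at h2
  have h3 : √(wt (k - m)) ≤ wt (k - m) := by
    rw [Real.sqrt_le_left (wt_pos _).le]
    nlinarith [one_le_wt (k - m)]
  have e : wt k - wt m = (√(wt k) - √(wt m)) * (√(wt k) + √(wt m)) := by
    have a1 := Real.mul_self_sqrt (wt_pos k).le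
    have a2 := Real.mul_self_sqrt (wt_pos m).le
    linarith
  rw [e, abs_mul, abs_of_nonneg (a := √(wt k) + √(wt m)) (by positivity)]
  refine mul_le_mul_of_nonneg_right ?_ (by positivity)
  rw [abs_le]; constructor <;> linarith

lemma kw (q : ℕ) (k m : Lat) : |wt k ^ (2 * q) - wt m ^ (2 * q)| * √(wt m) ≤
    4 * q * 2 ^ q * wt (k - m) ^ (q + 1) * (wt k ^ q * wt m ^ q) := by
  rcases Nat.eq_zero_or_pos q with rfl | hq
  · simp
  set A := wt k
  set B := wt m
  set E := wt (k - m)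
  have hA : 0 < A := wt_pos k
  have hB : 0 < B := wt_pos m
  have hE : 0 < E := wt_pos _
  set X := max A B with hX
  have hX0 : 0 < X := lt_max_of_lt_left hA
  have hAX : A ≤ X := le_max_left _ _
  have hBX : B ≤ X := le_max_right _ _
  have h1 := abs_pow_sub_pow_le A B (2 * q)
  rw [abs_of_pos hA, abs_of_pos hB, ← hX] at h1
  have h2 := wt_diff k m
  have h3 : X ^ q ≤ (2 * E) ^ q * (min A B) ^ q := by
    rw [← mul_pow]
    refine pow_le_pow_left₀ hX0.le ?_ q
    rcases le_total A B with h | h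
    · rw [hX, max_eq_right h, min_eq_left h]
      have := wt_le_sub m k
      rwa [wt_sub_comm] at this
    · rw [hX, max_eq_left h, min_eq_right h]
      exact wt_le_sub k m
  have h4 : X ^ q * (min A B) ^ q = A ^ q * B ^ q := by
    rw [← mul_pow, ← mul_pow, hX, max_mul_min]
  have sA : √A ≤ √X := Real.sqrt_le_sqrt hAX
  have sB : √B ≤ √X := Real.sqrt_le_sqrt hBX
  have sX := Real.mul_self_sqrt hX0.le
  have h5 : |A - B| * √B ≤ 2 * E * X := by
    calc |A - B| * √B ≤ (E * (√X + √X)) * √X := by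
          refine mul_le_mul (h2.trans ?_) sB (Real.sqrt_nonneg _) (by positivity)
          exact mul_le_mul_of_nonneg_left (by linarith) hE.le
      _ = 2 * E * (√X * √X) := by ring
      _ = _ := by rw [sX]
  have hpow : X * X ^ (2 * q - 1) = X ^ q * X ^ q := by
    rw [← pow_add, ← pow_succ']
    congr 1; omega
  calc |A ^ (2 * q) - B ^ (2 * q)| * √B ≤ (|A - B| * (2 * q : ℕ) * X ^ (2 * q - 1)) * √B :=
        mul_le_mul_of_nonneg_right h1 (Real.sqrt_nonneg _)
    _ = (|A - B| * √B) * ((2 * q : ℕ) * X ^ (2 * q - 1)) := by ring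
    _ ≤ (2 * E * X) * ((2 * q : ℕ) * X ^ (2 * q - 1)) := mul_le_mul_of_nonneg_right h5 (by positivity)
    _ = 4 * q * E * (X ^ q * X ^ q) := by rw [← hpow]; push_cast; ring
    _ ≤ 4 * q * E * (X ^ q * ((2 * E) ^ q * (min A B) ^ q)) := by gcongr
    _ = 4 * q * E * (2 * E) ^ q * (X ^ q * (min A B) ^ q) := by ring
    _ = _ := by rw [h4, mul_pow]; ring

section
variable {D : Type*} [Fintype D]

lemma sum_prod_le {Ψ : Lat → ℝ} (h0 : ∀ k, 0 ≤ Ψ k) (hs : Summable Ψ) (F : Finset (Lat × D)) :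
    ∑ j ∈ F, Ψ j.1 ≤ Fintype.card D * ∑' k, Ψ k := by
  classical
  calc ∑ j ∈ F, Ψ j.1 ≤ ∑ j ∈ (F.image Prod.fst) ×ˢ (Finset.univ : Finset D), Ψ j.1 := by
        refine Finset.sum_le_sum_of_subset_of_nonneg (fun j hj => ?_) fun j _ _ => h0 _
        simp only [Finset.mem_product, Finset.mem_image, Finset.mem_univ, and_true]
        exact ⟨j, hj, rfl⟩
    _ = Fintype.card D * ∑ k ∈ F.image Prod.fst, Ψ k := by
        rw [Finset.sum_product]
        simp [Finset.mul_sum]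
    _ ≤ _ := mul_le_mul_of_nonneg_left (hs.sum_le_tsum _ fun k _ => h0 k) (by positivity)

lemma schur {Ψ : Lat → ℝ} (h0 : ∀ k, 0 ≤ Ψ k) (hs : Summable Ψ) (F : Finset (Lat × D)) (z : Lat × D → ℝ) :
    ∑ i ∈ F, ∑ j ∈ F, Ψ (i.1 - j.1) * (z i * z j) ≤ Fintype.card D * (∑' k, Ψ k) * ∑ i ∈ F, z i ^ 2 := by
  set S := Fintype.card D * ∑' k, Ψ k
  have r1 : ∀ i : Lat × D, ∑ j ∈ F, Ψ (i.1 - j.1) ≤ S := fun i => by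
    have := sum_prod_le (Ψ := fun m => Ψ (i.1 - m)) (fun k => h0 _) ((Equiv.subLeft i.1).summable_iff.2 hs) F
    have e : ∑' k, Ψ (i.1 - k) = ∑' k, Ψ k := (Equiv.subLeft i.1).tsum_eq Ψ
    rwa [e] at this
  have r2 : ∀ j : Lat × D, ∑ i ∈ F, Ψ (i.1 - j.1) ≤ S := fun j => by
    have := sum_prod_le (Ψ := fun m => Ψ (m - j.1)) (fun k => h0 _) ((Equiv.subRight j.1).summable_iff.2 hs) F
    have e : ∑' k, Ψ (k - j.1) = ∑' k, Ψ k := (Equiv.subRight j.1).tsum_eq Ψ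
    rwa [e] at this
  calc ∑ i ∈ F, ∑ j ∈ F, Ψ (i.1 - j.1) * (z i * z j) ≤
      ∑ i ∈ F, ∑ j ∈ F, (Ψ (i.1 - j.1) * (z i ^ 2 / 2) + Ψ (i.1 - j.1) * (z j ^ 2 / 2)) := by
        refine Finset.sum_le_sum fun i _ => Finset.sum_le_sum fun j _ => ?_
        rw [← mul_add]
        exact mul_le_mul_of_nonneg_left (by nlinarith [sq_nonneg (z i - z j)]) (h0 _)
    _ = (∑ i ∈ F, (∑ j ∈ F, Ψ (i.1 - j.1)) * (z i ^ 2 / 2)) + ∑ j ∈ F, (∑ i ∈ F, Ψ (i.1 - j.1)) * (z j ^ 2 / 2) := by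
        simp only [Finset.sum_add_distrib, Finset.sum_mul]
        congr 1
        exact Finset.sum_comm
    _ ≤ (∑ i ∈ F, S * (z i ^ 2 / 2)) + ∑ j ∈ F, S * (z j ^ 2 / 2) := by
        refine add_le_add (Finset.sum_le_sum fun i _ => ?_) (Finset.sum_le_sum fun i _ => ?_)
        · exact mul_le_mul_of_nonneg_right (r1 i) (by positivity)
        · exact mul_le_mul_of_nonneg_right (r2 i) (by positivity)
    _ = _ := by rw [← Finset.sum_add_distrib, Finset.mul_sum]; refine Finset.sum_congr rfl fun i _ => ?_; ring

def ph (t : ℝ) : ℝ := 1 / (1 + t ^ 2)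
lemma ph_pos (t : ℝ) : 0 < ph t := by unfold ph; positivity
lemma ph_le (t : ℝ) : ph t ≤ 1 := by
  unfold ph; rw [div_le_one (by positivity)]; nlinarith [sq_nonneg t]

variable (D) in
structure Gal where
  σ : Lat × D → Lat × D → ℝ → ℂ
  β : Lat × D → Lat × D → ℝ → ℂ
  f : Lat × D → ℝ → ℂ
  ψ : Lat → ℝ
  cσ : ∀ i j, Continuous (σ i j)
  cβ : ∀ i j, Continuous (β i j)
  cf : ∀ i, Continuous (f i)
  ψ0 : ∀ k, 0 ≤ ψ k
  hψ : ∀ p : ℕ, Summable fun k => wt k ^ p * ψ k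
  anti : ∀ i j t, σ j i t = - conj (σ i j t)
  hσ : ∀ i j t, ‖σ i j t‖ ≤ ph t * (ψ (i.1 - j.1) * √(wt j.1))
  hβ : ∀ i j t, ‖β i j t‖ ≤ ph t * ψ (i.1 - j.1)
  hf : ∀ p : ℕ, ∃ C : ℝ, ∀ i t, ‖f i t‖ * wt i.1 ^ p ≤ C * ph t

namespace Gal
variable (G : Gal D)

def b (i j : Lat × D) (t : ℝ) : ℂ := G.σ i j t + G.β i j t

def c1 (q : ℕ) : ℝ := Fintype.card D * (∑' k, (4 * q * 2 ^ q * (wt k ^ (q + 1) * G.ψ k))) +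
  (Fintype.card D * ∑' k, (2 * 2 ^ q * (wt k ^ q * G.ψ k))) + 1

lemma hs1 (q : ℕ) : Summable fun k => (4 * q * 2 ^ q * (wt k ^ (q + 1) * G.ψ k)) := (G.hψ _).mul_left _
lemma hs2 (q : ℕ) : Summable fun k => (2 * 2 ^ q * (wt k ^ q * G.ψ k)) := (G.hψ _).mul_left _

lemma part1 (q : ℕ) (F : Finset (Lat × D)) (a : Lat × D → ℂ) (t : ℝ) :
    |∑ i ∈ F, ∑ j ∈ F, wt i.1 ^ (2 * q) * (2 * (conj (a i) * (G.σ i j t * a j)).re)| ≤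
    ph t * (Fintype.card D * (∑' k, (4 * q * 2 ^ q * (wt k ^ (q + 1) * G.ψ k))) * ∑ i ∈ F, (wt i.1 ^ q * ‖a i‖) ^ 2) := by
  set r : Lat × D → Lat × D → ℝ := fun i j => (conj (a i) * (G.σ i j t * a j)).re with hr
  have hanti : ∀ i j, r j i = - r i j := by
    intro i j
    simp only [hr]
    rw [G.anti i j t, ← Complex.conj_re, ← Complex.neg_re]
    congr 1
    simp only [map_mul, map_neg, Complex.conj_conj]
    ring
  have e : ∑ i ∈ F, ∑ j ∈ F, wt i.1 ^ (2 * q) * (2 * r i j) = ∑ i ∈ F, ∑ j ∈ F, (wt i.1 ^ (2 * q) - wt j.1 ^ (2 * q)) * r i j := by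
    have e1 : ∑ i ∈ F, ∑ j ∈ F, wt j.1 ^ (2 * q) * r i j = - ∑ i ∈ F, ∑ j ∈ F, wt i.1 ^ (2 * q) * r i j := by
      rw [Finset.sum_comm, ← Finset.sum_neg_distrib]
      refine Finset.sum_congr rfl fun i _ => ?_
      rw [← Finset.sum_neg_distrib]
      refine Finset.sum_congr rfl fun j _ => ?_
      rw [hanti i j]; ring
    simp only [sub_mul, Finset.sum_sub_distrib]
    rw [e1, sub_neg_eq_add, ← Finset.sum_add_distrib]
    refine Finset.sum_congr rfl fun i _ => ?_
    rw [← Finset.sum_add_distrib]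
    refine Finset.sum_congr rfl fun j _ => ?_
    ring
  rw [e]
  have sc := schur (D := D) (Ψ := fun k => 4 * q * 2 ^ q * (wt k ^ (q + 1) * G.ψ k))
    (fun k => by have := G.ψ0 k; have := wt_pos k; positivity) (G.hs1 q) F (fun i => wt i.1 ^ q * ‖a i‖)
  refine le_trans ?_ (mul_le_mul_of_nonneg_left sc (ph_pos t).le)
  rw [Finset.mul_sum]
  refine (Finset.abs_sum_le_sum_abs _ _).trans (Finset.sum_le_sum fun i _ => ?_)
  rw [Finset.mul_sum]
  refine (Finset.abs_sum_le_sum_abs _ _).trans (Finset.sum_le_sum fun j _ => ?_)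
  rw [abs_mul]
  have h1 : |r i j| ≤ ‖a i‖ * (ph t * (G.ψ (i.1 - j.1) * √(wt j.1)) * ‖a j‖) := by
    refine (Complex.abs_re_le_norm _).trans ?_
    rw [norm_mul, norm_mul, RCLike.norm_conj]
    exact mul_le_mul_of_nonneg_left (mul_le_mul_of_nonneg_right (G.hσ i j t) (norm_nonneg _)) (norm_nonneg _)
  have h2 := kw q i.1 j.1
  have p0 := ph_pos t
  have p1 := G.ψ0 (i.1 - j.1)
  calc _ ≤ |wt i.1 ^ (2 * q) - wt j.1 ^ (2 * q)| * (‖a i‖ * (ph t * (G.ψ (i.1 - j.1) * √(wt j.1)) * ‖a j‖)) :=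
        mul_le_mul_of_nonneg_left h1 (abs_nonneg _)
    _ = (|wt i.1 ^ (2 * q) - wt j.1 ^ (2 * q)| * √(wt j.1)) * (‖a i‖ * (ph t * (G.ψ (i.1 - j.1)) * ‖a j‖)) := by ring
    _ ≤ (4 * q * 2 ^ q * wt (i.1 - j.1) ^ (q + 1) * (wt i.1 ^ q * wt j.1 ^ q)) * (‖a i‖ * (ph t * (G.ψ (i.1 - j.1)) * ‖a j‖)) :=
        mul_le_mul_of_nonneg_right h2 (by positivity)
    _ = _ := by ring

lemma part2 (q : ℕ) (F : Finset (Lat × D)) (a : Lat × D → ℂ) (t : ℝ) :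
    |∑ i ∈ F, ∑ j ∈ F, wt i.1 ^ (2 * q) * (2 * (conj (a i) * (G.β i j t * a j)).re)| ≤
    ph t * (Fintype.card D * (∑' k, (2 * 2 ^ q * (wt k ^ q * G.ψ k))) * ∑ i ∈ F, (wt i.1 ^ q * ‖a i‖) ^ 2) := by
  have sc := schur (D := D) (Ψ := fun k => 2 * 2 ^ q * (wt k ^ q * G.ψ k))
    (fun k => by have := G.ψ0 k; have := wt_pos k; positivity) (G.hs2 q) F (fun i => wt i.1 ^ q * ‖a i‖)
  refine le_trans ?_ (mul_le_mul_of_nonneg_left sc (ph_pos t).le)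
  rw [Finset.mul_sum]
  refine (Finset.abs_sum_le_sum_abs _ _).trans (Finset.sum_le_sum fun i _ => ?_)
  rw [Finset.mul_sum]
  refine (Finset.abs_sum_le_sum_abs _ _).trans (Finset.sum_le_sum fun j _ => ?_)
  have w1 := wt_pos i.1
  have w2 := wt_pos j.1
  have w3 := wt_pos (i.1 - j.1)
  rw [abs_mul, abs_mul, abs_two, abs_of_pos (by positivity : 0 < wt i.1 ^ (2 * q))]
  have h1 : |(conj (a i) * (G.β i j t * a j)).re| ≤ ‖a i‖ * (ph t * (G.ψ (i.1 - j.1)) * ‖a j‖) := by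
    refine (Complex.abs_re_le_norm _).trans ?_
    rw [norm_mul, norm_mul, RCLike.norm_conj]
    exact mul_le_mul_of_nonneg_left (mul_le_mul_of_nonneg_right (G.hβ i j t) (norm_nonneg _)) (norm_nonneg _)
  have h2 : wt i.1 ^ q ≤ (2 * wt (i.1 - j.1) * wt j.1) ^ q := pow_le_pow_left₀ w1.le (wt_le_sub _ _) q
  have p0 := ph_pos t
  have p1 := G.ψ0 (i.1 - j.1)
  calc _ ≤ wt i.1 ^ (2 * q) * (2 * (‖a i‖ * (ph t * (G.ψ (i.1 - j.1)) * ‖a j‖))) := by gcongr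
    _ = wt i.1 ^ q * (wt i.1 ^ q * (2 * (‖a i‖ * (ph t * (G.ψ (i.1 - j.1)) * ‖a j‖)))) := by rw [two_mul q, pow_add]; ring
    _ ≤ (2 * wt (i.1 - j.1) * wt j.1) ^ q * (wt i.1 ^ q * (2 * (‖a i‖ * (ph t * (G.ψ (i.1 - j.1)) * ‖a j‖)))) :=
        mul_le_mul_of_nonneg_right h2 (by positivity)
    _ = _ := by rw [mul_pow, mul_pow]; ring

lemma energy (q : ℕ) {F : Finset (Lat × D)} {a e : Lat × D → ℝ → ℂ} {ts K : ℝ} (hK : 0 ≤ K)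
    (hd : ∀ i ∈ F, ∀ t, HasDerivAt (a i) (∑ j ∈ F, G.b i j t * a j t + e i t) t) (h0 : ∀ i ∈ F, a i ts = 0)
    (he : ∀ t, ∑ i ∈ F, (wt i.1 ^ q * ‖e i t‖) ^ 2 ≤ ph t ^ 2 * K) (t : ℝ) :
    ∑ i ∈ F, (wt i.1 ^ q * ‖a i t‖) ^ 2 ≤ K * Real.exp (G.c1 q * Real.pi) := by
  set y : ℝ → ℝ := fun t => ∑ i ∈ F, wt i.1 ^ (2 * q) * ‖a i t‖ ^ 2 with hy
  have ye : ∀ t, ∑ i ∈ F, (wt i.1 ^ q * ‖a i t‖) ^ 2 = y t := fun t => by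
    refine Finset.sum_congr rfl fun i _ => ?_
    rw [mul_pow, ← pow_mul, mul_comm q]
  have y0 : ∀ t, 0 ≤ y t := fun t => by rw [← ye]; positivity
  set y' : ℝ → ℝ := fun t => ∑ i ∈ F, wt i.1 ^ (2 * q) * (2 * (conj (a i t) * (∑ j ∈ F, G.b i j t * a j t + e i t)).re) with hy'
  have hder : ∀ t, HasDerivAt y (y' t) t := by
    intro t
    refine HasDerivAt.fun_sum fun i hi => ?_
    have := ((hd i hi t).norm_sq).const_mul (wt i.1 ^ (2 * q))
    refine this.congr_deriv ?_
    rw [Complex.inner, mul_comm (conj _)]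
  have n1 : 0 ≤ Fintype.card D * (∑' k, (4 * q * 2 ^ q * (wt k ^ (q + 1) * G.ψ k))) :=
    mul_nonneg (by positivity) (tsum_nonneg fun k => by have := G.ψ0 k; have := wt_pos k; positivity)
  have n2 : 0 ≤ Fintype.card D * (∑' k, (2 * 2 ^ q * (wt k ^ q * G.ψ k))) :=
    mul_nonneg (by positivity) (tsum_nonneg fun k => by have := G.ψ0 k; have := wt_pos k; positivity)
  have hbd : ∀ t, |y' t| ≤ G.c1 q * ph t * (y t + K) := by
    intro t
    have e1 : y' t = (∑ i ∈ F, ∑ j ∈ F, wt i.1 ^ (2 * q) * (2 * (conj (a i t) * (G.σ i j t * a j t)).re)) +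
        (∑ i ∈ F, ∑ j ∈ F, wt i.1 ^ (2 * q) * (2 * (conj (a i t) * (G.β i j t * a j t)).re)) +
        ∑ i ∈ F, wt i.1 ^ (2 * q) * (2 * (conj (a i t) * e i t).re) := by
      rw [← Finset.sum_add_distrib, ← Finset.sum_add_distrib]
      refine Finset.sum_congr rfl fun i _ => ?_
      rw [← Finset.sum_add_distrib, mul_add, Complex.add_re, mul_add, mul_add]
      congr 1
      rw [Finset.mul_sum, Complex.re_sum, Finset.mul_sum, Finset.mul_sum]
      refine Finset.sum_congr rfl fun j _ => ?_
      rw [b, add_mul, mul_add, Complex.add_re]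
      ring
    have p1 := G.part1 q F (fun i => a i t) t
    have p2 := G.part2 q F (fun i => a i t) t
    rw [ye] at p1 p2
    have hp := ph_pos t
    have p3 : |∑ i ∈ F, wt i.1 ^ (2 * q) * (2 * (conj (a i t) * e i t).re)| ≤ ph t * (y t + K) := by
      have e2 : ph t * (y t + K) = ph t * y t + (ph t ^ 2 * K) / ph t := by field_simp
      have e3 : (∑ i ∈ F, (wt i.1 ^ q * ‖e i t‖) ^ 2) / ph t ≤ (ph t ^ 2 * K) / ph t := by
        gcongr; exact he t
      rw [e2]
      refine le_trans ?_ (add_le_add_right e3 _)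
      rw [← ye, Finset.mul_sum, Finset.sum_div, ← Finset.sum_add_distrib]
      refine (Finset.abs_sum_le_sum_abs _ _).trans (Finset.sum_le_sum fun i _ => ?_)
      have w1 := wt_pos i.1
      rw [abs_mul, abs_mul, abs_two, abs_of_pos (by positivity : 0 < wt i.1 ^ (2 * q))]
      have h1 : |(conj (a i t) * e i t).re| ≤ ‖a i t‖ * ‖e i t‖ := by
        refine (Complex.abs_re_le_norm _).trans ?_
        rw [norm_mul, RCLike.norm_conj]
      set u := wt i.1 ^ q * ‖a i t‖
      set v := wt i.1 ^ q * ‖e i t‖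
      calc _ ≤ wt i.1 ^ (2 * q) * (2 * (‖a i t‖ * ‖e i t‖)) := by gcongr
        _ = 2 * (u * v) := by rw [two_mul q, pow_add]; simp only [u, v]; ring
        _ ≤ _ := by
          have : ph t * u ^ 2 + v ^ 2 / ph t - 2 * (u * v) = (ph t * u - v) ^ 2 / ph t := by field_simp; ring
          have : 0 ≤ (ph t * u - v) ^ 2 / ph t := by positivity
          linarith
    rw [e1]
    refine (abs_add_three _ _ _).trans ((add_le_add (add_le_add p1 p2) p3).trans ?_)
    unfold c1
    set u := Fintype.card D * (∑' k, (4 * q * 2 ^ q * (wt k ^ (q + 1) * G.ψ k)))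
    set v := Fintype.card D * (∑' k, (2 * 2 ^ q * (wt k ^ q * G.ψ k)))
    have : 0 ≤ ph t * ((u + v) * K) := by positivity
    have e9 : (u + v + 1) * ph t * (y t + K) = ph t * (u * y t) + ph t * (v * y t) + ph t * (y t + K) + ph t * ((u + v) * K) := by ring
    rw [e9]
    linarith
  have hg := gron (Φ := Real.arctan) (φ := ph) hder (fun t => Real.hasDerivAt_arctan t) Real.arctan_strictMono.monotone hbd
    (ts := ts) (by simp only [hy]; exact Finset.sum_eq_zero fun i hi => by simp [h0 i hi]) t
  rw [ye]
  have ha : |Real.arctan t - Real.arctan ts| ≤ Real.pi := by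
    have a1 := Real.arctan_lt_pi_div_two t
    have a2 := Real.arctan_lt_pi_div_two ts
    have a3 := Real.neg_pi_div_two_lt_arctan t
    have a4 := Real.neg_pi_div_two_lt_arctan ts
    rw [abs_le]; constructor <;> linarith
  have : Real.exp (G.c1 q * |Real.arctan t - Real.arctan ts|) ≤ Real.exp (G.c1 q * Real.pi) := by
    refine Real.exp_le_exp.2 (mul_le_mul_of_nonneg_left ha ?_)
    unfold c1; linarith
  have := mul_le_mul_of_nonneg_left this hK
  linarith

end Gal
end
end TE

namespace TE
open scoped ComplexConjugate Topology
open Filter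

section
variable {D : Type*} [Fintype D]

lemma rowsum {Ψ : Lat → ℝ} (h0 : ∀ k, 0 ≤ Ψ k) (hs : Summable Ψ) (F : Finset (Lat × D)) (i : Lat × D) :
    ∑ j ∈ F, Ψ (i.1 - j.1) ≤ Fintype.card D * ∑' k, Ψ k := by
  have := sum_prod_le (Ψ := fun m => Ψ (i.1 - m)) (fun k => h0 _) ((Equiv.subLeft i.1).summable_iff.2 hs) F
  have e : ∑' k, Ψ (i.1 - k) = ∑' k, Ψ k := (Equiv.subLeft i.1).tsum_eq Ψ
  rwa [e] at this

lemma summable_wtD : Summable fun i : Lat × D => ((wt i.1)⁻¹) ^ 3 := by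
  refine summable_of_sum_le (fun i => by have := wt_pos i.1; positivity) (c := Fintype.card D * ∑' k, ((wt k)⁻¹) ^ 3) fun F => ?_
  exact sum_prod_le (Ψ := fun k => ((wt k)⁻¹) ^ 3) (fun k => by have := wt_pos k; positivity) summable_wt F

lemma sq_le_wt {q : ℕ} {i : Lat} {C p x : ℝ} (hx : 0 ≤ x) (h : x * wt i ^ (q + 2) ≤ C * p) :
    (wt i ^ q * x) ^ 2 ≤ p ^ 2 * (C ^ 2 * ((wt i)⁻¹) ^ 3) := by
  have w := one_le_wt i
  have w0 := wt_pos i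
  have h1 : (x * wt i ^ (q + 2)) ^ 2 ≤ (C * p) ^ 2 := pow_le_pow_left₀ (by positivity) h 2
  have h2 : (wt i ^ q * x) ^ 2 = (x * wt i ^ (q + 2)) ^ 2 * ((wt i)⁻¹ ^ 4) := by
    rw [pow_add]; field_simp
  have h3 : ((wt i)⁻¹) ^ 4 ≤ ((wt i)⁻¹) ^ 3 := pow_le_pow_of_le_one (by positivity) (inv_le_one_of_one_le₀ w) (by norm_num)
  rw [h2]
  calc _ ≤ (C * p) ^ 2 * ((wt i)⁻¹) ^ 3 := mul_le_mul h1 h3 (by positivity) (by positivity)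
    _ = _ := by ring

set_option linter.unusedSectionVars false
namespace Gal
variable (G : Gal D)

lemma hb (i j : Lat × D) (t : ℝ) : ‖G.b i j t‖ ≤ ph t * (G.ψ (i.1 - j.1) * (2 * wt j.1)) := by
  have w := one_le_wt j.1
  have h3 : √(wt j.1) ≤ wt j.1 := by
    rw [Real.sqrt_le_left (wt_pos _).le]; nlinarith
  have p0 := ph_pos t
  have p1 := G.ψ0 (i.1 - j.1)
  have h1 := G.hσ i j t
  have h2 := G.hβ i j t
  calc ‖G.b i j t‖ ≤ ph t * (G.ψ (i.1 - j.1) * √(wt j.1)) + ph t * G.ψ (i.1 - j.1) := (norm_add_le _ _).trans (add_le_add h1 h2)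
    _ = ph t * (G.ψ (i.1 - j.1) * (√(wt j.1) + 1)) := by ring
    _ ≤ _ := by gcongr; linarith

def N (p : ℕ) : ℝ := Fintype.card D * ∑' k, wt k ^ p * G.ψ k

lemma N0 (p : ℕ) : 0 ≤ G.N p :=
  mul_nonneg (by positivity) (tsum_nonneg fun k => by have := G.ψ0 k; have := wt_pos k; positivity)

lemma hN (p : ℕ) (F : Finset (Lat × D)) (i : Lat × D) : ∑ j ∈ F, wt (i.1 - j.1) ^ p * G.ψ (i.1 - j.1) ≤ G.N p :=
  rowsum (Ψ := fun k => wt k ^ p * G.ψ k) (fun k => by have := G.ψ0 k; have := wt_pos k; positivity) (G.hψ p) F i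

lemma app (p : ℕ) (F : Finset (Lat × D)) (x : Lat × D → ℂ) {K : ℝ} (K0 : 0 ≤ K) (hK : ∀ j ∈ F, wt j.1 ^ (p + 1) * ‖x j‖ ≤ K)
    (i : Lat × D) (t : ℝ) : (∑ j ∈ F, ‖G.b i j t * x j‖) * wt i.1 ^ p ≤ ph t * (2 ^ (p + 1) * G.N p * K) := by
  have p0 := ph_pos t
  calc _ = ∑ j ∈ F, ‖G.b i j t * x j‖ * wt i.1 ^ p := by rw [Finset.sum_mul]
    _ ≤ ∑ j ∈ F, ph t * (2 ^ (p + 1) * K) * (wt (i.1 - j.1) ^ p * G.ψ (i.1 - j.1)) := by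
        refine Finset.sum_le_sum fun j hj => ?_
        have p1 := G.ψ0 (i.1 - j.1)
        have w1 := wt_pos i.1
        have w2 := wt_pos j.1
        have w3 := wt_pos (i.1 - j.1)
        have h2 : wt i.1 ^ p ≤ (2 * wt (i.1 - j.1) * wt j.1) ^ p := pow_le_pow_left₀ w1.le (wt_le_sub _ _) p
        rw [norm_mul]
        calc _ ≤ (ph t * (G.ψ (i.1 - j.1) * (2 * wt j.1)) * ‖x j‖) * (2 * wt (i.1 - j.1) * wt j.1) ^ p := 
              mul_le_mul (mul_le_mul_of_nonneg_right (G.hb i j t) (norm_nonneg _)) h2 (by positivity) (by positivity)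
          _ = ph t * 2 ^ (p + 1) * (wt (i.1 - j.1) ^ p * G.ψ (i.1 - j.1)) * (wt j.1 ^ (p + 1) * ‖x j‖) := by
              rw [mul_pow, mul_pow]; ring
          _ ≤ ph t * 2 ^ (p + 1) * (wt (i.1 - j.1) ^ p * G.ψ (i.1 - j.1)) * K :=
              mul_le_mul_of_nonneg_left (hK j hj) (by positivity)
          _ = _ := by ring
    _ = ph t * (2 ^ (p + 1) * K) * ∑ j ∈ F, (wt (i.1 - j.1) ^ p * G.ψ (i.1 - j.1)) := by rw [Finset.mul_sum]
    _ ≤ ph t * (2 ^ (p + 1) * K) * G.N p := mul_le_mul_of_nonneg_left (G.hN p F i) (by positivity)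
    _ = _ := by ring

lemma app0 (F : Finset (Lat × D)) (i : Lat × D) (t : ℝ) : ∑ j ∈ F, ‖G.b i j t‖ ≤ 4 * wt i.1 * G.N 1 := by
  rw [← mul_comm (G.N 1), ]
  calc _ ≤ ∑ j ∈ F, 4 * wt i.1 * (wt (i.1 - j.1) ^ 1 * G.ψ (i.1 - j.1)) := by
        refine Finset.sum_le_sum fun j hj => ?_
        have p1 := G.ψ0 (i.1 - j.1)
        have w1 := wt_pos i.1
        have w2 := wt_pos j.1
        have h2 : wt j.1 ≤ (2 * wt (i.1 - j.1) * wt i.1) := by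
          have := wt_le_sub j.1 i.1
          rwa [wt_sub_comm] at this
        calc _ ≤ ph t * (G.ψ (i.1 - j.1) * (2 * wt j.1)) := G.hb i j t
          _ ≤ 1 * (G.ψ (i.1 - j.1) * (2 * wt j.1)) := mul_le_mul_of_nonneg_right (ph_le t) (by positivity)
          _ ≤ 1 * (G.ψ (i.1 - j.1) * (2 * (2 * wt (i.1 - j.1) * wt i.1))) := by gcongr
          _ = _ := by ring
    _ = 4 * wt i.1 * ∑ j ∈ F, (wt (i.1 - j.1) ^ 1 * G.ψ (i.1 - j.1)) := by rw [Finset.mul_sum]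
    _ ≤ 4 * wt i.1 * G.N 1 := mul_le_mul_of_nonneg_left (G.hN 1 F i) (by have := wt_pos i.1; positivity)
    _ = _ := by ring

def Bl (F : Finset (Lat × D)) (t : ℝ) : (F → ℂ) →L[ℝ] (F → ℂ) :=
  ContinuousLinearMap.pi fun i => ∑ j : F, (G.b i j t) • (ContinuousLinearMap.proj (R := ℝ) (φ := fun _ : F => ℂ) j)

lemma Bl_apply (F : Finset (Lat × D)) (t : ℝ) (x : F → ℂ) (i : F) : G.Bl F t x i = ∑ j : F, G.b i j t * x j := by
  simp [Bl]

lemma cb (i j) : Continuous (G.b i j) := (G.cσ i j).add (G.cβ i j)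

lemma fin_ex (ts : ℝ) (F : Finset (Lat × D)) : ∃ a : Lat × D → ℝ → ℂ, (∀ i, i ∉ F → ∀ t, a i t = 0) ∧ (∀ i, a i ts = 0) ∧
    ∀ i ∈ F, ∀ t, HasDerivAt (a i) (∑ j ∈ F, G.b i j t * a j t + G.f i t) t := by
  classical
  have hB : Continuous fun p : ℝ × (F → ℂ) => G.Bl F p.1 p.2 := by
    refine continuous_pi fun i => ?_
    simp only [Bl_apply]
    refine continuous_finsetSum _ fun j _ => ?_
    exact ((G.cb _ _).comp continuous_fst).mul ((continuous_apply j).comp continuous_snd)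
  set M : ℝ := ∑ i ∈ F, 4 * wt i.1 * G.N 1
  have hM0 : ∀ i ∈ F, 0 ≤ 4 * wt i.1 * G.N 1 := fun i _ => by
    have := wt_pos i.1; have := G.N0 1; positivity
  have hM : ∀ t, ‖G.Bl F t‖ ≤ M := by
    intro t
    refine ContinuousLinearMap.opNorm_le_bound _ (Finset.sum_nonneg hM0) fun x => ?_
    rw [pi_norm_le_iff_of_nonneg (mul_nonneg (Finset.sum_nonneg hM0) (norm_nonneg _))]
    intro i
    rw [Bl_apply]
    calc _ ≤ ∑ j : F, ‖G.b i j t‖ * ‖x‖ := (norm_sum_le _ _).trans (Finset.sum_le_sum fun j _ => by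
            rw [norm_mul]; exact mul_le_mul_of_nonneg_left (norm_le_pi_norm x j) (norm_nonneg _))
      _ = (∑ j ∈ F, ‖G.b i j t‖) * ‖x‖ := by
            rw [← Finset.sum_mul, Finset.sum_coe_sort F (fun j => ‖G.b i j t‖)]
      _ ≤ (4 * wt i.1.1 * G.N 1) * ‖x‖ := mul_le_mul_of_nonneg_right (G.app0 F i t) (norm_nonneg _)
      _ ≤ M * ‖x‖ := mul_le_mul_of_nonneg_right (Finset.single_le_sum (f := fun i : Lat × D => 4 * wt i.1 * G.N 1) hM0 i.2) (norm_nonneg _)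
  obtain ⟨C, hC⟩ := G.hf 0
  obtain ⟨α, h0, hα⟩ := lin_ode (X := F → ℂ) (B := G.Bl F) (f := fun t i => G.f i t) hB hM
    (continuous_pi fun i => G.cf i) (K := |C|) (fun t => by
      rw [pi_norm_le_iff_of_nonneg (abs_nonneg _)]
      intro i
      have := hC i t
      simp only [pow_zero, mul_one] at this
      have h1 : C * ph t ≤ |C| * ph t := mul_le_mul_of_nonneg_right (le_abs_self C) (ph_pos t).le
      exact (this.trans h1).trans (mul_le_of_le_one_right (abs_nonneg C) (ph_le t))) ts
  refine ⟨fun i t => if h : i ∈ F then α t ⟨i, h⟩ else 0, fun i hi t => by simp [hi], fun i => ?_, fun i hi t => ?_⟩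
  · by_cases h : i ∈ F <;> simp [h, h0]
  · have h := (hasDerivAt_pi.1 (hα t)) ⟨i, hi⟩
    simp only [Pi.add_apply, Bl_apply] at h
    simp only [hi, dite_true]
    refine h.congr_deriv ?_
    congr 1
    rw [← Finset.sum_coe_sort F]
    refine Finset.sum_congr rfl fun j _ => ?_
    simp


lemma sum_sq (q : ℕ) (F : Finset (Lat × D)) {e : Lat × D → ℂ} {C p S : ℝ} (hS : ∑ i ∈ F, ((wt i.1)⁻¹) ^ 3 ≤ S)
    (h : ∀ i ∈ F, ‖e i‖ * wt i.1 ^ (q + 2) ≤ C * p) :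
    ∑ i ∈ F, (wt i.1 ^ q * ‖e i‖) ^ 2 ≤ p ^ 2 * (C ^ 2 * S) := by
  calc _ ≤ ∑ i ∈ F, p ^ 2 * (C ^ 2 * ((wt i.1)⁻¹) ^ 3) := Finset.sum_le_sum fun i hi => sq_le_wt (norm_nonneg _) (h i hi)
    _ = p ^ 2 * (C ^ 2 * ∑ i ∈ F, ((wt i.1)⁻¹) ^ 3) := by rw [Finset.mul_sum, Finset.mul_sum]
    _ ≤ _ := by gcongr

def sol (ts : ℝ) (F : Finset (Lat × D)) : Lat × D → ℝ → ℂ := Classical.choose (G.fin_ex ts F)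
lemma sol_out (ts : ℝ) (F : Finset (Lat × D)) {i} (h : i ∉ F) (t) : G.sol ts F i t = 0 :=
  (Classical.choose_spec (G.fin_ex ts F)).1 i h t
lemma sol_ts (ts : ℝ) (F : Finset (Lat × D)) (i) : G.sol ts F i ts = 0 :=
  (Classical.choose_spec (G.fin_ex ts F)).2.1 i
lemma sol_d (ts : ℝ) (F : Finset (Lat × D)) {i} (h : i ∈ F) (t) :
    HasDerivAt (G.sol ts F i) (∑ j ∈ F, G.b i j t * G.sol ts F j t + G.f i t) t :=
  (Classical.choose_spec (G.fin_ex ts F)).2.2 i h t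

lemma sol_bd (ts : ℝ) (q : ℕ) : ∃ K : ℝ, 0 ≤ K ∧ ∀ F i t, wt i.1 ^ q * ‖G.sol ts F i t‖ ≤ K := by
  obtain ⟨C, hC⟩ := G.hf (q + 2)
  set S := ∑' i : Lat × D, ((wt i.1)⁻¹) ^ 3 with hS
  have S0 : 0 ≤ S := tsum_nonneg fun i => by have := wt_pos i.1; positivity
  refine ⟨√(C ^ 2 * S * Real.exp (G.c1 q * Real.pi)), Real.sqrt_nonneg _, fun F i t => ?_⟩
  by_cases hi : i ∈ F
  swap
  · rw [G.sol_out ts F hi]; simp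
  apply Real.le_sqrt_of_sq_le
  have := G.energy q (F := F) (a := G.sol ts F) (e := G.f) (ts := ts) (K := C ^ 2 * S) (by positivity)
    (fun i hi t => G.sol_d ts F hi t) (fun i _ => G.sol_ts ts F i)
    (fun t => sum_sq q F ((summable_wtD (D := D)).sum_le_tsum F fun i _ => by have := wt_pos i.1; positivity) fun i _ => hC i t) t
  exact (Finset.single_le_sum (f := fun i : Lat × D => (wt i.1 ^ q * ‖G.sol ts F i t‖) ^ 2) (fun i _ => sq_nonneg _) hi).trans this

lemma sol_cauchy (ts : ℝ) {ε : ℝ} (hε : 0 < ε) : ∃ F₀, ∀ F, F₀ ⊆ F → ∀ i t, ‖G.sol ts F i t - G.sol ts F₀ i t‖ ≤ ε := by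
  classical
  obtain ⟨K, K0, hK⟩ := G.sol_bd ts 3
  obtain ⟨C, hC⟩ := G.hf 2
  set C' := 2 ^ 3 * G.N 2 * K + C
  set E := Real.exp (G.c1 0 * Real.pi)
  have E0 : 0 < E := Real.exp_pos _
  set δ := ε ^ 2 / ((C' ^ 2 + 1) * E)
  have δ0 : 0 < δ := by positivity
  obtain ⟨F₀, hF₀⟩ := summable_iff_vanishing_norm.1 (summable_wtD (D := D)) δ δ0
  refine ⟨F₀, fun F hF i t => ?_⟩
  by_cases hi : i ∈ F
  swap
  · rw [G.sol_out ts F hi, G.sol_out ts F₀ fun h => hi (hF h)]; simpa using hε.le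
  set e : Lat × D → ℝ → ℂ := fun i t => if i ∈ F₀ then 0 else ∑ j ∈ F₀, G.b i j t * G.sol ts F₀ j t + G.f i t with he
  have hd : ∀ i ∈ F, ∀ t, HasDerivAt (fun t => G.sol ts F i t - G.sol ts F₀ i t)
      (∑ j ∈ F, G.b i j t * (G.sol ts F j t - G.sol ts F₀ j t) + e i t) t := by
    intro i hi t
    have hsum : ∑ j ∈ F, G.b i j t * (G.sol ts F j t - G.sol ts F₀ j t) =
        ∑ j ∈ F, G.b i j t * G.sol ts F j t - ∑ j ∈ F₀, G.b i j t * G.sol ts F₀ j t := by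
      simp only [mul_sub, Finset.sum_sub_distrib]
      congr 1
      exact (Finset.sum_subset hF fun j _ hj => by rw [G.sol_out ts F₀ hj, mul_zero]).symm
    rw [hsum]
    by_cases h0 : i ∈ F₀
    · refine ((G.sol_d ts F hi t).sub (G.sol_d ts F₀ h0 t)).congr_deriv ?_
      simp only [he, h0, if_true]; ring
    · have h1 := (G.sol_d ts F hi t)
      have h2 : (fun t => G.sol ts F i t - G.sol ts F₀ i t) = G.sol ts F i := by
        funext t; rw [G.sol_out ts F₀ h0, sub_zero]
      rw [h2]
      refine h1.congr_deriv ?_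
      simp only [he, h0, if_false]; ring
  have hbd : ∀ i t, i ∉ F₀ → ‖e i t‖ * wt i.1 ^ (0 + 2) ≤ C' * ph t := by
    intro i t h
    have w := wt_pos i.1
    simp only [he, h, if_false]
    have h1 := G.app 2 F₀ (fun j => G.sol ts F₀ j t) K0 (fun j _ => hK F₀ j t) i t
    have h2 := hC i t
    calc _ ≤ ((∑ j ∈ F₀, ‖G.b i j t * G.sol ts F₀ j t‖) + ‖G.f i t‖) * wt i.1 ^ 2 := by
          rw [zero_add]
          exact mul_le_mul_of_nonneg_right ((norm_add_le _ _).trans (by gcongr; exact norm_sum_le _ _)) (by positivity)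
      _ ≤ _ := by rw [add_mul]; simp only [C']; norm_num at h1 ⊢; linarith
  have hs : ∀ t, ∑ i ∈ F, (wt i.1 ^ 0 * ‖e i t‖) ^ 2 ≤ ph t ^ 2 * (C' ^ 2 * δ) := by
    intro t
    have h1 : ∑ i ∈ F, (wt i.1 ^ 0 * ‖e i t‖) ^ 2 = ∑ i ∈ F \ F₀, (wt i.1 ^ 0 * ‖e i t‖) ^ 2 := by
      refine (Finset.sum_subset Finset.sdiff_subset fun j hj hj' => ?_).symm
      have : j ∈ F₀ := by
        by_contra h; exact hj' (Finset.mem_sdiff.2 ⟨hj, h⟩)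
      simp [he, this]
    rw [h1]
    refine sum_sq 0 _ ?_ fun i hi => hbd i t (Finset.mem_sdiff.1 hi).2
    have := hF₀ (F \ F₀) Finset.sdiff_disjoint
    exact (le_abs_self _).trans this.le
  have := G.energy 0 (F := F) (ts := ts) (K := C' ^ 2 * δ) (by positivity) hd
    (fun i _ => by simp only [G.sol_ts, sub_zero]) hs t
  have h3 := (Finset.single_le_sum (f := fun i : Lat × D => (wt i.1 ^ 0 * ‖G.sol ts F i t - G.sol ts F₀ i t‖) ^ 2) (fun i _ => sq_nonneg _) hi).trans this
  simp only [pow_zero, one_mul] at h3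
  have h4 : C' ^ 2 * δ * E ≤ ε ^ 2 := by
    have : C' ^ 2 * δ * E = (C' ^ 2 / (C' ^ 2 + 1)) * ε ^ 2 := by simp only [δ]; field_simp
    rw [this]
    have h5 : C' ^ 2 / (C' ^ 2 + 1) ≤ 1 := by rw [div_le_one (by positivity)]; linarith
    nlinarith [sq_nonneg ε]
  exact (pow_le_pow_iff_left₀ (norm_nonneg _) hε.le two_ne_zero).1 (h3.trans h4)

theorem main (ts : ℝ) : ∃ a : Lat × D → ℝ → ℂ, (∀ p : ℕ, ∃ C : ℝ, ∀ i t, ‖a i t‖ * wt i.1 ^ p ≤ C) ∧ (∀ i, a i ts = 0) ∧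
    ∀ i t, (Summable fun j => G.b i j t * a j t) ∧ HasDerivAt (a i) ((∑' j, G.b i j t * a j t) + G.f i t) t := by
  classical
  have hcs : ∀ i t, CauchySeq fun F => G.sol ts F i t := by
    intro i t
    refine Metric.cauchySeq_iff'.2 fun ε hε => ?_
    obtain ⟨F₀, h⟩ := G.sol_cauchy ts (half_pos hε)
    exact ⟨F₀, fun F hF => by rw [dist_eq_norm]; exact (h F hF i t).trans_lt (half_lt_self hε)⟩
  choose a ha using fun i t => cauchySeq_tendsto_of_complete (hcs i t)
  have hbd : ∀ p : ℕ, ∃ C : ℝ, 0 ≤ C ∧ ∀ i t, wt i.1 ^ p * ‖a i t‖ ≤ C := by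
    intro p
    obtain ⟨K, K0, hK⟩ := G.sol_bd ts p
    exact ⟨K, K0, fun i t => le_of_tendsto ((ha i t).norm.const_mul _) (Eventually.of_forall fun F => hK F i t)⟩
  have hunif : ∀ ε > 0, ∀ᶠ F in atTop, ∀ i t, ‖a i t - G.sol ts F i t‖ ≤ ε := by
    intro ε hε
    obtain ⟨F₀, h⟩ := G.sol_cauchy ts (half_pos hε)
    have h0 : ∀ i t, ‖a i t - G.sol ts F₀ i t‖ ≤ ε / 2 := fun i t =>
      le_of_tendsto ((ha i t).sub_const _).norm (eventually_atTop.2 ⟨F₀, fun F hF => h F hF i t⟩)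
    refine eventually_atTop.2 ⟨F₀, fun F hF i t => ?_⟩
    have e : a i t - G.sol ts F i t = (a i t - G.sol ts F₀ i t) - (G.sol ts F i t - G.sol ts F₀ i t) := by ring
    rw [e]
    refine (norm_sub_le _ _).trans ?_
    linarith [h0 i t, h F hF i t]
  have hsn : ∀ i t, Summable fun j => ‖G.b i j t * a j t‖ := by
    intro i t
    obtain ⟨C, C0, hC⟩ := hbd 1
    refine summable_of_sum_le (fun _ => norm_nonneg _) (c := ph t * (2 ^ (0 + 1) * G.N 0 * C)) fun F => ?_
    have := G.app 0 F (fun j => a j t) C0 (fun j _ => by simpa using hC j t) i t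
    simpa using this
  refine ⟨a, fun p => ?_, fun i => ?_, fun i t => ⟨(hsn i t).of_norm, ?_⟩⟩
  · obtain ⟨C, _, hC⟩ := hbd p
    exact ⟨C, fun i t => by rw [mul_comm]; exact hC i t⟩
  · have := ha i ts
    simp only [G.sol_ts] at this
    exact tendsto_nhds_unique this tendsto_const_nhds
  · refine hasDerivAt_of_tendstoUniformly (l := atTop) (f := fun F t => G.sol ts F i t)
      (f' := fun F t => ∑ j ∈ F, G.b i j t * G.sol ts F j t + G.f i t)
      (g' := fun t => (∑' j, G.b i j t * a j t) + G.f i t) ?_ ?_ (ha i) t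
    · rw [Metric.tendstoUniformly_iff]
      intro ε hε
      set M := 4 * wt i.1 * G.N 1
      have M0 : 0 ≤ M := by have := wt_pos i.1; have := G.N0 1; positivity
      filter_upwards [hunif (ε / (2 * (M + 1))) (by positivity)] with F hF t
      rw [dist_eq_norm]
      have e0 : ∑ j ∈ F, G.b i j t * G.sol ts F j t = ∑' j, G.b i j t * G.sol ts F j t :=
        (tsum_eq_sum fun j hj => by rw [G.sol_out ts F hj, mul_zero]).symm
      have e1 : Summable fun j => G.b i j t * G.sol ts F j t :=
        summable_of_ne_finset_zero (s := F) fun j hj => by rw [G.sol_out ts F hj, mul_zero]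
      have e2 : (∑' j, G.b i j t * a j t) + G.f i t - (∑ j ∈ F, G.b i j t * G.sol ts F j t + G.f i t) =
          ∑' j, G.b i j t * (a j t - G.sol ts F j t) := by
        rw [e0, add_sub_add_right_eq_sub, ← (hsn i t).of_norm.tsum_sub e1]
        simp only [mul_sub]
      rw [e2]
      have hle : ∀ F' : Finset (Lat × D), ∑ j ∈ F', ‖G.b i j t * (a j t - G.sol ts F j t)‖ ≤ M * (ε / (2 * (M + 1))) := by
        intro F'
        calc _ ≤ ∑ j ∈ F', ‖G.b i j t‖ * (ε / (2 * (M + 1))) := Finset.sum_le_sum fun j _ => by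
              rw [norm_mul]; exact mul_le_mul_of_nonneg_left (hF j t) (norm_nonneg _)
          _ = (∑ j ∈ F', ‖G.b i j t‖) * (ε / (2 * (M + 1))) := by rw [Finset.sum_mul]
          _ ≤ _ := mul_le_mul_of_nonneg_right (G.app0 F' i t) (by positivity)
      have hsum := summable_of_sum_le (fun _ => norm_nonneg _) hle
      calc _ ≤ ∑' j, ‖G.b i j t * (a j t - G.sol ts F j t)‖ := norm_tsum_le_tsum_norm hsum
        _ ≤ M * (ε / (2 * (M + 1))) := hsum.tsum_le_of_sum_le hle
        _ < ε := by
          have : M * (ε / (2 * (M + 1))) = (M / (M + 1)) * (ε / 2) := by field_simp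
          rw [this]
          have h5 : M / (M + 1) ≤ 1 := by rw [div_le_one (by positivity)]; linarith
          nlinarith
    · refine eventually_atTop.2 ⟨{i}, fun F hF t => G.sol_d ts F (hF (Finset.mem_singleton_self i)) t⟩

end Gal
end
end TE

namespace TE
open scoped ComplexConjugate Topology
open Filter

section
set_option linter.unusedSectionVars false
variable {D : Type*} [Fintype D]

def ng (i : Lat × D) : Lat × D := (-i.1, i.2)
lemma ng_ng (i : Lat × D) : ng (ng i) = i := by simp [ng]
def ngE : (Lat × D) ≃ (Lat × D) := ⟨ng, ng, ng_ng, ng_ng⟩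

theorem Gal.main' (G : Gal D) (hb : ∀ i j t, G.b (ng i) (ng j) t = conj (G.b i j t)) (hf : ∀ i t, G.f (ng i) t = conj (G.f i t))
    (ts : ℝ) : ∃ a : Lat × D → ℝ → ℂ, (∀ p : ℕ, ∃ C : ℝ, ∀ i t, ‖a i t‖ * wt i.1 ^ p ≤ C) ∧ (∀ i, a i ts = 0) ∧
    (∀ i t, a (ng i) t = conj (a i t)) ∧
    ∀ i t, (Summable fun j => G.b i j t * a j t) ∧ HasDerivAt (a i) ((∑' j, G.b i j t * a j t) + G.f i t) t := by
  obtain ⟨a, h1, h2, h3⟩ := G.main ts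
  have hs : ∀ i t, HasSum (fun j => G.b i j t * conj (a (ng j) t)) (conj (∑' j, G.b (ng i) j t * a j t)) := by
    intro i t
    have h := ((h3 (ng i) t).1.hasSum).map Complex.conjAe.toAddEquiv.toAddMonoidHom Complex.continuous_conj
    have h0 : HasSum (fun j => conj (G.b (ng i) j t * a j t)) (conj (∑' j, G.b (ng i) j t * a j t)) := h
    have h' := (ngE (D := D)).hasSum_iff.2 h0
    have e : (fun j => G.b i j t * conj (a (ng j) t)) = (fun j => conj (G.b (ng i) j t * a j t)) ∘ (ngE (D := D)) := by
      funext j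
      change _ = conj (G.b (ng i) (ng j) t * a (ng j) t)
      rw [hb, map_mul, Complex.conj_conj]
    rw [e]; exact h'
  refine ⟨fun i t => (1 / 2) * (a i t + conj (a (ng i) t)), fun p => ?_, fun i => by simp [h2], fun i t => ?_, fun i t => ?_⟩
  · obtain ⟨C, hC⟩ := h1 p
    refine ⟨C, fun i t => ?_⟩
    have e1 := hC i t
    have e2 := hC (ng i) t
    have e3 : wt (ng i).1 = wt i.1 := by simp [ng, wt_neg]
    rw [e3] at e2
    have w := wt_pos i.1
    have : ‖(1 / 2 : ℂ) * (a i t + conj (a (ng i) t))‖ ≤ (1 / 2) * (‖a i t‖ + ‖a (ng i) t‖) := by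
      rw [norm_mul]
      have := norm_add_le (a i t) (conj (a (ng i) t))
      rw [RCLike.norm_conj] at this
      norm_num; linarith
    have := mul_le_mul_of_nonneg_right this (by positivity : 0 ≤ wt i.1 ^ p)
    linarith
  · simp only [ng_ng, map_mul, map_add, Complex.conj_conj]
    rw [add_comm]; congr 1; simp; exact (map_ofNat _ 2).symm
  · have k1 := (((h3 i t).1.hasSum).add (hs i t)).mul_left (1 / 2 : ℂ)
    have k2 : (fun j => G.b i j t * ((1 / 2) * (a j t + conj (a (ng j) t)))) = fun j => (1 / 2) * (G.b i j t * a j t + G.b i j t * conj (a (ng j) t)) := by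
      funext j; ring
    rw [k2]
    refine ⟨k1.summable, ?_⟩
    rw [k1.tsum_eq]
    have d1 := (h3 i t).2
    have d2 : HasDerivAt (fun t => conj (a (ng i) t)) (conj ((∑' j, G.b (ng i) j t * a j t) + G.f (ng i) t)) t :=
      Complex.conjCLE.toContinuousLinearMap.hasFDerivAt.comp_hasDerivAt t (h3 (ng i) t).2
    refine ((d1.add d2).const_mul (1 / 2 : ℂ)).congr_deriv ?_
    rw [map_add, hf, Complex.conj_conj]
    ring

lemma tsumD {f : Lat × D → ℂ} (hf : Summable f) : ∑' j, f j = ∑ d, ∑' m, f (m, d) := by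
  have h1 : Summable (f ∘ (Equiv.prodComm D Lat)) := (Equiv.prodComm D Lat).summable_iff.2 hf
  rw [← (Equiv.prodComm D Lat).tsum_eq f, ← tsum_fintype (L := SummationFilter.unconditional _)]
  exact h1.tsum_prod

lemma norm_dsym' (i : Fin 3) (m : Lat) : ‖dsym i m‖ ≤ 7 * √(wt m) := by
  have h : ‖dsym i m‖ = 2 * Real.pi * |(m i : ℝ)| := by
    simp [dsym, abs_of_pos Real.pi_pos]
  rw [h]
  have h1 : |(m i : ℝ)| ≤ √(wt m) := by
    apply Real.le_sqrt_of_sq_le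
    rw [sq_abs]
    have h : (m i : ℝ)^2 ≤ ∑ i, (m i : ℝ) ^ 2 :=
      Finset.single_le_sum (f := fun i => (m i : ℝ)^2) (fun i _ => sq_nonneg _) (Finset.mem_univ i)
    unfold wt; linarith
  have := Real.pi_lt_d2
  refine mul_le_mul (by linarith) h1 (abs_nonneg _) (by norm_num)

lemma co_supp {g : Fn} {t : ℝ} (h : ∀ x, g t x = 0) (k : Lat) : co g k t = 0 := by
  simp [co, hat, toC, h]

lemma dec {g : Fn} (hg : IsS g) {R : ℝ} (hR : ∀ t, R ≤ |t| → ∀ x, g t x = 0) : ∃ ψ : Lat → ℝ, (∀ k, 0 ≤ ψ k) ∧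
    (∀ p : ℕ, Summable fun k => wt k ^ p * ψ k) ∧ ∀ k t, ‖co g k t‖ ≤ ph t * ψ k := by
  have hrd := hg.ss.rd
  have bdd : ∀ k, BddAbove (Set.range fun t => ‖co g k t‖) := by
    intro k
    obtain ⟨C, hC⟩ := hrd 0
    exact ⟨C, by rintro _ ⟨t, rfl⟩; simpa using hC k t⟩
  have s0 : ∀ k, 0 ≤ ⨆ t, ‖co g k t‖ := fun k => Real.iSup_nonneg fun t => norm_nonneg _
  refine ⟨fun k => (1 + R ^ 2) * ⨆ t, ‖co g k t‖, fun k => mul_nonneg (by positivity) (s0 k), fun p => ?_, fun k t => ?_⟩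
  · obtain ⟨C, C0, hC⟩ := hrd.bound p
    refine Summable.of_nonneg_of_le (fun k => by have := wt_pos k; have := s0 k; positivity) (fun k => ?_) (summable_wt.mul_left ((1 + R ^ 2) * C))
    have w := wt_pos k
    have : ⨆ t, ‖co g k t‖ ≤ C * ((wt k)⁻¹) ^ 3 / wt k ^ p := ciSup_le fun t => by
      rw [le_div_iff₀ (by positivity)]; exact hC k t
    rw [le_div_iff₀ (by positivity)] at this
    calc _ = (1 + R ^ 2) * ((⨆ t, ‖co g k t‖) * wt k ^ p) := by ring
      _ ≤ (1 + R ^ 2) * (C * ((wt k)⁻¹) ^ 3) := by gcongr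
      _ = _ := by ring
  · by_cases h : R ≤ |t|
    · rw [co_supp (hR t h)]
      simpa using mul_nonneg (ph_pos t).le (mul_nonneg (by positivity) (s0 k))
    · push Not at h
      have h1 : t ^ 2 ≤ R ^ 2 := by
        rw [← sq_abs t]; exact pow_le_pow_left₀ (abs_nonneg _) h.le 2
      calc ‖co g k t‖ ≤ 1 * ⨆ t, ‖co g k t‖ := by rw [one_mul]; exact le_ciSup (bdd k) t
        _ ≤ (ph t * (1 + R ^ 2)) * ⨆ t, ‖co g k t‖ := by
          refine mul_le_mul_of_nonneg_right ?_ (s0 k)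
          unfold ph
          rw [div_mul_eq_mul_div, le_div_iff₀ (by positivity)]; linarith
        _ = _ := by ring


lemma dsym_cj (i : Fin 3) (k : Lat) : dsym i (-k) = conj (dsym i k) := (Sym.dsym i).herm k

lemma SSn.zero (n : ℕ) : SSn n (fun _ _ => 0) := ss_zero n

lemma SSn.sum {n : ℕ} {ι : Type*} (s : Finset ι) {a : ι → Sq} (h : ∀ i ∈ s, SSn n (a i)) : SSn n (fun k t => ∑ i ∈ s, a i k t) := by
  classical
  induction s using Finset.induction_on with
  | empty => simpa using SSn.zero n
  | insert i s hi ih =>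
    simp only [Finset.sum_insert hi]
    exact (h i (Finset.mem_insert_self _ _)).add (ih fun j hj => h j (Finset.mem_insert_of_mem hj))

section pde
variable {E : Type*} [Fintype E] [DecidableEq D] (v : Fin 3 → Fn) (g : E → D → Fin 3 → Fn) (r : D → E → Lat → ℂ) (f : D → Fn)

def sgm (i j : Lat × D) (t : ℝ) : ℂ := if i.2 = j.2 then -∑ p, dsym p j.1 * co (v p) (i.1 - j.1) t else 0
def bt (i j : Lat × D) (t : ℝ) : ℂ := ∑ e, r i.2 e i.1 * ∑ p, dsym p j.1 * co (g e j.2 p) (i.1 - j.1) t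

def PhiS (a : D → Sq) (d : D) : Sq := fun k t =>
  -(∑ p, cv (fun m t => dsym p m * a d m t) (co (v p)) k t) +
    (∑ e, r d e k * ∑ d', ∑ p, cv (fun m t => dsym p m * a d' m t) (co (g e d' p)) k t) + co (f d) k t

variable {v g r f}
lemma sum_PhiS (hv : ∀ i, IsS (v i)) (hg : ∀ e d i, IsS (g e d i)) {a : D → Sq} (ha : ∀ d, RD (a d)) (d : D) (k : Lat) (t : ℝ)
    (hs : Summable fun j : Lat × D => (sgm v (k, d) j t + bt g r (k, d) j t) * a j.2 j.1 t) :
    (∑' j : Lat × D, (sgm v (k, d) j t + bt g r (k, d) j t) * a j.2 j.1 t) + co (f d) k t = PhiS v g r f a d k t := by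
  rw [tsumD hs]
  have key : ∀ d', ∑' m, (sgm v (k, d) (m, d') t + bt g r (k, d) (m, d') t) * a d' m t =
      (if d = d' then -∑ p, cv (fun m t => dsym p m * a d' m t) (co (v p)) k t else 0) +
      ∑ e, r d e k * ∑ p, cv (fun m t => dsym p m * a d' m t) (co (g e d' p)) k t := by
    intro d'
    have h0 : ∀ (p : Fin 3) (w : Fn), IsS w → HasSum (fun m => (dsym p m * a d' m t) * co w (k - m) t) (cv (fun m t => dsym p m * a d' m t) (co w) k t) :=
      fun p w hw => (cv_summable ((ha d').mult (dsym_pg p)) hw.ss.rd k t).hasSum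
    have h1 : HasSum (fun m => sgm v (k, d) (m, d') t * a d' m t) (if d = d' then -∑ p, cv (fun m t => dsym p m * a d' m t) (co (v p)) k t else 0) := by
      by_cases h : d = d'
      · simp only [sgm, h, if_true]
        have := (hasSum_sum fun p (_ : p ∈ Finset.univ) => h0 p (v p) (hv p)).neg
        have e : (fun m => (-∑ p, dsym p m * co (v p) (k - m) t) * a d' m t) = fun m => -∑ p, (dsym p m * a d' m t) * co (v p) (k - m) t := by
          funext m
          rw [neg_mul, Finset.sum_mul]
          exact congrArg _ (Finset.sum_congr rfl fun p _ => by ring)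
        rw [e]; exact this
      · simp only [sgm, h, if_false, zero_mul]; exact hasSum_zero
    have h2 : HasSum (fun m => bt g r (k, d) (m, d') t * a d' m t) (∑ e, r d e k * ∑ p, cv (fun m t => dsym p m * a d' m t) (co (g e d' p)) k t) := by
      have := hasSum_sum fun e (_ : e ∈ Finset.univ) => (hasSum_sum fun p (_ : p ∈ Finset.univ) => h0 p (g e d' p) (hg e d' p)).mul_left (r d e k)
      have e : (fun m => bt g r (k, d) (m, d') t * a d' m t) = fun m => ∑ e, r d e k * ∑ p, (dsym p m * a d' m t) * co (g e d' p) (k - m) t := by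
        funext m
        simp only [bt, Finset.sum_mul, Finset.mul_sum]
        exact Finset.sum_congr rfl fun e _ => Finset.sum_congr rfl fun p _ => by ring
      rw [e]; exact this
    have := h1.add h2
    simp only [add_mul]
    exact this.tsum_eq
  simp only [key, Finset.sum_add_distrib]
  unfold PhiS
  congr 2
  · simp
  · rw [Finset.sum_comm]
    simp only [Finset.mul_sum]

lemma PhiS_ss (hv : ∀ i, IsS (v i)) (hg : ∀ e d i, IsS (g e d i)) (hr : ∀ d e, Sym (r d e)) (hf : ∀ d, IsS (f d)) {n : ℕ} {a : D → Sq} (ha : ∀ d, SSn n (a d)) (d : D) : SSn n (PhiS v g r f a d) := by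
  have h1 : ∀ (d' : D) (p : Fin 3) (w : Fn), IsS w → SSn n (cv (fun m t => dsym p m * a d' m t) (co w)) := fun d' p w hw =>
    ((ha d').mult (dsym_pg p)).cv (hw.ss n)
  refine SSn.add (SSn.add ?_ ?_) ((hf d).ss n)
  · have := (SSn.sum Finset.univ fun p _ => h1 d p (v p) (hv p)).mult (pg_const (-1))
    simpa using this
  · refine SSn.sum _ fun e _ => SSn.mult (hr d e).pg (SSn.sum _ fun d' _ => SSn.sum _ fun p _ => h1 d' p _ (hg e d' p))


lemma sgm_anti (hv : ∀ i, IsS (v i)) (hdiv : ∑ i, dx i (v i) = 0) (i j : Lat × D) (t : ℝ) :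
    sgm v j i t = - conj (sgm v i j t) := by
  unfold sgm
  by_cases h : i.2 = j.2
  swap
  · rw [if_neg h, if_neg (Ne.symm h)]; simp
  rw [if_pos h, if_pos h.symm]
  have hz : ∀ k, ∑ p, dsym p k * co (v p) k t = 0 := by
    intro k
    have := congrArg (fun w => co w k t) hdiv
    simp only [co_zero'] at this
    rw [co_sum _ fun p _ => (hv p).dx p] at this
    simpa only [co_dx (hv _)] using this
  have h1 := hz (j.1 - i.1)
  have h2 : ∀ p, conj (co (v p) (i.1 - j.1) t) = co (v p) (j.1 - i.1) t := fun p => by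
    rw [← co_cj, neg_sub]
  have h3 : ∀ p, dsym p (j.1 - i.1) = dsym p j.1 - dsym p i.1 := fun p => by
    simp [dsym]; ring
  simp only [h3, sub_mul, Finset.sum_sub_distrib] at h1
  simp only [map_neg, map_sum, map_mul, h2, ← dsym_cj]
  have h4 : ∀ p, dsym p (-j.1) = - dsym p j.1 := fun p => by simp [dsym]
  simp only [h4, neg_mul, Finset.sum_neg_distrib, neg_neg]
  have := sub_eq_zero.1 h1
  rw [this]

lemma ng_sym (hr : ∀ d e, Sym (r d e)) (i j : Lat × D) (t : ℝ) :
    sgm v (ng i) (ng j) t + bt g r (ng i) (ng j) t = conj (sgm v i j t + bt g r i j t) := by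
  have e : ∀ w : Fn, co w (-i.1 - -j.1) t = conj (co w (i.1 - j.1) t) := fun w => by
    rw [← co_cj]; congr 1; abel
  simp only [sgm, bt, ng, e, dsym_cj, (hr _ _).herm]
  rw [map_add]
  congr 1
  · split_ifs <;> simp
  · simp

def mkG (v : Fin 3 → Fn) (g : E → D → Fin 3 → Fn) (r : D → E → Lat → ℂ) (f : D → Fn) (hv : ∀ i, IsS (v i))
    (hdiv : ∑ i, dx i (v i) = 0) (hg : ∀ e d i, IsS (g e d i)) {C : ℝ} (C0 : 0 ≤ C) (hrb : ∀ d e k, ‖r d e k‖ * √(wt k) ≤ C) (hf : ∀ d, IsS (f d))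
    (ψv : Fin 3 → Lat → ℝ) (ψg : E → D → Fin 3 → Lat → ℝ) (v0 : ∀ i k, 0 ≤ ψv i k) (g0 : ∀ e d i k, 0 ≤ ψg e d i k)
    (v1 : ∀ i (p : ℕ), Summable fun k => wt k ^ p * ψv i k) (g1 : ∀ e d i (p : ℕ), Summable fun k => wt k ^ p * ψg e d i k)
    (v2 : ∀ i k t, ‖co (v i) k t‖ ≤ ph t * ψv i k) (g2 : ∀ e d i k t, ‖co (g e d i) k t‖ ≤ ph t * ψg e d i k)
    (f2 : ∀ d (p : ℕ), ∃ C : ℝ, ∀ k t, ‖co (f d) k t‖ * wt k ^ p ≤ C * ph t) : Gal D where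
  σ := sgm v
  β := bt g r
  f i := co (f i.2) i.1
  ψ k := 7 * ∑ i, ψv i k + 14 * C * (wt k * ∑ e, ∑ d, ∑ i, ψg e d i k)
  cσ i j := by
    unfold sgm
    split_ifs
    · exact (continuous_finsetSum _ fun p _ => continuous_const.mul (((hv p).ss 0).cont _)).neg
    · exact continuous_const
  cβ i j := by
    unfold bt
    exact continuous_finsetSum _ fun e _ => continuous_const.mul (continuous_finsetSum _ fun p _ => continuous_const.mul (((hg e _ p).ss 0).cont _))
  cf i := ((hf i.2).ss 0).cont _
  ψ0 k := by
    have := wt_pos k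
    refine add_nonneg (mul_nonneg (by norm_num) (Finset.sum_nonneg fun i _ => v0 i k)) (mul_nonneg (by positivity) (mul_nonneg this.le ?_))
    exact Finset.sum_nonneg fun e _ => Finset.sum_nonneg fun d _ => Finset.sum_nonneg fun i _ => g0 e d i k
  hψ p := by
    have h1 : Summable fun k => 7 * ∑ i, wt k ^ p * ψv i k := (summable_sum fun i _ => v1 i p).mul_left 7
    have h2 : Summable fun k => 14 * C * ∑ e, ∑ d, ∑ i, wt k ^ (p + 1) * ψg e d i k :=
      (summable_sum fun e _ => summable_sum fun d _ => summable_sum fun i _ => g1 e d i (p + 1)).mul_left _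
    refine (h1.add h2).congr fun k => ?_
    simp only [← Finset.mul_sum]
    ring
  anti := sgm_anti hv hdiv
  hσ i j t := by
    have hp := ph_pos t
    have w := wt_pos (i.1 - j.1)
    have n2 : 0 ≤ 14 * C * (wt (i.1 - j.1) * ∑ e, ∑ d, ∑ p, ψg e d p (i.1 - j.1)) :=
      mul_nonneg (by positivity) (mul_nonneg w.le (Finset.sum_nonneg fun e _ => Finset.sum_nonneg fun d _ => Finset.sum_nonneg fun i _ => g0 e d i _))
    have n1 : 0 ≤ ∑ p, ψv p (i.1 - j.1) := Finset.sum_nonneg fun i _ => v0 i _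
    have h : ‖sgm v i j t‖ ≤ ph t * ((7 * ∑ p, ψv p (i.1 - j.1)) * √(wt j.1)) := by
      unfold sgm
      split_ifs
      · rw [norm_neg]
        calc _ ≤ ∑ p, (7 * √(wt j.1)) * (ph t * ψv p (i.1 - j.1)) := (norm_sum_le _ _).trans (Finset.sum_le_sum fun p _ => by
              rw [norm_mul]; exact mul_le_mul (norm_dsym' p _) (v2 p _ t) (norm_nonneg _) (by positivity))
          _ = _ := by rw [← Finset.mul_sum, ← Finset.mul_sum]; ring
      · simp only [norm_zero]; positivity
    refine h.trans (mul_le_mul_of_nonneg_left (mul_le_mul_of_nonneg_right ?_ (Real.sqrt_nonneg _)) hp.le)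
    linarith
  hβ i j t := by
    have hp := ph_pos t
    have w := one_le_wt (i.1 - j.1)
    have n1 : 0 ≤ ∑ p, ψv p (i.1 - j.1) := Finset.sum_nonneg fun i _ => v0 i _
    have h : ‖bt g r i j t‖ ≤ ∑ e, ∑ p, 14 * C * wt (i.1 - j.1) * (ph t * ψg e j.2 p (i.1 - j.1)) := by
      unfold bt
      refine (norm_sum_le _ _).trans (Finset.sum_le_sum fun e _ => ?_)
      rw [Finset.mul_sum]
      refine (norm_sum_le _ _).trans (Finset.sum_le_sum fun p _ => ?_)
      rw [norm_mul, norm_mul, ← mul_assoc]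
      refine mul_le_mul ?_ (g2 e _ p _ t) (norm_nonneg _) (by positivity)
      have h1 : √(wt j.1) ≤ √(wt i.1) * (2 * wt (i.1 - j.1)) := by
        rw [Real.sqrt_le_left (by positivity), mul_pow, Real.sq_sqrt (wt_pos _).le]
        have := wt_le_sub j.1 i.1
        rw [wt_sub_comm] at this
        have wi := wt_pos i.1
        have w2 : 2 * wt (i.1 - j.1) ≤ (2 * wt (i.1 - j.1)) ^ 2 := by nlinarith
        nlinarith [mul_le_mul_of_nonneg_left w2 wi.le]
      calc _ ≤ ‖r i.2 e i.1‖ * (7 * (√(wt i.1) * (2 * wt (i.1 - j.1)))) :=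
            mul_le_mul_of_nonneg_left ((norm_dsym' p _).trans (by linarith)) (norm_nonneg _)
        _ = (‖r i.2 e i.1‖ * √(wt i.1)) * (14 * wt (i.1 - j.1)) := by ring
        _ ≤ C * (14 * wt (i.1 - j.1)) := mul_le_mul_of_nonneg_right (hrb _ _ _) (by positivity)
        _ = _ := by ring
    refine h.trans ?_
    have e1 : ∑ e, ∑ p, 14 * C * wt (i.1 - j.1) * (ph t * ψg e j.2 p (i.1 - j.1)) = ph t * (14 * C * (wt (i.1 - j.1) * ∑ e, ∑ p, ψg e j.2 p (i.1 - j.1))) := by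
      simp only [← Finset.mul_sum]; ring
    rw [e1]
    refine mul_le_mul_of_nonneg_left ?_ hp.le
    have : ∑ e, ∑ p, ψg e j.2 p (i.1 - j.1) ≤ ∑ e, ∑ d, ∑ i_1, ψg e d i_1 (i.1 - j.1) := by
      refine Finset.sum_le_sum fun e _ => ?_
      exact Finset.single_le_sum (f := fun d => ∑ p, ψg e d p (i.1 - j.1)) (fun d _ => Finset.sum_nonneg fun p _ => g0 e d p _) (Finset.mem_univ _)
    have h5 : 14 * C * (wt (i.1 - j.1) * ∑ e, ∑ p, ψg e j.2 p (i.1 - j.1)) ≤ 14 * C * (wt (i.1 - j.1) * ∑ e, ∑ d, ∑ i_1, ψg e d i_1 (i.1 - j.1)) := by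
      gcongr
    linarith
  hf p := by
    choose C hC using fun d => f2 d p
    refine ⟨∑ d, |C d|, fun i t => (hC i.2 i.1 t).trans (mul_le_mul_of_nonneg_right ?_ (ph_pos t).le)⟩
    exact (le_abs_self _).trans (Finset.single_le_sum (f := fun d => |C d|) (fun d _ => abs_nonneg _) (Finset.mem_univ _))

theorem pde_ex (hv : ∀ i, IsS (v i)) (hdiv : ∑ i, dx i (v i) = 0) (hg : ∀ e d i, IsS (g e d i)) (hr : ∀ d e, Sym (r d e))
    {C : ℝ} (C0 : 0 ≤ C) (hrb : ∀ d e k, ‖r d e k‖ * √(wt k) ≤ C) (hf : ∀ d, IsS (f d))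
    {R : ℝ} (sv : ∀ i t, R ≤ |t| → ∀ x, v i t x = 0) (sg : ∀ e d i t, R ≤ |t| → ∀ x, g e d i t x = 0)
    (sf : ∀ d t, R ≤ |t| → ∀ x, f d t x = 0) (ts : ℝ) :
    ∃ N : D → Fn, (∀ d, IsS (N d)) ∧ (∀ d x, N d ts x = 0) ∧
      ∀ d, pt (N d) + ∑ i, v i * dx i (N d) = ∑ e, Op (r d e) (∑ d', ∑ i, g e d' i * dx i (N d')) + f d := by
  choose ψv v0 v1 v2 using fun i => dec (hv i) (sv i)
  choose ψg g0 g1 g2 using fun e d i => dec (hg e d i) (sg e d i)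
  choose ψf f0 f1 f2 using fun d => dec (hf d) (sf d)
  have f3 : ∀ d (p : ℕ), ∃ C : ℝ, ∀ k t, ‖co (f d) k t‖ * wt k ^ p ≤ C * ph t := by
    intro d p
    refine ⟨∑' k, wt k ^ p * ψf d k, fun k t => ?_⟩
    have w := wt_pos k
    calc _ ≤ (ph t * ψf d k) * wt k ^ p := mul_le_mul_of_nonneg_right (f2 d k t) (by positivity)
      _ = (wt k ^ p * ψf d k) * ph t := by ring
      _ ≤ _ := mul_le_mul_of_nonneg_right ((f1 d p).le_tsum k fun j _ => mul_nonneg (by have := wt_pos j; positivity) (f0 d j)) (ph_pos t).le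
  set G := mkG v g r f hv hdiv hg C0 hrb hf ψv ψg v0 g0 v1 g1 v2 g2 f3
  obtain ⟨a', h1, h2, h3, h4⟩ := G.main' (fun i j t => ng_sym hr i j t) (fun i t => co_cj (f i.2) i.1 t) ts
  set a : D → Sq := fun d k t => a' (k, d) t with ha
  have rd : ∀ d, RD (a d) := fun d p => by
    obtain ⟨C, hC⟩ := h1 p
    exact ⟨C, fun k t => hC (k, d) t⟩
  have hd : ∀ d k t, HasDerivAt (a d k) (PhiS v g r f a d k t) t := by
    intro d k t
    obtain ⟨s1, s2⟩ := h4 (k, d) t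
    rw [← sum_PhiS hv hg rd d k t s1]
    exact s2
  have ss : ∀ n d, SSn n (a d) := by
    intro n
    induction n with
    | zero => exact fun d => ⟨fun k => continuous_iff_continuousAt.2 fun t => (hd d k t).continuousAt, rd d⟩
    | succ n ih =>
      intro d
      refine ⟨fun k t => (hd d k t).differentiableAt, rd d, ?_⟩
      have : (fun k => deriv (a d k)) = PhiS v g r f a d := by
        funext k t; exact (hd d k t).deriv
      rw [this]
      exact PhiS_ss hv hg hr hf ih d
  have cja : ∀ d, cj (a d) = a d := by
    intro d; funext k t
    simp only [cj, ha]
    have := h3 (k, d) t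
    simp only [ng] at this
    rw [this, Complex.conj_conj]
  have hN : ∀ d, toC (fun t x => (ev (a d) t x).re) = ev (a d) := by
    intro d; funext t x
    have := ev_cj (a d) t x
    rw [cja] at this
    exact (Complex.conj_eq_iff_re.1 this.symm)
  have hNS := fun d => IsS.of_ev (fun n => ss n d) (hN d)
  refine ⟨fun d t x => (ev (a d) t x).re, fun d => (hNS d).1, fun d x => ?_, fun d => ?_⟩
  · simp [ev, ha, h2]
  · set N : D → Fn := fun d t x => (ev (a d) t x).re
    have i1 : ∀ d, IsS (N d) := fun d => (hNS d).1
    have i2 : ∀ d, co (N d) = a d := fun d => (hNS d).2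
    have j1 : ∀ i, IsS (v i * dx i (N d)) := fun i => (hv i).mul ((i1 d).dx i)
    have j2 : ∀ e d' i, IsS (g e d' i * dx i (N d')) := fun e d' i => (hg e d' i).mul ((i1 d').dx i)
    have j3 : ∀ e, IsS (∑ d', ∑ i, g e d' i * dx i (N d')) := fun e => IsS.sum _ fun d' _ => IsS.sum _ fun i _ => j2 e d' i
    have j4 : ∀ e, IsS (Op (r d e) (∑ d', ∑ i, g e d' i * dx i (N d'))) := fun e => (j3 e).op (hr d e)
    have cm : ∀ (w : Fn) (_ : IsS w) d' i k t, co (w * dx i (N d')) k t = cv (fun m t => dsym i m * a d' m t) (co w) k t := by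
      intro w hw d' i k t
      rw [mul_comm, co_mul ((i1 d').dx i) hw]
      congr 1
      funext m t
      rw [co_dx (i1 d'), i2]
    refine ((i1 d).pt.add (IsS.sum _ fun i _ => j1 i)).ext ((IsS.sum _ fun e _ => j4 e).add (hf d)) fun k t => ?_
    rw [co_add (i1 d).pt (IsS.sum _ fun i _ => j1 i), co_pt (i1 d), co_sum _ fun i _ => j1 i,
      co_add (IsS.sum _ fun e _ => j4 e) (hf d), co_sum _ fun e _ => j4 e, i2, (hd d k t).deriv]
    have q1 : ∀ i, co (v i * dx i (N d)) k t = cv (fun m t => dsym i m * a d m t) (co (v i)) k t := fun i => cm _ (hv i) d i k t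
    have q2 : ∀ e, co (Op (r d e) (∑ d', ∑ i, g e d' i * dx i (N d'))) k t = r d e k * ∑ d', ∑ p, cv (fun m t => dsym p m * a d' m t) (co (g e d' p)) k t := by
      intro e
      rw [co_op (hr d e) (j3 e), co_sum _ fun d' _ => IsS.sum _ fun i _ => j2 e d' i]
      congr 1
      refine Finset.sum_congr rfl fun d' _ => ?_
      rw [co_sum _ fun i _ => j2 e d' i]
      exact Finset.sum_congr rfl fun i _ => cm _ (hg e d' i) d' i k t
    simp only [q1, q2]
    unfold PhiS
    ring

end pde
end
end TE

namespace TE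
open scoped ComplexConjugate Topology

/-- material derivative on the smooth class -/
def Dt (v : Fin 3 → Fn) (f : Fn) : Fn := pt f + ∑ i, v i * dx i f

lemma IsS.vdx {v : Fin 3 → Fn} (hv : ∀ i, IsS (v i)) {f : Fn} (hf : IsS f) : IsS (∑ i, v i * TE.dx i f) :=
  IsS.sum _ fun i _ => (hv i).mul (hf.dx i)

lemma IsS.Dt {v : Fin 3 → Fn} (hv : ∀ i, IsS (v i)) {f : Fn} (hf : IsS f) : IsS (Dt v f) :=
  hf.pt.add (IsS.vdx hv hf)

lemma Dt_add {v : Fin 3 → Fn} {f g : Fn} (hf : IsS f) (hg : IsS g) : Dt v (f + g) = Dt v f + Dt v g := by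
  unfold Dt
  rw [pt_add hf hg]
  simp only [dx_add hf hg, mul_add, Finset.sum_add_distrib]
  abel

lemma Dt_smul {v : Fin 3 → Fn} {f : Fn} (hf : IsS f) (c : ℝ) : Dt v (c • f) = c • Dt v f := by
  unfold Dt
  rw [pt_smul hf]
  simp only [dx_smul hf, mul_smul_comm, smul_add, Finset.smul_sum]

lemma Dt_neg {v : Fin 3 → Fn} {f : Fn} (hf : IsS f) : Dt v (-f) = - Dt v f := by
  have := Dt_smul (v := v) hf (-1)
  simpa using this

lemma Dt_sub {v : Fin 3 → Fn} {f g : Fn} (hf : IsS f) (hg : IsS g) : Dt v (f - g) = Dt v f - Dt v g := by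
  rw [sub_eq_add_neg, Dt_add hf hg.neg, Dt_neg hg, sub_eq_add_neg]

lemma Dt_zero {v : Fin 3 → Fn} : Dt v 0 = 0 := by
  have := Dt_smul (v := v) isS_zero 0
  simpa using this

lemma Dt_sum {v : Fin 3 → Fn} {ι : Type*} (s : Finset ι) {f : ι → Fn} (hf : ∀ i ∈ s, IsS (f i)) :
    Dt v (∑ i ∈ s, f i) = ∑ i ∈ s, Dt v (f i) := by
  classical
  induction s using Finset.induction_on with
  | empty => simp [Dt_zero]
  | insert a s ha ih =>
    rw [Finset.sum_insert ha, Finset.sum_insert ha, Dt_add (hf a (by simp)) (IsS.sum _ fun i hi => hf i (by simp [hi])),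
      ih fun i hi => hf i (by simp [hi])]

lemma Dt_mul {v : Fin 3 → Fn} {f g : Fn} (hf : IsS f) (hg : IsS g) : Dt v (f * g) = Dt v f * g + f * Dt v g := by
  unfold Dt
  rw [pt_mul hf hg]
  simp only [dx_mul hf hg, mul_add, add_mul, Finset.sum_add_distrib, Finset.sum_mul, Finset.mul_sum]
  have e1 : ∀ i, v i * (dx i f * g) = v i * dx i f * g := fun i => by ring
  have e2 : ∀ i, v i * (f * dx i g) = f * (v i * dx i g) := fun i => by ring
  simp only [e1, e2]
  abel

lemma Dt_dx {v : Fin 3 → Fn} (hv : ∀ i, IsS (v i)) {f : Fn} (hf : IsS f) (j : Fin 3) :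
    Dt v (dx j f) = dx j (Dt v f) - ∑ i, dx j (v i) * dx i f := by
  unfold Dt
  rw [pt_dx hf, dx_add hf.pt (IsS.vdx hv hf), dx_sum _ fun i _ => (hv i).mul (hf.dx i)]
  simp only [dx_mul (hv _) (hf.dx _), Finset.sum_add_distrib, dx_comm hf j]
  abel

lemma vdx_div {v : Fin 3 → Fn} (hv : ∀ i, IsS (v i)) (hd : ∑ i, dx i (v i) = 0) {f : Fn} (hf : IsS f) :
    ∑ i, v i * dx i f = ∑ i, dx i (v i * f) := by
  simp only [dx_mul (hv _) hf, Finset.sum_add_distrib, ← Finset.sum_mul, hd]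
  simp

lemma Dt_op {v : Fin 3 → Fn} (hv : ∀ i, IsS (v i)) (hd : ∑ i, dx i (v i) = 0) {m : Lat → ℂ} (hm : Sym m)
    {f : Fn} (hf : IsS f) : Dt v (Op m f) = Op m (Dt v f) + ∑ i, comm (dsym i * m) (v i) f := by
  have e1 : ∀ i, dx i (Op m f) = Op (dsym i * m) f := fun i => by
    rw [op_dsym (hf.op hm), op_comp (Sym.dsym i) hm hf]
  have e2 : ∀ i, Op m (dx i (v i * f)) = Op (dsym i * m) (v i * f) := fun i => by
    rw [op_dsym ((hv i).mul hf), op_comp hm (Sym.dsym i) ((hv i).mul hf), mul_comm]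
  unfold Dt comm
  rw [vdx_div hv hd hf, op_add hm hf.pt (IsS.sum _ fun i _ => ((hv i).mul hf).dx i),
    op_sum hm _ fun i _ => ((hv i).mul hf).dx i, op_pt hm hf]
  simp only [e1, e2, Finset.sum_sub_distrib]
  abel

lemma int_add' {f g : Fn} (hf : IsS f) (hg : IsS g) (t : ℝ) :
    ∫ x in Tdom, (f + g) t x = (∫ x in Tdom, f t x) + ∫ x in Tdom, g t x :=
  integral_add (hf.integrable t) (hg.integrable t)

lemma int_sum' {ι : Type*} (s : Finset ι) {f : ι → Fn} (hf : ∀ i ∈ s, IsS (f i)) (t : ℝ) :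
    ∫ x in Tdom, (∑ i ∈ s, f i) t x = ∑ i ∈ s, ∫ x in Tdom, f i t x := by
  have := integral_finsetSum (μ := volume.restrict Tdom) s (f := fun i => f i t) fun i hi => (hf i hi).integrable t
  rw [← this]
  simp only [Finset.sum_apply]

lemma int_Dt {v : Fin 3 → Fn} (hv : ∀ i, IsS (v i)) (hd : ∑ i, dx i (v i) = 0) {f : Fn} (hf : IsS f) (t : ℝ) :
    ∫ x in Tdom, Dt v f t x = ∫ x in Tdom, pt f t x := by
  have hs : ∀ i, IsS (dx i (v i * f)) := fun i => ((hv i).mul hf).dx i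
  unfold Dt
  rw [vdx_div hv hd hf, int_add' hf.pt (IsS.sum _ fun i _ => hs i), int_sum' _ fun i _ => hs i]
  simp [fun i => ((hv i).mul hf).int_dx i t]

lemma deriv_int_Dt {v : Fin 3 → Fn} (hv : ∀ i, IsS (v i)) (hd : ∑ i, dx i (v i) = 0) {f : Fn} (hf : IsS f) (t : ℝ) :
    HasDerivAt (fun s => ∫ x in Tdom, f s x) (∫ x in Tdom, Dt v f t x) t := by
  rw [int_Dt hv hd hf]; exact hf.hasDerivAt_int t

lemma deriv_int4 {v : Fin 3 → Fn} (hv : ∀ i, IsS (v i)) (hd : ∑ i, dx i (v i) = 0) {f : Fn} (hf : IsS f) (t : ℝ) :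
    HasDerivAt (fun s => ∫ x in Tdom, f s x ^ 4) (4 * ∫ x in Tdom, f t x ^ 3 * Dt v f t x) t := by
  have h := deriv_int_Dt hv hd ((hf.mul hf).mul (hf.mul hf)) t
  rw [Dt_mul (hf.mul hf) (hf.mul hf), Dt_mul hf hf] at h
  rw [← integral_const_mul]
  have e : ∀ s x, (f * f * (f * f)) s x = f s x ^ 4 := fun s x => by simp only [Pi.mul_apply]; ring
  have e' : ∀ x, ((Dt v f * f + f * Dt v f) * (f * f) + f * f * (Dt v f * f + f * Dt v f)) t x
      = 4 * (f t x ^ 3 * Dt v f t x) := fun x => by simp only [Pi.mul_apply, Pi.add_apply]; ring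
  simpa only [e, e'] using h

lemma IsS.zero_of_n4 {f : Fn} (hf : IsS f) {t : ℝ} (h : n4 (f t) = 0) (x : Spc) : f t x = 0 := by
  have hc := hf.cont t
  have h4 : ∫ x in Tdom, f t x ^ 4 = 0 := by rw [← n4_pow hc, h]; norm_num
  have hz : f t =ᵐ[volume.restrict Tdom] 0 := by
    have := (integral_eq_zero_iff_of_nonneg (μ := volume.restrict Tdom) (f := fun x => f t x ^ 4)
      (fun x => by positivity) (cont_integrable (hc.pow 4))).1 h4
    filter_upwards [this] with x hx
    simpa using hx
  have hk : ∀ k, co f k t = 0 := by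
    intro k
    rw [co, hat]
    rw [integral_congr_ae (g := fun _ => 0)]
    · simp
    · filter_upwards [hz] with x hx
      simp [toC, hx]
  have := hf.ev' t x
  simp only [TE.ev, hk, zero_mul, tsum_zero] at this
  exact_mod_cast this

lemma Dt_unique {v : Fin 3 → Fn} (hv : ∀ i, IsS (v i)) (hd : ∑ i, dx i (v i) = 0) {f : Fn} (hf : IsS f)
    (h : Dt v f = 0) {ts : ℝ} (h0 : ∀ x, f ts x = 0) : f = 0 := by
  have hder : ∀ t, HasDerivAt (fun s => ∫ x in Tdom, f s x ^ 4) 0 t := fun t => by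
    have := deriv_int4 hv hd hf t
    simpa [h] using this
  funext t x
  refine hf.zero_of_n4 ?_ x
  have e := is_const_of_deriv_eq_zero (fun t => (hder t).differentiableAt) (fun t => (hder t).deriv) t ts
  rw [n4_eq (hf.cont t), e]
  simp [h0]

/-- iterated partial derivative along a word -/
def dxl (w : List (Fin 3)) (f : Fn) : Fn := w.foldr dx f

@[simp] lemma dxl_nil (f : Fn) : dxl [] f = f := rfl
lemma dxl_cons (j : Fin 3) (w : List (Fin 3)) (f : Fn) : dxl (j :: w) f = dx j (dxl w f) := rfl

lemma IsS.dxl {f : Fn} (hf : IsS f) (w : List (Fin 3)) : IsS (dxl w f) := by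
  induction w with
  | nil => exact hf
  | cons j w ih => exact ih.dx j

lemma dxl_dx {f : Fn} (hf : IsS f) (w : List (Fin 3)) (j : Fin 3) : dxl w (dx j f) = dx j (dxl w f) := by
  induction w with
  | nil => rfl
  | cons i w ih => rw [dxl_cons, ih, dx_comm (hf.dxl w), dxl_cons]

lemma dxl_append (w u : List (Fin 3)) (f : Fn) : dxl (w ++ u) f = dxl w (dxl u f) := by
  simp [dxl]

lemma dxl_comm {f : Fn} (hf : IsS f) (w u : List (Fin 3)) : dxl w (dxl u f) = dxl u (dxl w f) := by
  induction w with
  | nil => rfl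
  | cons i w ih => rw [dxl_cons, ih, dxl_cons, dxl_dx (hf.dxl w)]

lemma dxl_op {m : Lat → ℂ} (hm : Sym m) {f : Fn} (hf : IsS f) (w : List (Fin 3)) : dxl w (Op m f) = Op m (dxl w f) := by
  induction w with
  | nil => rfl
  | cons i w ih => rw [dxl_cons, ih, dxl_cons, op_dx hm (hf.dxl w)]

lemma dxl_add {f g : Fn} (hf : IsS f) (hg : IsS g) (w : List (Fin 3)) : dxl w (f + g) = dxl w f + dxl w g := by
  induction w with
  | nil => rfl
  | cons i w ih => rw [dxl_cons, ih, dx_add (hf.dxl w) (hg.dxl w)]; rfl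

lemma dxl_sub {f g : Fn} (hf : IsS f) (hg : IsS g) (w : List (Fin 3)) : dxl w (f - g) = dxl w f - dxl w g := by
  induction w with
  | nil => rfl
  | cons i w ih => rw [dxl_cons, ih, dx_sub (hf.dxl w) (hg.dxl w)]; rfl

lemma dxl_smul {f : Fn} (hf : IsS f) (c : ℝ) (w : List (Fin 3)) : dxl w (c • f) = c • dxl w f := by
  induction w with
  | nil => rfl
  | cons i w ih => rw [dxl_cons, ih, dx_smul (hf.dxl w)]; rfl

lemma dxl_sum {ι : Type*} (s : Finset ι) {f : ι → Fn} (hf : ∀ i ∈ s, IsS (f i)) (w : List (Fin 3)) :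
    dxl w (∑ i ∈ s, f i) = ∑ i ∈ s, dxl w (f i) := by
  induction w with
  | nil => rfl
  | cons i w ih => rw [dxl_cons, ih, dx_sum _ fun i hi => (hf i hi).dxl w]; rfl

lemma n4_sum' {ι : Type*} (s : Finset ι) {f : ι → Fn} (hf : ∀ i ∈ s, IsS (f i)) (t : ℝ) :
    n4 ((∑ i ∈ s, f i) t) ≤ ∑ i ∈ s, n4 (f i t) := by
  rw [Finset.sum_apply]
  exact n4_sum s fun i hi => (hf i hi).cont t

/-- generic Leibniz estimate for a bilinear expression `P` -/
lemma leib {S : Set (List (Fin 3))} {P : Fn → Fn → Fn} {c Λ : ℝ} (c0 : 0 ≤ c) (Λ0 : 0 < Λ)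
    (hP : ∀ g f, IsS g → IsS f → ∀ t B, 0 ≤ B → (∀ e ∈ S, ∀ x, |dxl e g t x| ≤ B) → n4 (P g f t) ≤ c * B * n4 (f t))
    (hI : ∀ g f, IsS g → IsS f → IsS (P g f))
    (hD : ∀ j g f, IsS g → IsS f → dx j (P g f) = P (dx j g) f + P g (dx j f)) (t : ℝ) (w : List (Fin 3)) :
    ∀ g f, IsS g → IsS f → ∀ A B, 0 ≤ A → 0 ≤ B →
    (∀ u : List (Fin 3), u.length ≤ w.length → ∀ e ∈ S, ∀ x, |dxl u (dxl e g) t x| ≤ B * Λ ^ u.length) →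
    (∀ u : List (Fin 3), u.length ≤ w.length → n4 (dxl u f t) ≤ A * Λ ^ u.length) →
    n4 (dxl w (P g f) t) ≤ c * 2 ^ w.length * B * A * Λ ^ w.length := by
  induction w with
  | nil =>
    intro g f hg hf A B A0 B0 h1 h2
    have e1 := hP g f hg hf t B B0 fun e he x => by simpa using h1 [] (by simp) e he x
    have e2 := h2 [] (by simp)
    simp only [dxl_nil, List.length_nil, pow_zero, mul_one] at e1 e2 ⊢
    exact e1.trans (mul_le_mul_of_nonneg_left e2 (by positivity))
  | cons j w ih =>
    intro g f hg hf A B A0 B0 h1 h2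
    have l : (j :: w).length = w.length + 1 := rfl
    rw [l] at h1 h2 ⊢
    rw [dxl_cons, ← dxl_dx (hI g f hg hf), hD j g f hg hf, dxl_add (hI _ _ (hg.dx j) hf) (hI _ _ hg (hf.dx j))]
    have a1 := ih (dx j g) f (hg.dx j) hf A (B * Λ) A0 (by positivity) (fun u hu e he x => by
      have := h1 (j :: u) (by simpa using hu) e he x
      rw [dxl_cons] at this
      rw [dxl_dx hg, dxl_dx (hg.dxl e)]
      refine this.trans (le_of_eq ?_)
      simp only [List.length_cons, pow_succ]; ring) (fun u hu => h2 u (by omega))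
    have a2 := ih g (dx j f) hg (hf.dx j) (A * Λ) B (by positivity) B0 (fun u hu => h1 u (by omega)) (fun u hu => by
      have := h2 (j :: u) (by simpa using hu)
      rw [dxl_cons] at this
      rw [dxl_dx hf]
      refine this.trans (le_of_eq ?_)
      simp only [List.length_cons, pow_succ]; ring)
    have := n4_add (g := dxl w (P g (dx j f)) t) (((hI _ _ (hg.dx j) hf).dxl w).cont t)
    refine this.trans ((add_le_add a1 a2).trans (le_of_eq ?_))
    rw [pow_succ, pow_succ]; ring

lemma leib_mul {Λ : ℝ} (Λ0 : 0 < Λ) (t : ℝ) (w : List (Fin 3)) {g f : Fn} (hg : IsS g) (hf : IsS f) {A B : ℝ}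
    (A0 : 0 ≤ A) (B0 : 0 ≤ B)
    (h1 : ∀ u : List (Fin 3), u.length ≤ w.length → ∀ x, |dxl u g t x| ≤ B * Λ ^ u.length)
    (h2 : ∀ u : List (Fin 3), u.length ≤ w.length → n4 (dxl u f t) ≤ A * Λ ^ u.length) :
    n4 (dxl w (g * f) t) ≤ 2 ^ w.length * B * A * Λ ^ w.length := by
  have := leib (S := {[]}) (P := fun g f => g * f) zero_le_one Λ0 (fun g f hg hf t B B0 h => by
      rw [one_mul]
      exact n4_mul (hf.cont t) (hg.cont t) B0 (h [] rfl)) (fun g f hg hf => hg.mul hf)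
    (fun j g f hg hf => dx_mul hg hf j) t w g f hg hf A B A0 B0 (fun u hu e he x => by
      rw [Set.mem_singleton_iff.1 he]; exact h1 u hu x) h2
  simpa using this

lemma dx_comm_op {m : Lat → ℂ} (hm : Sym m) (j : Fin 3) {g f : Fn} (hg : IsS g) (hf : IsS f) :
    dx j (comm m g f) = comm m (dx j g) f + comm m g (dx j f) := by
  unfold comm
  rw [dx_sub (hg.mul (hf.op hm)) ((hg.mul hf).op hm), dx_mul hg (hf.op hm), ← op_dx hm (hg.mul hf), dx_mul hg hf,
    op_add hm ((hg.dx j).mul hf) (hg.mul (hf.dx j)), ← op_dx hm hf]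
  abel

lemma leib_comm {m : Lat → ℂ} (hm : Sym m) {c Λ : ℝ} (c0 : 0 ≤ c) (hc : BdC m c) (Λ0 : 0 < Λ) (t : ℝ) (w : List (Fin 3))
    {g f : Fn} (hg : IsS g) (hf : IsS f) {A B : ℝ} (A0 : 0 ≤ A) (B0 : 0 ≤ B)
    (h1 : ∀ u : List (Fin 3), u.length ≤ w.length → ∀ i x, |dxl u (dx i g) t x| ≤ B * Λ ^ u.length)
    (h2 : ∀ u : List (Fin 3), u.length ≤ w.length → n4 (dxl u f t) ≤ A * Λ ^ u.length) :
    n4 (dxl w (comm m g f) t) ≤ c * 2 ^ w.length * B * A * Λ ^ w.length :=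
  leib (S := Set.range fun i => [i]) (P := comm m) c0 Λ0 (fun g f hg hf t B B0 h => 
      hc g f hg hf t B B0 fun i x => h [i] ⟨i, rfl⟩ x) (fun g f hg hf => IsS.comm hm hg hf)
    (fun j g f hg hf => dx_comm_op hm j hg hf) t w g f hg hf A B A0 B0 (fun u hu e he x => by
      obtain ⟨i, rfl⟩ := he; exact h1 u hu i x) h2

/-- bounds on the derivatives of the drift -/
def VB (v : Fin 3 → Fn) (L : ℕ) (τ Λ : ℝ) : Prop :=
  ∀ (w : List (Fin 3)), w.length ≤ L → ∀ i j t x, |dxl w (dx j (v i)) t x| ≤ τ⁻¹ * Λ ^ w.length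

lemma comm_word {v : Fin 3 → Fn} (hv : ∀ i, IsS (v i)) {L : ℕ} {τ Λ : ℝ} (τ0 : 0 < τ) (Λ0 : 0 < Λ) (hV : VB v L τ Λ)
    (t : ℝ) (w : List (Fin 3)) : ∀ f, IsS f → ∀ j Y, 0 ≤ Y → w.length ≤ L →
    (∀ u : List (Fin 3), u.length ≤ w.length → ∀ m, n4 (dxl u (dx m f) t) ≤ Y * Λ ^ u.length) →
    n4 (Dt v (dxl w (dx j f)) t - dxl w (dx j (Dt v f)) t) ≤ 6 * 2 ^ w.length * τ⁻¹ * Y * Λ ^ w.length := by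
  have key : ∀ (w : List (Fin 3)) f, IsS f → ∀ j Y, 0 ≤ Y → w.length ≤ L →
    (∀ u : List (Fin 3), u.length ≤ w.length → ∀ m, n4 (dxl u (dx m f) t) ≤ Y * Λ ^ u.length) →
    n4 (dxl w (∑ i, dx j (v i) * dx i f) t) ≤ 3 * (2 ^ w.length * τ⁻¹ * Y * Λ ^ w.length) := by
    intro w f hf j Y Y0 hw h
    have hs : ∀ i, IsS (dx j (v i) * dx i f) := fun i => ((hv i).dx j).mul (hf.dx i)
    rw [dxl_sum _ fun i _ => hs i]
    refine (n4_sum' _ (fun i _ => (hs i).dxl w) t).trans ((Finset.sum_le_sum fun i _ =>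
      leib_mul Λ0 t w ((hv i).dx j) (hf.dx i) Y0 (inv_nonneg.2 τ0.le) (fun u hu x => hV u (by omega) i j t x)
        fun u hu => h u hu i).trans (by simp))
  induction w with
  | nil =>
    intro f hf j Y Y0 hw h
    have := key [] f hf j Y Y0 hw h
    simp only [dxl_nil] at this ⊢
    rw [Dt_dx hv hf]
    rw [show (dx j (Dt v f) - ∑ i, dx j (v i) * dx i f) t - dx j (Dt v f) t = -((∑ i, dx j (v i) * dx i f) t) by
      rw [Pi.sub_apply]; abel, n4_neg]
    refine this.trans ?_
    have : 0 ≤ τ⁻¹ * Y := by positivity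
    simp only [List.length_nil, pow_zero]
    nlinarith
  | cons a w ih =>
    intro f hf j Y Y0 hw h
    have l : (a :: w).length = w.length + 1 := rfl
    rw [l] at hw h ⊢
    have hS : IsS (∑ i, dx j (v i) * dx i f) := IsS.sum _ fun i _ => ((hv i).dx j).mul (hf.dx i)
    have hD := IsS.Dt hv hf
    have h1 := ih (dx j f) (hf.dx j) a (Y * Λ) (by positivity) (by omega) fun u hu m => by
      have := h (m :: u) (by simpa using hu) j
      rw [dxl_cons] at this
      rw [dxl_dx (hf.dx j)]
      refine this.trans (le_of_eq ?_)
      simp only [List.length_cons, pow_succ]; ring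
    have h2 := key (a :: w) f hf j Y Y0 hw h
    rw [Dt_dx hv hf, dx_sub (hD.dx j) hS, dxl_sub ((hD.dx j).dx a) (hS.dx a), dxl_dx (hf.dx j), dxl_dx (hD.dx j),
      dxl_dx hS, ← dxl_cons, ← dxl_cons, ← dxl_cons] at h1
    have e : Dt v (dxl (a :: w) (dx j f)) t - dxl (a :: w) (dx j (Dt v f)) t
      = (Dt v (dxl (a :: w) (dx j f)) t - (dxl (a :: w) (dx j (Dt v f)) - dxl (a :: w) (∑ i, dx j (v i) * dx i f)) t)
        - dxl (a :: w) (∑ i, dx j (v i) * dx i f) t := by rw [Pi.sub_apply]; abel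
    rw [e]
    refine (n4_sub ?_).trans ((add_le_add h1 h2).trans (le_of_eq ?_))
    · exact ((IsS.Dt hv ((hf.dx j).dxl _)).cont t).sub ((((hD.dx j).dxl _).sub (hS.dxl _)).cont t)
    · rw [l, pow_succ, pow_succ]; ring

end TE

namespace TE
open scoped ComplexConjugate Topology

lemma op_madd {m n : Lat → ℂ} (hm : Sym m) (hn : Sym n) {f : Fn} (hf : IsS f) : Op (m + n) f = Op m f + Op n f :=
  (hf.op (hm.add hn)).ext ((hf.op hm).add (hf.op hn)) fun k t => by
    rw [co_op (hm.add hn) hf, co_add (hf.op hm) (hf.op hn), co_op hm hf, co_op hn hf, Pi.add_apply, add_mul]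

lemma op_msmul {m : Lat → ℂ} (hm : Sym m) (c : ℝ) {f : Fn} (hf : IsS f) : Op (fun k => (c : ℂ) * m k) f = c • Op m f :=
  (hf.op (hm.smul c)).ext ((hf.op hm).smul c) fun k t => by
    rw [co_op (hm.smul c) hf, co_smul (hf.op hm), co_op hm hf, mul_assoc]

lemma BdO.add {m n : Lat → ℂ} {a b : ℝ} (hm : Sym m) (hn : Sym n) (h1 : BdO m a) (h2 : BdO n b) : BdO (m + n) (a + b) := by
  intro f hf t
  rw [op_madd hm hn hf, add_mul]
  exact (n4_add ((hf.op hm).cont t)).trans (add_le_add (h1 f hf t) (h2 f hf t))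

lemma BdO.smul {m : Lat → ℂ} {a : ℝ} (hm : Sym m) (h1 : BdO m a) (c : ℝ) : BdO (fun k => (c : ℂ) * m k) (|c| * a) := by
  intro f hf t
  rw [op_msmul hm c hf, Pi.smul_apply, n4_smul, mul_assoc]
  exact mul_le_mul_of_nonneg_left (h1 f hf t) (abs_nonneg _)

lemma BdC.add {m n : Lat → ℂ} {a b : ℝ} (hm : Sym m) (hn : Sym n) (h1 : BdC m a) (h2 : BdC n b) : BdC (m + n) (a + b) := by
  intro g f hg hf t B hB h
  have e : comm (m + n) g f = comm m g f + comm n g f := by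
    unfold comm
    rw [op_madd hm hn hf, op_madd hm hn (hg.mul hf), mul_add]
    abel
  rw [e, add_mul, add_mul]
  exact (n4_add ((IsS.comm hm hg hf).cont t)).trans (add_le_add (h1 g f hg hf t B hB h) (h2 g f hg hf t B hB h))

lemma BdC.smul {m : Lat → ℂ} {a : ℝ} (hm : Sym m) (h1 : BdC m a) (c : ℝ) : BdC (fun k => (c : ℂ) * m k) (|c| * a) := by
  intro g f hg hf t B hB h
  have e : comm (fun k => (c : ℂ) * m k) g f = c • comm m g f := by
    unfold comm
    rw [op_msmul hm c hf, op_msmul hm c (hg.mul hf), mul_smul_comm, smul_sub]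
  rw [e, Pi.smul_apply, n4_smul, mul_assoc, mul_assoc, ← mul_assoc a]
  exact mul_le_mul_of_nonneg_left (h1 g f hg hf t B hB h) (abs_nonneg _)

def Jm (j : Fin 3) (k : Lat) : ℂ := -Complex.I * ((k j : ℝ) / (2 * Real.pi * kn k ^ 2) : ℝ)

lemma one_le_kn {k : Lat} (hk : k ≠ 0) : 1 ≤ kn k := by
  obtain ⟨i, hi⟩ := Function.ne_iff.1 hk
  refine le_trans ?_ (abs_le_kn k i)
  exact_mod_cast Int.one_le_abs hi

lemma kn_zero : kn 0 = 0 := by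
  have := kn_sq 0
  simpa using this

lemma wt_eq (k : Lat) : wt k = 1 + kn k ^ 2 := by rw [wt, kn_sq]

lemma Jm_zero (j : Fin 3) : Jm j 0 = 0 := by simp [Jm]

lemma Jm_bd (j : Fin 3) (k : Lat) : ‖Jm j k‖ * √(wt k) ≤ 1 := by
  by_cases hk : k = 0
  · subst hk; simp [Jm_zero]
  have h1 := one_le_kn hk
  have h2 := abs_le_kn k j
  have hs : √(wt k) ≤ 2 * kn k := by
    rw [Real.sqrt_le_left (by positivity), wt_eq]; nlinarith
  have hp := Real.pi_gt_three
  have : ‖Jm j k‖ = |(k j : ℝ)| / (2 * Real.pi * kn k ^ 2) := by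
    rw [Jm, norm_mul, Complex.norm_real, Real.norm_eq_abs, abs_div, abs_of_pos (a := 2 * Real.pi * kn k ^ 2) (by positivity)]
    simp
  rw [this, div_mul_eq_mul_div, div_le_one (by positivity)]
  calc _ ≤ kn k * (2 * kn k) := mul_le_mul h2 hs (by positivity) (by positivity)
    _ ≤ _ := by nlinarith

lemma Jm_sym (j : Fin 3) : Sym (Jm j) := by
  refine ⟨⟨1, 0, zero_le_one, fun k => ?_⟩, fun k => ?_⟩
  · have h1 : (1:ℝ) ≤ √(wt k) := by rw [Real.one_le_sqrt]; exact one_le_wt k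
    have := Jm_bd j k
    have h0 := norm_nonneg (Jm j k)
    simp only [pow_zero, mul_one]
    nlinarith
  · rw [Jm, Jm, kn_neg]
    simp [neg_div, Complex.conj_ofNat]

lemma dsym_Jm (m j : Fin 3) : dsym m * Jm j = rr m j := by
  funext k
  by_cases hk : k = 0
  · subst hk; simp [Jm_zero, rr]
  have h1 := one_le_kn hk
  have h2 : (kn k : ℂ) ≠ 0 := by exact_mod_cast (by linarith : kn k ≠ 0)
  have h3 : (Real.pi : ℂ) ≠ 0 := by exact_mod_cast Real.pi_ne_zero
  simp only [Pi.mul_apply, dsym, Jm, rr]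
  push_cast
  field_simp
  linear_combination (-(k m : ℂ) * (k j : ℂ)) * Complex.I_sq

def dl (a b : Fin 3) : ℝ := if a = b then 1 else 0

lemma dl_abs (a b : Fin 3) : |dl a b| ≤ 1 := by unfold dl; split_ifs <;> simp

lemma dl_comm (a b : Fin 3) : dl a b = dl b a := by simp [dl, eq_comm]

/-- the symbol of the symmetric inverse divergence -/
def rJ (d : Fin 3 × Fin 3) (e : Fin 3) : Lat → ℂ :=
  (fun k => (dl e d.2 : ℂ) * Jm d.1 k) + (fun k => (dl e d.1 : ℂ) * Jm d.2 k) + fun k => ((-dl d.1 d.2 : ℝ) : ℂ) * Jm e k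

lemma rJ_sym (d : Fin 3 × Fin 3) (e : Fin 3) : Sym (rJ d e) :=
  (((Jm_sym _).smul _).add ((Jm_sym _).smul _)).add ((Jm_sym _).smul _)

lemma rJ_zero (d : Fin 3 × Fin 3) (e : Fin 3) : rJ d e 0 = 0 := by simp [rJ, Jm_zero]

lemma rJ_swap (j l e : Fin 3) : rJ (j, l) e = rJ (l, j) e := by
  simp only [rJ, dl_comm j l]
  rw [add_comm (fun k => (dl e l : ℂ) * Jm j k)]

lemma rJ_bd (d : Fin 3 × Fin 3) (e : Fin 3) (k : Lat) : ‖rJ d e k‖ * √(wt k) ≤ 3 := by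
  have h : ∀ (c : ℝ) j, |c| ≤ 1 → ‖(c : ℂ) * Jm j k‖ ≤ ‖Jm j k‖ := fun c j hc => by
    rw [norm_mul, Complex.norm_real, Real.norm_eq_abs]
    exact mul_le_of_le_one_left (norm_nonneg _) hc
  have e1 := h _ d.1 (dl_abs e d.2)
  have e2 := h _ d.2 (dl_abs e d.1)
  have e3 := h _ e (show |-dl d.1 d.2| ≤ 1 by rw [abs_neg]; exact dl_abs _ _)
  have : ‖rJ d e k‖ ≤ ‖Jm d.1 k‖ + ‖Jm d.2 k‖ + ‖Jm e k‖ :=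
    (norm_add_le _ _).trans (add_le_add ((norm_add_le _ _).trans (add_le_add e1 e2)) e3)
  have b1 := Jm_bd d.1 k
  have b2 := Jm_bd d.2 k
  have b3 := Jm_bd e k
  nlinarith [mul_le_mul_of_nonneg_right this (Real.sqrt_nonneg (wt k))]

lemma dsym_rJ (m : Fin 3) (d : Fin 3 × Fin 3) (e : Fin 3) : dsym m * rJ d e =
    (fun k => (dl e d.2 : ℂ) * rr m d.1 k) + (fun k => (dl e d.1 : ℂ) * rr m d.2 k) + fun k => ((-dl d.1 d.2 : ℝ) : ℂ) * rr m e k := by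
  funext k
  simp only [← dsym_Jm, rJ, Pi.mul_apply, Pi.add_apply]
  ring

lemma rJ_bdO : ∃ C : ℝ, 1 ≤ C ∧ ∀ m d e, BdO (dsym m * rJ d e) C := by
  obtain ⟨C, hC, h⟩ := riesz2
  refine ⟨3 * C, by linarith, fun m d e => ?_⟩
  rw [dsym_rJ]
  have h' : ∀ i j, BdO (rr i j) C := fun i j f hf t => h i j f hf t
  have s := fun i j (c : ℝ) => (rr_sym i j).smul c
  refine BdO.mono (BdO.add ((s _ _ _).add (s _ _ _)) (s _ _ _) (BdO.add (s _ _ _) (s _ _ _) ((h' _ _).smul (rr_sym _ _) _)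
    ((h' _ _).smul (rr_sym _ _) _)) ((h' _ _).smul (rr_sym _ _) _)) ?_
  have e1 := dl_abs e d.2
  have e2 := dl_abs e d.1
  have e3 := dl_abs d.1 d.2
  rw [abs_neg]
  nlinarith

/-- symmetric inverse divergence -/
def RR (W : Fin 3 → Fn) (d : Fin 3 × Fin 3) : Fn := ∑ e, Op (rJ d e) (W e)

lemma IsS.RR {W : Fin 3 → Fn} (hW : ∀ e, IsS (W e)) (d : Fin 3 × Fin 3) : IsS (RR W d) :=
  IsS.sum _ fun e _ => (hW e).op (rJ_sym d e)

lemma RR_swap (W : Fin 3 → Fn) (j l : Fin 3) : RR W (j, l) = RR W (l, j) := by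
  simp only [RR, rJ_swap j l]

lemma co_RR {W : Fin 3 → Fn} (hW : ∀ e, IsS (W e)) (d : Fin 3 × Fin 3) (k : Lat) (t : ℝ) :
    co (RR W d) k t = ∑ e, rJ d e k * co (W e) k t := by
  rw [RR, co_sum _ fun e _ => (hW e).op (rJ_sym d e)]
  exact Finset.sum_congr rfl fun e _ => co_op (rJ_sym d e) (hW e) k t

lemma RR_mean {W : Fin 3 → Fn} (hW : ∀ e, IsS (W e)) (d : Fin 3 × Fin 3) (t : ℝ) : ∫ x in Tdom, RR W d t x = 0 := by
  have := co_zero (RR W d) t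
  rw [co_RR hW] at this
  simp only [rJ_zero, zero_mul, Finset.sum_const_zero] at this
  exact_mod_cast this.symm

lemma rr_trace {k : Lat} (hk : k ≠ 0) : ∑ j, rr j j k = 1 := by
  have h1 := one_le_kn hk
  have h2 := kn_sq k
  have : ∑ j, ((k j : ℝ) * (k j : ℝ) / kn k ^ 2) = 1 := by
    rw [← Finset.sum_div, h2, div_eq_one_iff_eq (by rw [← h2]; positivity)]
    simp only [sq]
  simp only [rr]
  rw [← Complex.ofReal_sum, this]; simp

lemma rr_comm (i j : Fin 3) (k : Lat) : rr i j k = rr j i k := by simp [rr, mul_comm]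

lemma RR_div {W : Fin 3 → Fn} (hW : ∀ e, IsS (W e)) (l : Fin 3) (h0 : ∀ t, ∫ x in Tdom, W l t x = 0) :
    ∑ j, dx j (RR W (j, l)) = W l := by
  have hR := IsS.RR hW
  refine (IsS.sum _ fun j _ => (hR (j, l)).dx j).ext (hW l) fun k t => ?_
  rw [co_sum _ fun j _ => (hR (j, l)).dx j]
  simp only [co_dx (hR _), co_RR hW, Finset.mul_sum]
  by_cases hk : k = 0
  · subst hk
    rw [co_zero, h0]
    simp [rJ_zero]
  have e : ∀ j e, dsym j k * (rJ (j, l) e k * co (W e) k t)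
      = ((dl e l : ℂ) * rr j j k + (dl e j : ℂ) * rr j l k + ((-dl j l : ℝ) : ℂ) * rr j e k) * co (W e) k t := fun j e => by
    rw [← mul_assoc]
    have := congrFun (dsym_rJ j (j, l) e) k
    simp only [Pi.mul_apply, Pi.add_apply] at this
    rw [this]
  simp only [e]
  have T := rr_trace hk
  rw [Fin.sum_univ_three] at T
  simp only [Fin.sum_univ_three, dl]
  have c1 := rr_comm 1 0 k
  have c2 := rr_comm 2 0 k
  have c3 := rr_comm 2 1 k
  fin_cases l
  · simp [c1, c2, c3]; linear_combination (co (W 0) k t) * T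
  · simp [c1, c2, c3]; linear_combination (co (W 1) k t) * T
  · simp [c1, c2, c3]; linear_combination (co (W 2) k t) * T

end TE

namespace TE
open scoped ComplexConjugate Topology

def WW (v V : Fin 3 → Fn) (Q : Fin 3 × Fin 3 → Fn) (l : Fin 3) : Fn :=
  Dt v (V l) + ∑ p, ∑ i, dx p (v i) * dx i (Q (p, l))

/-- the transport-elliptic equation for the low-frequency part -/
structure Sol (v V : Fin 3 → Fn) (ts : ℝ) (Q : Fin 3 × Fin 3 → Fn) : Prop where
  isS : ∀ d, IsS (Q d)
  ini0 : ∀ d x, Q d ts x = 0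
  eqn : ∀ d, Dt v (Q d) = RR (WW v V Q) d

lemma IsS.WW {v V : Fin 3 → Fn} (hv : ∀ i, IsS (v i)) (hV : ∀ l, IsS (V l)) {Q : Fin 3 × Fin 3 → Fn} (hQ : ∀ d, IsS (Q d))
    (l : Fin 3) : IsS (WW v V Q l) :=
  (IsS.Dt hv (hV l)).add (IsS.sum _ fun p _ => IsS.sum _ fun i _ => ((hv i).dx p).mul ((hQ _).dx i))

lemma Op_zero_time {m : Lat → ℂ} {f : Fn} {t : ℝ} (h : ∀ x, f t x = 0) (x : Spc) : Op m f t x = 0 := by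
  have : ∀ k, co f k t = 0 := fun k => by simp [co, hat, toC, h]
  simp [Op, ev, this]

lemma dx_zero_time {f : Fn} {t : ℝ} (h : ∀ x, f t x = 0) (j : Fin 3) (x : Spc) : dx j f t x = 0 := by
  have : f t = fun _ => 0 := funext h
  simp [dx, pd, this]

lemma dxl_zero_time {f : Fn} {t : ℝ} (h : ∀ x, f t x = 0) (w : List (Fin 3)) (x : Spc) : dxl w f t x = 0 := by
  induction w generalizing x with
  | nil => exact h x
  | cons j w ih => exact dx_zero_time ih j x

lemma pt_zero_time {f : Fn} {t : ℝ} (h : ∀ᶠ s in 𝓝 t, ∀ x, f s x = 0) (x : Spc) : pt f t x = 0 := by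
  have : (fun s => f s x) =ᶠ[𝓝 t] fun _ => 0 := h.mono fun s hs => hs x
  rw [pt, this.deriv_eq]; simp

lemma Dt_zero_time {v : Fin 3 → Fn} {f : Fn} {t : ℝ} (h : ∀ᶠ s in 𝓝 t, ∀ x, f s x = 0) (x : Spc) : Dt v f t x = 0 := by
  simp [Dt, pt_zero_time h, dx_zero_time h.self_of_nhds]

lemma sol_ex {v V : Fin 3 → Fn} (hv : ∀ i, IsS (v i)) (hd : ∑ i, dx i (v i) = 0) (hV : ∀ l, IsS (V l))
    {R : ℝ} (sv : ∀ i t, R ≤ |t| → ∀ x, v i t x = 0) (sV : ∀ l t, R ≤ |t| → ∀ x, V l t x = 0) (ts : ℝ) :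
    ∃ Q, Sol v V ts Q := by
  have hD := fun l => IsS.Dt hv (hV l)
  have far : ∀ {f : Fn}, (∀ t, R ≤ |t| → ∀ x, f t x = 0) → ∀ t, R + 1 ≤ |t| → ∀ᶠ s in 𝓝 t, ∀ x, f s x = 0 := by
    intro f hf t ht
    have : ∀ᶠ s in 𝓝 t, R < |s| := continuous_abs.continuousAt.eventually (lt_mem_nhds (by linarith))
    exact this.mono fun s hs => hf s hs.le
  obtain ⟨N, h1, h2, h3⟩ := pde_ex (D := Fin 3 × Fin 3) (E := Fin 3) (v := v)
    (g := fun e d i => dl e d.2 • dx d.1 (v i)) (r := rJ) (f := fun d => RR (fun l => Dt v (V l)) d) hv hd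
    (fun e d i => ((hv i).dx d.1).smul _) rJ_sym (C := 3) (by norm_num) rJ_bd (IsS.RR hD) (R := R + 1)
    (fun i t ht => sv i t (by linarith))
    (fun e d i t ht x => by
      have := dx_zero_time (sv i t (by linarith)) d.1 x
      simp [this])
    (fun d t ht x => by
      have : ∀ e, Op (rJ d e) (Dt v (V e)) t x = 0 := fun e =>
        Op_zero_time (fun x => Dt_zero_time (far (sV e) t ht) x) x
      simp [RR, this]) ts
  refine ⟨N, h1, h2, fun d => ?_⟩
  have hS : ∀ e, IsS (∑ p, ∑ i, dx p (v i) * dx i (N (p, e))) := fun e =>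
    IsS.sum _ fun p _ => IsS.sum _ fun i _ => ((hv i).dx p).mul ((h1 _).dx i)
  have := h3 d
  rw [show pt (N d) + ∑ i, v i * dx i (N d) = Dt v (N d) from rfl] at this
  rw [this, RR, RR, ← Finset.sum_add_distrib]
  refine Finset.sum_congr rfl fun e _ => ?_
  rw [WW, op_add (rJ_sym d e) (hD e) (hS e), add_comm]
  congr 2
  rw [Fintype.sum_prod_type]
  refine Finset.sum_congr rfl fun p _ => ?_
  rw [Finset.sum_comm]
  refine Finset.sum_congr rfl fun i _ => ?_
  rw [Finset.sum_eq_single e]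
  · simp [dl]
  · intro b _ hb
    simp [dl, hb.symm]
  · simp

lemma Sol.add {v V V' : Fin 3 → Fn} (hv : ∀ i, IsS (v i)) (hV : ∀ l, IsS (V l)) (hV' : ∀ l, IsS (V' l)) {ts : ℝ} {Q Q' : Fin 3 × Fin 3 → Fn} (h : Sol v V ts Q)
    (h' : Sol v V' ts Q') : Sol v (V + V') ts (Q + Q') := by
  refine ⟨fun d => (h.isS d).add (h'.isS d), fun d x => by simp [h.ini0, h'.ini0], fun d => ?_⟩
  rw [Pi.add_apply, Dt_add (h.isS d) (h'.isS d), h.eqn, h'.eqn, RR, RR, RR, ← Finset.sum_add_distrib]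
  refine Finset.sum_congr rfl fun e _ => ?_
  rw [← op_add (rJ_sym d e) (IsS.WW hv hV h.isS e) (IsS.WW hv hV' h'.isS e)]
  congr 1
  simp only [WW, Pi.add_apply, Dt_add (hV e) (hV' e), dx_add (h.isS _) (h'.isS _), mul_add, Finset.sum_add_distrib]
  abel

lemma Sol.smul {v V : Fin 3 → Fn} (hv : ∀ i, IsS (v i)) (hV : ∀ l, IsS (V l)) {ts : ℝ} {Q : Fin 3 × Fin 3 → Fn} (h : Sol v V ts Q)
    (c : ℝ) : Sol v (c • V) ts (c • Q) := by
  refine ⟨fun d => (h.isS d).smul c, fun d x => by simp [h.ini0], fun d => ?_⟩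
  rw [Pi.smul_apply, Dt_smul (h.isS d), h.eqn, RR, RR, Finset.smul_sum]
  refine Finset.sum_congr rfl fun e _ => ?_
  rw [← op_smul (rJ_sym d e) (IsS.WW hv hV h.isS e)]
  congr 1
  simp only [WW, Pi.smul_apply, Dt_smul (hV e), dx_smul (h.isS _), mul_smul_comm, Finset.smul_sum, smul_add]

section
variable {v V : Fin 3 → Fn} {ts : ℝ} {Q : Fin 3 × Fin 3 → Fn}

lemma Sol.symm (h : Sol v V ts Q) (hv : ∀ i, IsS (v i)) (hd : ∑ i, dx i (v i) = 0) (j l : Fin 3) : Q (j, l) = Q (l, j) := by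
  refine sub_eq_zero.1 (Dt_unique hv hd ((h.isS _).sub (h.isS _)) ?_ (ts := ts) fun x => by simp [h.ini0])
  rw [Dt_sub (h.isS _) (h.isS _), h.eqn, h.eqn, RR_swap, sub_self]

lemma Sol.mean (h : Sol v V ts Q) (hv : ∀ i, IsS (v i)) (hd : ∑ i, dx i (v i) = 0) (hV : ∀ l, IsS (V l)) (d) (t : ℝ) :
    ∫ x in Tdom, Q d t x = 0 := by
  have hder : ∀ t, HasDerivAt (fun s => ∫ x in Tdom, Q d s x) 0 t := fun t => by
    have := deriv_int_Dt hv hd (h.isS d) t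
    rwa [h.eqn, RR_mean (IsS.WW hv hV h.isS)] at this
  have e := is_const_of_deriv_eq_zero (fun t => (hder t).differentiableAt) (fun t => (hder t).deriv) t ts
  rw [e]; simp [h.ini0]

lemma Sol.WW_mean (h : Sol v V ts Q) (hv : ∀ i, IsS (v i)) (hd : ∑ i, dx i (v i) = 0) (hV : ∀ l, IsS (V l))
    (h0 : ∀ l t, ∫ x in Tdom, V l t x = 0) (l) (t : ℝ) : ∫ x in Tdom, WW v V Q l t x = 0 := by
  have hs : ∀ p i, IsS (dx i (dx p (v i) * Q (p, l))) := fun p i => (((hv i).dx p).mul (h.isS _)).dx i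
  have hd' : ∀ p, ∑ i, dx i (dx p (v i)) = 0 := fun p => by
    have : ∀ i, dx i (dx p (v i)) = dx p (dx i (v i)) := fun i => dx_comm (hv i) i p
    simp only [this]
    rw [← dx_sum _ fun i _ => (hv i).dx i, hd]
    funext t x
    exact dx_zero_time (fun _ => rfl) p x
  rw [WW, int_add' (IsS.Dt hv (hV l)) (IsS.sum _ fun p _ => IsS.sum _ fun i _ => ((hv i).dx p).mul ((h.isS _).dx i))]
  have e1 : ∫ x in Tdom, Dt v (V l) t x = 0 := by
    have := deriv_int_Dt hv hd (hV l) t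
    simp only [h0] at this
    exact this.unique (hasDerivAt_const t 0)
  have e2 : ∑ p, ∑ i, dx p (v i) * dx i (Q (p, l)) = ∑ p, ∑ i, dx i (dx p (v i) * Q (p, l)) :=
    Finset.sum_congr rfl fun p _ => vdx_div (v := fun i => dx p (v i)) (fun i => (hv i).dx p) (hd' p) (h.isS _)
  rw [e1, e2, int_sum' _ fun p _ => IsS.sum _ fun i _ => hs p i]
  simp only [int_sum' _ fun i _ => hs _ i, fun p i => (((hv i).dx p).mul (h.isS (p, l))).int_dx i t]
  simp

lemma Sol.div (h : Sol v V ts Q) (hv : ∀ i, IsS (v i)) (hd : ∑ i, dx i (v i) = 0) (hV : ∀ l, IsS (V l))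
    (h0 : ∀ l t, ∫ x in Tdom, V l t x = 0) (hts : ∀ l x, V l ts x = 0) (l) : ∑ j, dx j (Q (j, l)) = V l := by
  have hs : ∀ j, IsS (dx j (Q (j, l))) := fun j => (h.isS _).dx j
  refine sub_eq_zero.1 (Dt_unique hv hd ((IsS.sum _ fun j _ => hs j).sub (hV l)) ?_ (ts := ts) fun x => ?_)
  · rw [Dt_sub (IsS.sum _ fun j _ => hs j) (hV l), Dt_sum _ fun j _ => hs j]
    simp only [Dt_dx hv (h.isS _), Finset.sum_sub_distrib, h.eqn]
    rw [RR_div (IsS.WW hv hV h.isS) l (h.WW_mean hv hd hV h0 l), WW]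
    abel
  · have : ∀ j, dx j (Q (j, l)) ts x = 0 := fun j => dx_zero_time (h.ini0 _) j x
    simp [hts, this]

end

def wds (L : ℕ) : Finset (List (Fin 3)) := (List.finite_length_le (Fin 3) L).toFinset

lemma mem_wds {L : ℕ} {w : List (Fin 3)} : w ∈ wds L ↔ w.length ≤ L := by simp [wds]

lemma n4_RR {C : ℝ} (hC : ∀ m d e, BdO (dsym m * rJ d e) C) {W : Fin 3 → Fn} (hW : ∀ e, IsS (W e)) (w : List (Fin 3))
    (m d) (t : ℝ) {b : ℝ} (C0 : 0 ≤ C) (hb : ∀ e, n4 (dxl w (W e) t) ≤ b) : n4 (dxl w (dx m (RR W d)) t) ≤ 3 * C * b := by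
  have e : dxl w (dx m (RR W d)) = ∑ e, Op (dsym m * rJ d e) (dxl w (W e)) := by
    rw [RR, dx_sum _ fun e _ => (hW e).op (rJ_sym d e), dxl_sum _ fun e _ => ((hW e).op (rJ_sym d e)).dx m]
    refine Finset.sum_congr rfl fun e _ => ?_
    rw [op_dsym ((hW e).op (rJ_sym d e)), op_comp (Sym.dsym m) (rJ_sym d e) (hW e),
      dxl_op ((Sym.dsym m).mul (rJ_sym d e)) (hW e)]
  rw [e]
  refine (n4_sum' _ (fun e _ => ((hW e).dxl w).op ((Sym.dsym m).mul (rJ_sym d e))) t).trans ?_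
  refine (Finset.sum_le_sum fun e _ => ((hC m d e _ ((hW e).dxl w) t).trans (mul_le_mul_of_nonneg_left (hb e) C0))).trans ?_
  simp; linarith

end TE

namespace TE
open scoped ComplexConjugate Topology

lemma Sol.dtQ {v V : Fin 3 → Fn} {ts : ℝ} {Q : Fin 3 × Fin 3 → Fn} (h : Sol v V ts Q) (hv : ∀ i, IsS (v i))
    (hV : ∀ l, IsS (V l)) {C : ℝ} (C0 : 0 ≤ C) (hC : ∀ m d e, BdO (dsym m * rJ d e) C) {L : ℕ} {τ Λ : ℝ} (τ0 : 0 < τ) (Λ0 : 0 < Λ)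
    (hB : VB v L τ Λ) {B : ℝ} {t : ℝ} (hV' : ∀ w : List (Fin 3), w.length ≤ L → ∀ l, n4 (dxl w (Dt v (V l)) t) ≤ B * τ⁻¹ * Λ ^ w.length)
    {Y : ℝ} (Y0 : 0 ≤ Y) (hY : ∀ w : List (Fin 3), w.length ≤ L → ∀ m d, n4 (dxl w (dx m (Q d)) t) ≤ Y * Λ ^ w.length)
    (w : List (Fin 3)) (hw : w.length ≤ L) (m d) :
    n4 (dxl w (dx m (Dt v (Q d))) t) ≤ 3 * C * (B + 9 * 2 ^ L * Y) * τ⁻¹ * Λ ^ w.length := by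
  have hs : ∀ l p i, IsS (dx p (v i) * dx i (Q (p, l))) := fun l p i => ((hv i).dx p).mul ((h.isS _).dx i)
  rw [h.eqn]
  refine (n4_RR hC (IsS.WW hv hV h.isS) w m d t C0 (b := (B + 9 * 2 ^ L * Y) * τ⁻¹ * Λ ^ w.length) fun l => ?_).trans (le_of_eq (by ring))
  rw [WW, dxl_add (IsS.Dt hv (hV l)) (IsS.sum _ fun p _ => IsS.sum _ fun i _ => hs l p i)]
  refine (n4_add (((IsS.Dt hv (hV l)).dxl w).cont t)).trans ?_
  have e1 := hV' w hw l
  have e2 : n4 (dxl w (∑ p, ∑ i, dx p (v i) * dx i (Q (p, l))) t) ≤ 9 * (2 ^ L * τ⁻¹ * Y * Λ ^ w.length) := by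
    rw [dxl_sum _ fun p _ => IsS.sum _ fun i _ => hs l p i]
    simp only [dxl_sum _ fun i _ => hs _ _ i]
    refine (n4_sum' _ (fun p _ => IsS.sum _ fun i _ => (hs l p i).dxl w) t).trans ?_
    refine (Finset.sum_le_sum fun p _ => (n4_sum' _ (fun i _ => (hs l p i).dxl w) t).trans 
      (Finset.sum_le_sum fun i _ => (leib_mul Λ0 t w ((hv i).dx p) ((h.isS (p, l)).dx i) Y0 (inv_nonneg.2 τ0.le)
        (fun u hu x => hB u (by omega) i p t x) fun u hu => hY u (by omega) i (p, l)).trans 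
        (?_ : _ ≤ 2 ^ L * τ⁻¹ * Y * Λ ^ w.length))).trans ?_
    · have : (2:ℝ) ^ w.length ≤ 2 ^ L := pow_le_pow_right₀ (by norm_num) hw
      have h3 : 0 ≤ τ⁻¹ * Y * Λ ^ w.length := by positivity
      nlinarith
    · simp; linarith
  calc _ ≤ _ := add_le_add e1 e2
    _ = _ := by ring

lemma low_est (L : ℕ) : ∃ C : ℝ, 1 ≤ C ∧ ∀ (v V : Fin 3 → Fn) (ts : ℝ) (Q : Fin 3 × Fin 3 → Fn) (τ Λ B : ℝ), Sol v V ts Q →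
    (∀ i, IsS (v i)) → ∑ i, dx i (v i) = 0 → (∀ l, IsS (V l)) → 0 < τ → 0 < Λ → 0 ≤ B → VB v L τ Λ →
    (∀ w : List (Fin 3), w.length ≤ L → ∀ l t, n4 (dxl w (Dt v (V l)) t) ≤ B * τ⁻¹ * Λ ^ w.length) →
    ∀ t, |t - ts| ≤ 4 * τ → ∀ w : List (Fin 3), w.length ≤ L → ∀ m d, 
      n4 (dxl w (dx m (Q d)) t) ≤ C * B * Λ ^ w.length ∧ n4 (dxl w (dx m (Dt v (Q d))) t) ≤ C * B * τ⁻¹ * Λ ^ w.length := by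
  obtain ⟨C, C1, hC⟩ := rJ_bdO
  have C0 : 0 ≤ C := by linarith
  set I : Finset (List (Fin 3) × Fin 3 × Fin 3 × Fin 3) := wds L ×ˢ Finset.univ
  set C2 : ℝ := 3 * C * (1 + 9 * 2 ^ L) + 6 * 2 ^ L with hC2
  have C20 : 0 ≤ C2 := by positivity
  set M : ℝ := 8 * I.card * C2 with hM
  have M0 : 0 ≤ M := by positivity
  set E : ℝ := Real.exp M with hE
  have E1 : 1 ≤ E := Real.one_le_exp M0
  refine ⟨3 * C * (1 + 9 * 2 ^ L * E) + E, by nlinarith [show 0 ≤ 3 * C * (1 + 9 * 2 ^ L * E) by positivity], ?_⟩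
  intro v V ts Q τ Λ B h hv hd hV τ0 Λ0 B0 hB hV'
  set y : ℝ → ℝ := fun t => ∑ q ∈ I, (Λ ^ (4 * q.1.length))⁻¹ * ∫ x in Tdom, dxl q.1 (dx q.2.1 (Q q.2.2)) t x ^ 4 with hy
  set y' : ℝ → ℝ := fun t => ∑ q ∈ I, (Λ ^ (4 * q.1.length))⁻¹ * (4 * ∫ x in Tdom, dxl q.1 (dx q.2.1 (Q q.2.2)) t x ^ 3 * Dt v (dxl q.1 (dx q.2.1 (Q q.2.2))) t x) with hy'
  have hq : ∀ w m d, IsS (dxl w (dx m (Q d))) := fun w m d => ((h.isS d).dx m).dxl w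
  have y0 : ∀ t, 0 ≤ y t := fun t => Finset.sum_nonneg fun q _ => mul_nonneg (by positivity) (int4_nonneg _)
  set Y : ℝ → ℝ := fun t => y t ^ ((1:ℝ)/4) with hYd
  have Y0 : ∀ t, 0 ≤ Y t := fun t => Real.rpow_nonneg (y0 t) _
  have Y4 : ∀ t, Y t ^ 4 = y t := fun t => by
    rw [hYd, ← Real.rpow_natCast, ← Real.rpow_mul (y0 t)]; norm_num
  have hY : ∀ t, ∀ w : List (Fin 3), w.length ≤ L → ∀ m d, n4 (dxl w (dx m (Q d)) t) ≤ Y t * Λ ^ w.length := by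
    intro t w hw m d
    refine n4_le_of_int ((hq w m d).cont t) (mul_nonneg (Y0 t) (by positivity)) ?_
    rw [mul_pow, Y4, ← pow_mul, mul_comm w.length]
    rw [← div_le_iff₀ (by positivity), div_eq_inv_mul]
    exact Finset.single_le_sum (f := fun q : List (Fin 3) × Fin 3 × Fin 3 × Fin 3 =>
      (Λ ^ (4 * q.1.length))⁻¹ * ∫ x in Tdom, dxl q.1 (dx q.2.1 (Q q.2.2)) t x ^ 4)
      (fun q _ => mul_nonneg (by positivity) (int4_nonneg _)) (a := (w, m, d)) (by simp [I, mem_wds, hw])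
  have hDY : ∀ t, ∀ w : List (Fin 3), w.length ≤ L → ∀ m d, n4 (Dt v (dxl w (dx m (Q d))) t) ≤ C2 * (B + Y t) * τ⁻¹ * Λ ^ w.length := by
    intro t w hw m d
    have e1 := h.dtQ hv hV C0 hC τ0 Λ0 hB (B := B) (t := t) (fun w hw l => hV' w hw l t) (Y0 t) (hY t) w hw m d
    have e2 := comm_word hv τ0 Λ0 hB t w (Q d) (h.isS d) m (Y t) (Y0 t) hw fun u hu m => hY t u (by omega) m d
    have e3 : n4 (Dt v (dxl w (dx m (Q d))) t) ≤ n4 (Dt v (dxl w (dx m (Q d))) t - dxl w (dx m (Dt v (Q d))) t) + n4 (dxl w (dx m (Dt v (Q d))) t) := by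
      have := n4_add (f := Dt v (dxl w (dx m (Q d))) t - dxl w (dx m (Dt v (Q d))) t) (g := dxl w (dx m (Dt v (Q d))) t)
        (((IsS.Dt hv (hq w m d)).cont t).sub ((((IsS.Dt hv (h.isS d)).dx m).dxl w).cont t))
      rwa [sub_add_cancel] at this
    refine e3.trans ((add_le_add e2 e1).trans ?_)
    have l1 : (2:ℝ) ^ w.length ≤ 2 ^ L := pow_le_pow_right₀ (by norm_num) hw
    have l2 : 6 * 2 ^ w.length * Y t + 3 * C * (B + 9 * 2 ^ L * Y t) ≤ C2 * (B + Y t) := by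
      rw [hC2]
      have := Y0 t
      have a1 : 6 * 2 ^ w.length * Y t ≤ 6 * 2 ^ L * Y t := by gcongr
      have a2 : 0 ≤ 6 * 2 ^ L * B := by positivity
      have a3 : 0 ≤ 3 * C * (9 * 2 ^ L) * B := by positivity
      have a4 : 0 ≤ 3 * C * Y t := by positivity
      nlinarith
    calc _ = (6 * 2 ^ w.length * Y t + 3 * C * (B + 9 * 2 ^ L * Y t)) * (τ⁻¹ * Λ ^ w.length) := by ring
      _ ≤ C2 * (B + Y t) * (τ⁻¹ * Λ ^ w.length) := mul_le_mul_of_nonneg_right l2 (by positivity)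
      _ = _ := by ring
  have hder : ∀ t, HasDerivAt y (y' t) t := fun t => by
    refine HasDerivAt.fun_sum fun q _ => ?_
    exact (deriv_int4 hv hd (hq _ _ _) t).const_mul _
  have hyb : ∀ t, |y' t| ≤ M * τ⁻¹ * (y t + B ^ 4) := by
    intro t
    have hYt := Y0 t
    have term : ∀ q ∈ I, |(Λ ^ (4 * q.1.length))⁻¹ * (4 * ∫ x in Tdom, dxl q.1 (dx q.2.1 (Q q.2.2)) t x ^ 3 * Dt v (dxl q.1 (dx q.2.1 (Q q.2.2))) t x)|
        ≤ 4 * C2 * τ⁻¹ * (Y t ^ 3 * (B + Y t)) := by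
      rintro ⟨w, m, d⟩ hq'
      have hw : w.length ≤ L := by simpa [I, mem_wds] using hq'
      have p : 0 < Λ ^ w.length := by positivity
      have b1 := holder' ((hq w m d).cont t) ((IsS.Dt hv (hq w m d)).cont t)
      have b2 := b1.trans (mul_le_mul (pow_le_pow_left₀ (n4_nonneg _) (hY t w hw m d) 3) (hDY t w hw m d) (n4_nonneg _) (by positivity))
      rw [abs_mul, abs_mul, abs_of_pos (inv_pos.2 (by positivity : 0 < Λ ^ (4 * w.length))), abs_of_pos (by norm_num : (0:ℝ) < 4),
        inv_mul_le_iff₀ (by positivity)]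
      refine (mul_le_mul_of_nonneg_left b2 (by norm_num)).trans (le_of_eq ?_)
      rw [mul_comm 4 w.length, pow_mul]
      ring
    have key : Y t ^ 3 * (B + Y t) ≤ 2 * (y t + B ^ 4) := by
      rw [← Y4]
      have : Y t ^ 3 * B ≤ Y t ^ 4 + B ^ 4 := by
        rcases le_total (Y t) B with hh | hh
        · have : Y t ^ 3 * B ≤ B ^ 3 * B := by gcongr
          nlinarith [pow_nonneg hYt 4]
        · have : Y t ^ 3 * B ≤ Y t ^ 3 * Y t := by gcongr
          nlinarith [pow_nonneg B0 4]
      nlinarith [pow_nonneg B0 4]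
    refine (Finset.abs_sum_le_sum_abs _ _).trans ((Finset.sum_le_sum term).trans ?_)
    rw [Finset.sum_const, nsmul_eq_mul, hM]
    calc _ ≤ (I.card:ℝ) * (4 * C2 * τ⁻¹ * (2 * (y t + B ^ 4))) := by gcongr
      _ = _ := by ring
  have hts : y ts = 0 := by
    refine Finset.sum_eq_zero fun q _ => ?_
    have : ∀ x, dxl q.1 (dx q.2.1 (Q q.2.2)) ts x = 0 := dxl_zero_time (dx_zero_time (h.ini0 _) _) _
    simp [this]
  have hg := gron (y := y) (y' := y') (Φ := fun t => t * τ⁻¹) (φ := fun _ => τ⁻¹) (C := M) (K := B ^ 4) (ts := ts) hder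
    (fun t => by simpa using (hasDerivAt_id t).mul_const τ⁻¹) (fun a b hab => by simp only; gcongr) hyb hts
  intro t ht w hw m d
  have hYt : Y t ≤ E * B := by
    have h1 := hg t
    have h2 : |t * τ⁻¹ - ts * τ⁻¹| ≤ 4 := by
      rw [← sub_mul, abs_mul, abs_of_pos (inv_pos.2 τ0), ← div_eq_mul_inv, div_le_iff₀ τ0]; exact ht
    have h3 : Real.exp (M * |t * τ⁻¹ - ts * τ⁻¹|) ≤ E ^ 4 := by
      rw [hE, ← Real.exp_nat_mul]
      refine Real.exp_le_exp.2 ?_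
      push_cast
      nlinarith
    have h4 : Y t ^ 4 ≤ (E * B) ^ 4 := by
      rw [Y4, mul_pow]
      have : B ^ 4 * Real.exp (M * |t * τ⁻¹ - ts * τ⁻¹|) ≤ B ^ 4 * E ^ 4 := by gcongr
      nlinarith [pow_nonneg B0 4]
    exact le_of_pow_le_pow_left₀ (by norm_num) (by positivity) h4
  have hp : 0 ≤ 3 * C * (1 + 9 * 2 ^ L * E) := by positivity
  constructor
  · refine (hY t w hw m d).trans (mul_le_mul_of_nonneg_right (hYt.trans ?_) (by positivity))
    nlinarith
  · refine (h.dtQ hv hV C0 hC τ0 Λ0 hB (B := B) (t := t) (fun w hw l => hV' w hw l t) (Y0 t) (hY t) w hw m d).trans ?_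
    refine mul_le_mul_of_nonneg_right (mul_le_mul_of_nonneg_right ?_ (by positivity)) (by positivity)
    calc _ ≤ 3 * C * (B + 9 * 2 ^ L * (E * B)) := by gcongr
      _ ≤ _ := by nlinarith

end TE

namespace TE
open scoped ComplexConjugate Topology

def NF (Λ : ℝ) : Lat → ℂ := (fun _ => ((1:ℝ) : ℂ)) + fun k => ((-1 : ℝ) : ℂ) * Fg (1 / Λ) k

lemma NF_sym (Λ : ℝ) : Sym (NF Λ) := (Sym.const 1).add ((Fg_sym _).smul _)

lemma op_one {f : Fn} (hf : IsS f) : Op (fun _ => ((1:ℝ) : ℂ)) f = f :=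
  (hf.op (Sym.const 1)).ext hf fun k t => by rw [co_op (Sym.const 1) hf]; simp

lemma op_NF (Λ : ℝ) {f : Fn} (hf : IsS f) : Op (NF Λ) f = f - Op (Fg (1 / Λ)) f := by
  rw [NF, op_madd (Sym.const 1) ((Fg_sym _).smul _) hf, op_one hf, op_msmul (Fg_sym _) _ hf]
  simp [sub_eq_add_neg]

def mh (Λ : ℝ) (d : Fin 3 × Fin 3) (e : Fin 3) : Lat → ℂ := rJ d e * NF Λ

lemma mh_sym (Λ : ℝ) (d : Fin 3 × Fin 3) (e : Fin 3) : Sym (mh Λ d e) := (rJ_sym d e).mul (NF_sym Λ)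

lemma Jm_NF {Λ : ℝ} (hΛ : 0 < Λ) (i j : Fin 3) (k : Lat) :
    dsym i k * Jm j k * NF Λ k = ((-(Λ ^ 2)⁻¹ : ℝ) : ℂ) * (dsym i * dsym j * Hs Λ) k := by
  by_cases hk : k = 0
  · subst hk; simp [Jm_zero, dsym]
  have h1 := one_le_kn hk
  have h2 : (kn k : ℂ) ≠ 0 := by exact_mod_cast (by linarith : kn k ≠ 0)
  have h3 : (Real.pi : ℂ) ≠ 0 := by exact_mod_cast Real.pi_ne_zero
  have h4 : (Λ : ℂ) ≠ 0 := by exact_mod_cast hΛ.ne'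
  have hH := Hs_eq hΛ k
  have hN : NF Λ k = 4 * Real.pi ^ 2 * (kn k : ℂ) ^ 2 * Hs Λ k / Λ ^ 2 := by
    rw [hH, NF]
    field_simp
    simp [sub_eq_add_neg]
  rw [hN]
  simp only [Pi.mul_apply, dsym, Jm]
  push_cast
  field_simp
  ring

lemma mh_bdC : ∃ K : ℝ, 1 ≤ K ∧ ∀ Λ : ℝ, 0 < Λ → ∀ i d e, BdC (dsym i * mh Λ d e) (K / Λ) := by
  obtain ⟨K, K1, hK⟩ := h_bounds
  refine ⟨3 * K, by linarith, fun Λ hΛ i d e => ?_⟩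
  have s : ∀ i j, Sym (dsym i * dsym j * Hs Λ) := fun i j => ((Sym.dsym i).mul (Sym.dsym j)).mul (Hs_sym Λ)
  have s' := fun i j (c : ℝ) => (s i j).smul c
  have e1 : dsym i * mh Λ d e = (fun k => ((dl e d.2 * (-(Λ ^ 2)⁻¹) : ℝ) : ℂ) * (dsym i * dsym d.1 * Hs Λ) k)
    + (fun k => ((dl e d.1 * (-(Λ ^ 2)⁻¹) : ℝ) : ℂ) * (dsym i * dsym d.2 * Hs Λ) k) + 
    (fun k => ((-dl d.1 d.2 * (-(Λ ^ 2)⁻¹) : ℝ) : ℂ) * (dsym i * dsym e * Hs Λ) k) := by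
    funext k
    have j1 := Jm_NF hΛ i d.1 k
    have j2 := Jm_NF hΛ i d.2 k
    have j3 := Jm_NF hΛ i e k
    simp only [Pi.add_apply]
    rw [Complex.ofReal_mul, Complex.ofReal_mul, Complex.ofReal_mul, mul_assoc (dl e d.2 : ℂ), mul_assoc (dl e d.1 : ℂ),
      mul_assoc ((-dl d.1 d.2 : ℝ) : ℂ), ← j1, ← j2, ← j3]
    simp only [mh, rJ, Pi.mul_apply, Pi.add_apply]
    ring
  rw [e1]
  refine BdC.mono (BdC.add ((s' _ _ _).add (s' _ _ _)) (s' _ _ _) (BdC.add (s' _ _ _) (s' _ _ _)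
    ((hK Λ hΛ _ _).smul (s _ _) _) ((hK Λ hΛ _ _).smul (s _ _) _)) ((hK Λ hΛ _ _).smul (s _ _) _)) ?_
  have q : ∀ c : ℝ, |c| ≤ 1 → |c * (-(Λ ^ 2)⁻¹)| * (K * Λ) ≤ K / Λ := by
    intro c hc
    rw [abs_mul, abs_neg, abs_of_pos (a := (Λ ^ 2)⁻¹) (by positivity)]
    have : |c| * (Λ ^ 2)⁻¹ * (K * Λ) = |c| * (K / Λ) := by field_simp
    rw [this]
    exact mul_le_of_le_one_left (by positivity) hc
  have q1 := q _ (dl_abs e d.2)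
  have q2 := q _ (dl_abs e d.1)
  have q3 := q _ (show |-dl d.1 d.2| ≤ 1 by rw [abs_neg]; exact dl_abs _ _)
  have : 3 * K / Λ = K / Λ + K / Λ + K / Λ := by ring
  linarith

/-- high-frequency part -/
def Qh (Λ : ℝ) (U : Fin 3 → Fn) (d : Fin 3 × Fin 3) : Fn := ∑ e, Op (mh Λ d e) (U e)

lemma IsS.Qh {U : Fin 3 → Fn} (hU : ∀ l, IsS (U l)) (Λ : ℝ) (d : Fin 3 × Fin 3) : IsS (Qh Λ U d) :=
  IsS.sum _ fun e _ => (hU e).op (mh_sym Λ d e)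

lemma Qh_eq {U : Fin 3 → Fn} (hU : ∀ l, IsS (U l)) (Λ : ℝ) (d : Fin 3 × Fin 3) :
    Qh Λ U d = RR (fun e => U e - Op (Fg (1 / Λ)) (U e)) d := by
  unfold Qh RR
  refine Finset.sum_congr rfl fun e _ => ?_
  rw [mh, ← op_comp (rJ_sym d e) (NF_sym Λ) (hU e), op_NF Λ (hU e)]

lemma Qh_add {U U' : Fin 3 → Fn} (hU : ∀ l, IsS (U l)) (hU' : ∀ l, IsS (U' l)) (Λ : ℝ) : Qh Λ (U + U') = Qh Λ U + Qh Λ U' := by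
  funext d
  simp only [Qh, Pi.add_apply, op_add (mh_sym Λ d _) (hU _) (hU' _), Finset.sum_add_distrib]

lemma Qh_smul {U : Fin 3 → Fn} (hU : ∀ l, IsS (U l)) (Λ c : ℝ) : Qh Λ (c • U) = c • Qh Λ U := by
  funext d
  simp only [Qh, Pi.smul_apply, op_smul (mh_sym Λ d _) (hU _), Finset.smul_sum]

lemma op_mean {m : Lat → ℂ} (hm : Sym m) {f : Fn} (hf : IsS f) {t : ℝ} (h : ∫ x in Tdom, f t x = 0) :
    ∫ x in Tdom, Op m f t x = 0 := by
  have := co_zero (Op m f) t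
  rw [co_op hm hf, co_zero, h] at this
  simp only [Complex.ofReal_zero, mul_zero] at this
  exact_mod_cast this.symm

lemma Qh_div {U : Fin 3 → Fn} (hU : ∀ l, IsS (U l)) (Λ : ℝ) (h0 : ∀ l t, ∫ x in Tdom, U l t x = 0) (l : Fin 3) :
    ∑ j, dx j (Qh Λ U (j, l)) = U l - Op (Fg (1 / Λ)) (U l) := by
  simp only [Qh_eq hU]
  have hS : ∀ e, IsS (U e - Op (Fg (1 / Λ)) (U e)) := fun e => (hU e).sub ((hU e).op (Fg_sym _))
  refine RR_div hS l fun t => ?_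
  have := integral_sub (μ := volume.restrict Tdom) ((hU l).integrable t) (((hU l).op (Fg_sym (1 / Λ))).integrable t)
  simp only [Pi.sub_apply]
  rw [this, h0, op_mean (Fg_sym _) (hU l) (h0 l t), sub_zero]

lemma Qh_est (L : ℕ) : ∃ C : ℝ, 1 ≤ C ∧ ∀ (v U : Fin 3 → Fn) (τ Λ A : ℝ), (∀ i, IsS (v i)) → ∑ i, dx i (v i) = 0 →
    (∀ l, IsS (U l)) → 0 < τ → 0 < Λ → 0 ≤ A → VB v L τ Λ →
    (∀ w : List (Fin 3), w.length ≤ L → ∀ l t, n4 (dxl w (U l) t) ≤ A * Λ ^ w.length) →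
    (∀ w : List (Fin 3), w.length + 1 ≤ L → ∀ l t, n4 (dxl w (Dt v (U l)) t) ≤ A * τ⁻¹ * Λ ^ w.length) →
    ∀ t m d, (∀ w : List (Fin 3), w.length ≤ L → n4 (dxl w (dx m (Qh Λ U d)) t) ≤ C * A * Λ ^ w.length) ∧ 
      (∀ w : List (Fin 3), w.length + 1 ≤ L → n4 (dxl w (dx m (Dt v (Qh Λ U d))) t) ≤ C * A * τ⁻¹ * Λ ^ w.length) := by
  obtain ⟨C, C1, hC⟩ := rJ_bdO
  obtain ⟨K, K1, hK⟩ := mh_bdC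
  obtain ⟨K', K1', hK'⟩ := fg_bounds
  refine ⟨6 * C + 9 * K * 2 ^ L, by nlinarith [show 0 ≤ 9 * K * 2 ^ L by positivity], ?_⟩
  intro v U τ Λ A hv hd hU τ0 Λ0 A0 hB hA hA' t m d
  have bN : BdO (NF Λ) 2 := by
    intro f hf t
    rw [op_NF Λ hf]
    have := (hK' (1 / Λ) (by positivity)).1 f hf t
    refine (n4_sub (hf.cont t)).trans ?_
    linarith
  have sm : ∀ e, Sym (dsym m * mh Λ d e) := fun e => (Sym.dsym m).mul (mh_sym Λ d e)
  have bm : ∀ e, BdO (dsym m * mh Λ d e) (2 * C) := fun e => by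
    rw [mh, ← mul_assoc, mul_comm 2 C]
    exact BdO.mul ((Sym.dsym m).mul (rJ_sym d e)) (NF_sym Λ) (by linarith) (hC m d e) bN
  have first : ∀ (w : List (Fin 3)) (W : Fin 3 → Fn) (b : ℝ), (∀ e, IsS (W e)) → (∀ e, n4 (dxl w (W e) t) ≤ b) → 
      n4 (dxl w (dx m (∑ e, Op (mh Λ d e) (W e))) t) ≤ 6 * C * b := by
    intro w W b hW hb
    have e : dxl w (dx m (∑ e, Op (mh Λ d e) (W e))) = ∑ e, Op (dsym m * mh Λ d e) (dxl w (W e)) := by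
      rw [dx_sum _ fun e _ => (hW e).op (mh_sym Λ d e), dxl_sum _ fun e _ => ((hW e).op (mh_sym Λ d e)).dx m]
      refine Finset.sum_congr rfl fun e _ => ?_
      rw [op_dsym ((hW e).op (mh_sym Λ d e)), op_comp (Sym.dsym m) (mh_sym Λ d e) (hW e), dxl_op (sm e) (hW e)]
    rw [e]
    refine (n4_sum' _ (fun e _ => ((hW e).dxl w).op (sm e)) t).trans ?_
    refine (Finset.sum_le_sum fun e _ => ((bm e _ ((hW e).dxl w) t).trans (mul_le_mul_of_nonneg_left (hb e) (by linarith)))).trans ?_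
    simp; linarith
  constructor
  · intro w hw
    refine (first w U _ hU fun e => hA w hw e t).trans ?_
    have : 0 ≤ 9 * K * 2 ^ L * (A * Λ ^ w.length) := by positivity
    nlinarith
  · intro w hw
    have hc : ∀ e i, IsS (comm (dsym i * mh Λ d e) (v i) (U e)) := fun e i =>
      IsS.comm ((Sym.dsym i).mul (mh_sym Λ d e)) (hv i) (hU e)
    have e1 : Dt v (Qh Λ U d) = (∑ e, Op (mh Λ d e) (Dt v (U e))) + ∑ e, ∑ i, comm (dsym i * mh Λ d e) (v i) (U e) := by
      rw [Qh, Dt_sum _ fun e _ => (hU e).op (mh_sym Λ d e), ← Finset.sum_add_distrib]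
      exact Finset.sum_congr rfl fun e _ => Dt_op hv hd (mh_sym Λ d e) (hU e)
    have hD : ∀ e, IsS (Dt v (U e)) := fun e => IsS.Dt hv (hU e)
    have hS1 : IsS (∑ e, Op (mh Λ d e) (Dt v (U e))) := IsS.sum _ fun e _ => (hD e).op (mh_sym Λ d e)
    have hS2 : IsS (∑ e, ∑ i, comm (dsym i * mh Λ d e) (v i) (U e)) := IsS.sum _ fun e _ => IsS.sum _ fun i _ => hc e i
    have f1 := first w _ _ hD fun e => hA' w hw e t
    have f2 : n4 (dxl w (dx m (∑ e, ∑ i, comm (dsym i * mh Λ d e) (v i) (U e))) t) ≤ 9 * (K * 2 ^ L * τ⁻¹ * A * Λ ^ w.length) := by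
      rw [dxl_dx hS2, ← dxl_cons, dxl_sum _ fun e _ => IsS.sum _ fun i _ => hc e i]
      simp only [dxl_sum _ fun i _ => hc _ i]
      refine (n4_sum' _ (fun p _ => IsS.sum _ fun i _ => (hc p i).dxl _) t).trans ?_
      refine (Finset.sum_le_sum fun p _ => (n4_sum' _ (fun i _ => (hc p i).dxl _) t).trans 
        (Finset.sum_le_sum fun i _ => (leib_comm ((Sym.dsym i).mul (mh_sym Λ d p)) (c := K / Λ) (by positivity) (hK Λ Λ0 i d p)
          Λ0 t (m :: w) (hv i) (hU p) A0 (inv_nonneg.2 τ0.le) (fun u hu j x => hB u (by simp at hu; omega) i j t x)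
          (fun u hu => hA u (by simp at hu; omega) p t)).trans
        (?_ : _ ≤ K * 2 ^ L * τ⁻¹ * A * Λ ^ w.length))).trans ?_
      · rw [List.length_cons]
        have : (2:ℝ) ^ (w.length + 1) ≤ 2 ^ L := pow_le_pow_right₀ (by norm_num) hw
        calc _ = 2 ^ (w.length + 1) * (K * τ⁻¹ * A * Λ ^ w.length) := by rw [pow_succ Λ]; field_simp
          _ ≤ 2 ^ L * (K * τ⁻¹ * A * Λ ^ w.length) := by gcongr
          _ = _ := by ring
      · simp; linarith
    rw [e1, dx_add hS1 hS2, dxl_add (hS1.dx m) (hS2.dx m)]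
    refine (n4_add (((hS1.dx m).dxl w).cont t)).trans ((add_le_add f1 f2).trans (le_of_eq ?_))
    ring

lemma low_data (L : ℕ) (hL : 1 ≤ L) : ∃ C : ℝ, 1 ≤ C ∧ ∀ (v : Fin 3 → Fn) (f : Fn) (τ Λ A : ℝ), (∀ i, IsS (v i)) → ∑ i, dx i (v i) = 0 →
    IsS f → 0 < τ → 0 < Λ → 0 ≤ A → VB v L τ Λ →
    (∀ w : List (Fin 3), w.length ≤ L → ∀ t, n4 (dxl w f t) ≤ A * Λ ^ w.length) →
    (∀ w : List (Fin 3), w.length + 1 ≤ L → ∀ t, n4 (dxl w (Dt v f) t) ≤ A * τ⁻¹ * Λ ^ w.length) →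
    ∀ w : List (Fin 3), w.length ≤ L → ∀ t, n4 (dxl w (Dt v (Op (Fg (1 / Λ)) f)) t) ≤ C * A * τ⁻¹ * Λ ^ w.length := by
  obtain ⟨K, K1, hK⟩ := fg_bounds
  refine ⟨K + 3 * K * 2 ^ L, by nlinarith [show 0 ≤ 3 * K * 2 ^ L by positivity], ?_⟩
  intro v f τ Λ A hv hd hf τ0 Λ0 A0 hB hA hA' w hw t
  obtain ⟨k1, k2, k3, k4⟩ := hK (1 / Λ) (by positivity)
  have sF := Fg_sym (1 / Λ)
  have hD := IsS.Dt hv hf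
  have hc : ∀ i, IsS (comm (dsym i * Fg (1 / Λ)) (v i) f) := fun i => IsS.comm ((Sym.dsym i).mul sF) (hv i) hf
  rw [Dt_op hv hd sF hf, dxl_add (hD.op sF) (IsS.sum _ fun i _ => hc i), dxl_sum _ fun i _ => hc i]
  have f1 : n4 (dxl w (Op (Fg (1 / Λ)) (Dt v f)) t) ≤ K * (A * τ⁻¹ * Λ ^ w.length) := by
    rw [dxl_op sF hD]
    cases w with
    | nil =>
      refine (k1 _ (hD.dxl []) t).trans ?_
      have := hA' [] (by simpa using hL) t
      have h0 : 0 ≤ A * τ⁻¹ * Λ ^ ([] : List (Fin 3)).length := by positivity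
      nlinarith
    | cons j w =>
      rw [dxl_cons, op_dsym (hD.dxl w), op_comp sF (Sym.dsym j) (hD.dxl w), mul_comm]
      have := hA' w (by simpa using hw) t
      refine (k2 j _ (hD.dxl w) t).trans ((mul_le_mul_of_nonneg_left this (by positivity)).trans (le_of_eq ?_))
      rw [List.length_cons, pow_succ]
      field_simp
  have f2 : n4 ((∑ i, dxl w (comm (dsym i * Fg (1 / Λ)) (v i) f)) t) ≤ 3 * (K * 2 ^ L * τ⁻¹ * A * Λ ^ w.length) := by
    refine (n4_sum' _ (fun i _ => (hc i).dxl w) t).trans 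
        ((Finset.sum_le_sum fun i _ => (leib_comm ((Sym.dsym i).mul sF) (c := K) (by positivity) (k3 i)
          Λ0 t w (hv i) hf A0 (inv_nonneg.2 τ0.le) (fun u hu j x => hB u (by omega) i j t x)
          (fun u hu => hA u (by omega) t)).trans
        (?_ : _ ≤ K * 2 ^ L * τ⁻¹ * A * Λ ^ w.length)).trans ?_)
    · have : (2:ℝ) ^ w.length ≤ 2 ^ L := pow_le_pow_right₀ (by norm_num) hw
      gcongr
    · simp
  refine (n4_add (((hD.op sF).dxl w).cont t)).trans ((add_le_add f1 f2).trans (le_of_eq ?_))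
  ring

end TE

namespace TE
open scoped ComplexConjugate Topology

lemma bump_ex : ∃ (b : ℝ → ℝ) (K : ℝ), 0 ≤ K ∧ ContDiff ℝ (⊤ : ℕ∞) b ∧ (∀ s, |s| ≤ 1 → b s = 1) ∧ (∀ s, 3 / 2 ≤ |s| → b s = 0) ∧
    (∀ s, |b s| ≤ 1) ∧ ∀ s, |deriv b s| ≤ K := by
  let f : ContDiffBump (0 : ℝ) := ⟨1, 3 / 2, by norm_num, by norm_num⟩
  have hc : ContDiff ℝ (⊤ : ℕ∞) f := f.contDiff
  obtain ⟨K, hK⟩ := (f.hasCompactSupport.deriv).exists_bound_of_continuous (hc.continuous_deriv (by simp))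
  refine ⟨f, K, (norm_nonneg _).trans (hK 0), hc, fun s hs => ?_, fun s hs => ?_, fun s => ?_, fun s => ?_⟩
  · exact f.one_of_mem_closedBall (by simpa using hs)
  · exact f.zero_of_le_dist (by simpa using hs)
  · rw [abs_of_nonneg f.nonneg]; exact f.le_one
  · simpa using hK s

def tf (η : ℝ → ℝ) : Fn := fun t _ => η t

lemma isS_tf {η : ℝ → ℝ} (h : ContDiff ℝ (⊤ : ℕ∞) η) {R : ℝ} (hR : ∀ t, R ≤ |t| → η t = 0) : IsS (tf η) :=
  isS_of_smooth (h.comp contDiff_fst) (fun t x k => rfl) ⟨R, fun t ht x => hR t ht⟩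

lemma dx_tf (η : ℝ → ℝ) (j : Fin 3) : dx j (tf η) = 0 := by
  funext t x
  have : tf η t = fun _ => η t := rfl
  simp [dx, pd, this]

lemma pt_tf (η : ℝ → ℝ) : pt (tf η) = tf (deriv η) := rfl

lemma Dt_tf (v : Fin 3 → Fn) (η : ℝ → ℝ) : Dt v (tf η) = tf (deriv η) := by
  simp [Dt, dx_tf, pt_tf]

lemma dx_tf_mul {η : ℝ → ℝ} (h : IsS (tf η)) {f : Fn} (hf : IsS f) (j : Fin 3) : dx j (tf η * f) = tf η * dx j f := by
  rw [dx_mul h hf, dx_tf, zero_mul, zero_add]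

lemma dxl_tf_mul {η : ℝ → ℝ} (h : IsS (tf η)) {f : Fn} (hf : IsS f) (w : List (Fin 3)) : dxl w (tf η * f) = tf η * dxl w f := by
  induction w with
  | nil => rfl
  | cons j w ih => rw [dxl_cons, ih, dx_tf_mul h (hf.dxl w), dxl_cons]

lemma n4_tf_mul (η : ℝ → ℝ) (f : Fn) (t : ℝ) : n4 ((tf η * f) t) = |η t| * n4 (f t) := n4_smul (η t) (f t)

def Qf (η : ℝ → ℝ) (Λ : ℝ) (U : Fin 3 → Fn) (Q : Fin 3 × Fin 3 → Fn) (d : Fin 3 × Fin 3) : Fn := tf η * Q d + Qh Λ U d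

def Lo (Λ : ℝ) (U : Fin 3 → Fn) (l : Fin 3) : Fn := Op (Fg (1 / Λ)) (U l)

lemma IsS.Lo {U : Fin 3 → Fn} (hU : ∀ l, IsS (U l)) (Λ : ℝ) (l : Fin 3) : IsS (Lo Λ U l) := (hU l).op (Fg_sym _)

structure Cut (η : ℝ → ℝ) (t0 τ K : ℝ) : Prop where
  isS : IsS (tf η)
  le : ∀ t, |η t| ≤ 1
  dle : ∀ t, |deriv η t| ≤ K * τ⁻¹
  one : ∀ t, |t - t0| ≤ τ → η t = 1
  zero : ∀ t, 3 * τ / 2 ≤ |t - t0| → η t = 0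

lemma Cut.dzero {η : ℝ → ℝ} {t0 τ K : ℝ} (h : Cut η t0 τ K) {t : ℝ} (ht : 3 * τ / 2 < |t - t0|) : deriv η t = 0 := by
  have : η =ᶠ[𝓝 t] fun _ => 0 := by
    have ho : IsOpen {s : ℝ | 3 * τ / 2 < |s - t0|} := isOpen_lt continuous_const (by fun_prop)
    filter_upwards [ho.mem_nhds ht] with s hs
    exact h.zero s (le_of_lt hs)
  rw [this.deriv_eq]; simp

lemma IsS.Qf {η : ℝ → ℝ} (h : IsS (tf η)) {U : Fin 3 → Fn} (hU : ∀ l, IsS (U l)) {Q : Fin 3 × Fin 3 → Fn} (hQ : ∀ d, IsS (Q d)) (Λ : ℝ)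
    (d : Fin 3 × Fin 3) : IsS (Qf η Λ U Q d) := (h.mul (hQ d)).add (IsS.Qh hU Λ d)

lemma fin_est (L : ℕ) (hL : 1 ≤ L) (K : ℝ) (K0 : 0 ≤ K) : ∃ C : ℝ, 1 ≤ C ∧ ∀ (v U : Fin 3 → Fn) (t0 τ Λ A : ℝ) (η : ℝ → ℝ) (Q : Fin 3 × Fin 3 → Fn),
    (∀ i, IsS (v i)) → ∑ i, dx i (v i) = 0 →
    (∀ l, IsS (U l)) → 0 < τ → 0 < Λ → 0 ≤ A → VB v L τ Λ →
    (∀ w : List (Fin 3), w.length ≤ L → ∀ l t, n4 (dxl w (U l) t) ≤ A * Λ ^ w.length) →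
    (∀ w : List (Fin 3), w.length + 1 ≤ L → ∀ l t, n4 (dxl w (Dt v (U l)) t) ≤ A * τ⁻¹ * Λ ^ w.length) →
    Cut η t0 τ K → Sol v (Lo Λ U) (t0 - 2 * τ) Q →
    ∀ t m d, (∀ w : List (Fin 3), w.length ≤ L → n4 (dxl w (dx m (Qf η Λ U Q d)) t) ≤ C * A * Λ ^ w.length) ∧
      (∀ w : List (Fin 3), w.length + 1 ≤ L → n4 (dxl w (dx m (Dt v (Qf η Λ U Q d))) t) ≤ C * A * τ⁻¹ * Λ ^ w.length) := by
  obtain ⟨C1, h1, H1⟩ := Qh_est L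
  obtain ⟨C2, h2, H2⟩ := low_data L hL
  obtain ⟨C3, h3, H3⟩ := low_est L
  have hp : 0 ≤ C3 * C2 := by positivity
  refine ⟨C1 + (K + 1) * (C3 * C2), by nlinarith [mul_nonneg K0 hp], fun v U t0 τ Λ A η Q hv hd hU τ0 Λ0 A0 hVB hU1 hU2 hη hS t m d => ?_⟩
  have e1 := H1 v U τ Λ A hv hd hU τ0 Λ0 A0 hVB hU1 hU2 t m d
  have e2 : ∀ w : List (Fin 3), w.length ≤ L → ∀ l t, n4 (dxl w (Dt v (Lo Λ U l)) t) ≤ (C2 * A) * τ⁻¹ * Λ ^ w.length := fun w hw l t =>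
    H2 v (U l) τ Λ A hv hd (hU l) τ0 Λ0 A0 hVB (fun w hw t => hU1 w hw l t) (fun w hw t => hU2 w hw l t) w hw t
  have e3 := H3 v (Lo Λ U) _ Q τ Λ (C2 * A) hS hv hd (IsS.Lo hU Λ) τ0 Λ0 (by positivity) hVB e2 t
  have hQ := hS.isS d
  have hq := IsS.Qh hU Λ d
  have hη' : IsS (tf (deriv η)) := hη.isS.pt
  have hcase : (η t = 0 ∧ deriv η t = 0) ∨ |t - (t0 - 2 * τ)| ≤ 4 * τ := by
    rcases le_or_gt |t - t0| (3 * τ / 2) with h | h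
    · right
      rw [abs_le] at h ⊢
      constructor <;> linarith [h.1, h.2]
    · exact Or.inl ⟨hη.zero t h.le, hη.dzero h⟩
  have hτ : 0 < τ⁻¹ := by positivity
  refine ⟨fun w hw => ?_, fun w hw => ?_⟩
  · have key : n4 (dxl w (dx m (tf η * Q d)) t) ≤ C3 * (C2 * A) * Λ ^ w.length := by
      rw [dx_tf_mul hη.isS hQ, dxl_tf_mul hη.isS (hQ.dx m), n4_tf_mul]
      rcases hcase with h | h
      · rw [h.1]; simp; positivity
      · exact (mul_le_of_le_one_left (n4_nonneg _) (hη.le t)).trans (e3 h w hw m d).1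
    have hz := e1.1 w hw
    rw [Qf, dx_add (hη.isS.mul hQ) hq, dxl_add ((hη.isS.mul hQ).dx m) (hq.dx m)]
    refine (n4_add ((((hη.isS.mul hQ).dx m).dxl w).cont t)).trans ?_
    have : 0 ≤ K * (C3 * C2) * A * Λ ^ w.length := by positivity
    linarith
  · have k1 : n4 (dxl w (dx m (tf η * Dt v (Q d))) t) ≤ C3 * (C2 * A) * τ⁻¹ * Λ ^ w.length := by
      rw [dx_tf_mul hη.isS (hQ.Dt hv), dxl_tf_mul hη.isS ((hQ.Dt hv).dx m), n4_tf_mul]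
      rcases hcase with h | h
      · rw [h.1]; simp; positivity
      · exact (mul_le_of_le_one_left (n4_nonneg _) (hη.le t)).trans (e3 h w (by omega) m d).2
    have k2 : n4 (dxl w (dx m (tf (deriv η) * Q d)) t) ≤ (K * τ⁻¹) * (C3 * (C2 * A) * Λ ^ w.length) := by
      rw [dx_tf_mul hη' hQ, dxl_tf_mul hη' (hQ.dx m), n4_tf_mul]
      rcases hcase with h | h
      · rw [h.2]; simp; positivity
      · exact mul_le_mul (hη.dle t) (e3 h w (by omega) m d).1 (n4_nonneg _) (by positivity)
    have hz := e1.2 w hw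
    have sA : IsS (tf (deriv η) * Q d) := hη'.mul hQ
    have sB : IsS (tf η * Dt v (Q d)) := hη.isS.mul (hQ.Dt hv)
    rw [Qf, Dt_add (hη.isS.mul hQ) hq, Dt_mul hη.isS hQ, Dt_tf, dx_add (sA.add sB) (hq.Dt hv), dx_add sA sB,
      dxl_add ((sA.dx m).add (sB.dx m)) ((hq.Dt hv).dx m), dxl_add (sA.dx m) (sB.dx m)]
    refine (n4_add ((((sA.dx m).dxl w).add ((sB.dx m).dxl w)).cont t)).trans ?_
    have := n4_add (g := dxl w (dx m (tf η * Dt v (Q d))) t) (((sA.dx m).dxl w).cont t)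
    rw [Pi.add_apply]
    linarith

lemma Qf_symm {η : ℝ → ℝ} {v U : Fin 3 → Fn} {ts Λ : ℝ} {Q : Fin 3 × Fin 3 → Fn} (hv : ∀ i, IsS (v i)) (hd : ∑ i, dx i (v i) = 0)
    (hU : ∀ l, IsS (U l)) (hS : Sol v (Lo Λ U) ts Q) (j l : Fin 3) : Qf η Λ U Q (j, l) = Qf η Λ U Q (l, j) := by
  rw [Qf, Qf, hS.symm hv hd j l, Qh_eq hU, Qh_eq hU, RR_swap]

lemma Qf_mean {η : ℝ → ℝ} (hη : IsS (tf η)) {v U : Fin 3 → Fn} {ts Λ : ℝ} {Q : Fin 3 × Fin 3 → Fn} (hv : ∀ i, IsS (v i)) (hd : ∑ i, dx i (v i) = 0)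
    (hU : ∀ l, IsS (U l)) (hS : Sol v (Lo Λ U) ts Q) (d) (t : ℝ) : ∫ x in Tdom, Qf η Λ U Q d t x = 0 := by
  rw [Qf, int_add' (hη.mul (hS.isS d)) (IsS.Qh hU Λ d), Qh_eq hU,
    RR_mean fun e => (hU e).sub ((hU e).op (Fg_sym _)), add_zero]
  have : ∫ x in Tdom, (tf η * Q d) t x = ∫ x in Tdom, η t * Q d t x := rfl
  rw [this, integral_const_mul, hS.mean hv hd (IsS.Lo hU Λ), mul_zero]

lemma Qf_div {η : ℝ → ℝ} {t0 τ K : ℝ} (τ0 : 0 < τ) (hη : Cut η t0 τ K) {v U : Fin 3 → Fn} {Λ : ℝ} {Q : Fin 3 × Fin 3 → Fn} (hv : ∀ i, IsS (v i)) (hd : ∑ i, dx i (v i) = 0)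
    (hU : ∀ l, IsS (U l)) (h0 : ∀ l t, ∫ x in Tdom, U l t x = 0) (hs : ∀ t, τ < |t - t0| → ∀ l x, U l t x = 0)
    (hS : Sol v (Lo Λ U) (t0 - 2 * τ) Q) (l : Fin 3) : ∑ j, dx j (Qf η Λ U Q (j, l)) = U l := by
  have h1 : ∀ j, dx j (Qf η Λ U Q (j, l)) = tf η * dx j (Q (j, l)) + dx j (Qh Λ U (j, l)) := fun j => by
    rw [Qf, dx_add (hη.isS.mul (hS.isS _)) (IsS.Qh hU Λ _), dx_tf_mul hη.isS (hS.isS _)]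
  simp only [h1, Finset.sum_add_distrib, ← Finset.mul_sum]
  rw [Qh_div hU Λ h0, hS.div hv hd (IsS.Lo hU Λ) (fun l t => op_mean (Fg_sym _) (hU l) (h0 l t)) (fun l x => ?_)]
  · have : tf η * Lo Λ U l = Op (Fg (1 / Λ)) (U l) := by
      funext t x
      change η t * Lo Λ U l t x = Lo Λ U l t x
      rcases le_or_gt |t - t0| τ with h | h
      · rw [hη.one t h, one_mul]
      · rw [Lo, Op_zero_time (hs t h l), mul_zero]
    rw [this]; abel
  · refine Op_zero_time (hs _ ?_ l) x
    rw [show t0 - 2 * τ - t0 = -(2 * τ) by ring, abs_neg, abs_of_pos (by positivity)]; linarith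

lemma Qf_supp {η : ℝ → ℝ} {t0 τ K : ℝ} (τ0 : 0 < τ) (hη : Cut η t0 τ K) {U : Fin 3 → Fn} {Λ : ℝ} {Q : Fin 3 × Fin 3 → Fn} 
    (hs : ∀ t, τ < |t - t0| → ∀ l x, U l t x = 0) (d) {t : ℝ} (ht : 3 * τ / 2 ≤ |t - t0|) (x : Spc) : Qf η Λ U Q d t x = 0 := by
  have h2 : Qh Λ U d t x = 0 := by
    simp only [Qh, Finset.sum_apply]
    exact Finset.sum_eq_zero fun e _ => Op_zero_time (hs t (by linarith) e) x
  change η t * Q d t x + Qh Λ U d t x = 0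
  rw [h2, hη.zero t ht]; simp

end TE

namespace TE
open scoped Topology

section
variable {E : Type*} [NormedAddCommGroup E] [NormedSpace ℝ E]

def pdl (w : List (Fin 3)) (g : Spc → E) : Spc → E := w.foldr pd g

lemma pdl_cons (j : Fin 3) (w : List (Fin 3)) (g : Spc → E) : pdl (j :: w) g = pd j (pdl w g) := rfl

lemma pdl_ofFn {g : Spc → E} (hg : ContDiff ℝ (⊤ : ℕ∞) g) {k : ℕ} (r : Fin k → Fin 3) (x : Spc) :
    pdl (List.ofFn r) g x = iteratedFDeriv ℝ k g x (fun i => Pi.single (r i) 1) := by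
  induction k generalizing x with
  | zero => simp [pdl]
  | succ k ih =>
    rw [List.ofFn_succ, pdl_cons, pd, funext (ih _)]
    have hd : DifferentiableAt ℝ (iteratedFDeriv ℝ k g) x :=
      (hg.differentiable_iteratedFDeriv (by exact_mod_cast WithTop.coe_lt_top _)).differentiableAt
    rw [iteratedFDeriv_succ_apply_left]
    have := ((ContinuousMultilinearMap.apply ℝ (fun _ : Fin k => Spc) E (fun i => Pi.single (r i.succ) 1)).hasFDerivAt.comp x hd.hasFDerivAt).fderiv
    change fderiv ℝ ((ContinuousMultilinearMap.apply ℝ (fun _ : Fin k => Spc) E (fun i => Pi.single (r i.succ) 1)) ∘ iteratedFDeriv ℝ k g) x _ = _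
    rw [this]
    rfl

lemma pdl_le {g : Spc → E} (hg : ContDiff ℝ (⊤ : ℕ∞) g) (w : List (Fin 3)) (x : Spc) :
    ‖pdl w g x‖ ≤ ‖iteratedFDeriv ℝ w.length g x‖ := by
  have := pdl_ofFn hg w.get x
  rw [List.ofFn_get] at this
  rw [this]
  refine ((iteratedFDeriv ℝ w.length g x).le_opNorm _).trans ?_
  have h1 : ∀ j : Fin 3, ‖(Pi.single j 1 : Spc)‖ = 1 := fun j => by rw [Pi.norm_single]; simp
  simp only [h1, Finset.prod_const_one, mul_one, le_refl]

lemma iter_le {g : Spc → E} (hg : ContDiff ℝ (⊤ : ℕ∞) g) (k : ℕ) (x : Spc) :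
    ‖iteratedFDeriv ℝ k g x‖ ≤ ∑ r : Fin k → Fin 3, ‖pdl (List.ofFn r) g x‖ := by
  refine ContinuousMultilinearMap.opNorm_le_bound (Finset.sum_nonneg fun _ _ => norm_nonneg _) fun m => ?_
  have hm : m = fun i => ∑ j : Fin 3, m i j • (Pi.single j 1 : Spc) := by
    funext i
    exact pi_eq_sum_univ' (m i)
  have e : iteratedFDeriv ℝ k g x m = ∑ r : Fin k → Fin 3, (∏ i, m i (r i)) • pdl (List.ofFn r) g x := by
    conv_lhs => rw [hm]
    rw [ContinuousMultilinearMap.map_sum]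
    refine Finset.sum_congr rfl fun r _ => ?_
    rw [ContinuousMultilinearMap.map_smul_univ, pdl_ofFn hg]
  rw [e, Finset.sum_mul]
  refine (norm_sum_le _ _).trans (Finset.sum_le_sum fun r _ => ?_)
  rw [norm_smul, mul_comm, norm_prod]
  refine mul_le_mul_of_nonneg_left ?_ (norm_nonneg _)
  exact Finset.prod_le_prod (fun _ _ => norm_nonneg _) fun i _ => norm_le_pi_norm (m i) (r i)

lemma iter_cont {g : Spc → E} (hg : ContDiff ℝ (⊤ : ℕ∞) g) (k : ℕ) : Continuous fun x => ‖iteratedFDeriv ℝ k g x‖ :=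
  (hg.continuous_iteratedFDeriv (by exact_mod_cast le_top)).norm

lemma n4_iter {g : Spc → E} (hg : ContDiff ℝ (⊤ : ℕ∞) g) (k : ℕ) :
    (∫ x in Tdom, ‖iteratedFDeriv ℝ k g x‖ ^ (4 : ℝ)) ^ ((1 : ℝ) / 4) = n4 fun x => ‖iteratedFDeriv ℝ k g x‖ := by
  rw [n4_eq (iter_cont hg k)]
  congr 2
  funext x
  exact_mod_cast Real.rpow_natCast _ 4

lemma pd_sm {g : Spc → E} (hg : ContDiff ℝ (⊤ : ℕ∞) g) (j : Fin 3) : ContDiff ℝ (⊤ : ℕ∞) (pd j g) :=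
  (hg.fderiv_right (m := (⊤ : ℕ∞)) (by simp)).clm_apply contDiff_const

lemma pdl_smooth {g : Spc → E} (hg : ContDiff ℝ (⊤ : ℕ∞) g) (w : List (Fin 3)) : ContDiff ℝ (⊤ : ℕ∞) (pdl w g) := by
  induction w with
  | nil => exact hg
  | cons j w ih => exact pd_sm ih j

end

lemma pd_pi {ι : Type*} [Fintype ι] {F : ι → Type*} [∀ i, NormedAddCommGroup (F i)] [∀ i, NormedSpace ℝ (F i)] {g : Spc → ∀ i, F i} (hg : ContDiff ℝ (⊤ : ℕ∞) g) (j : Fin 3) (l : ι) :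
    pd j (fun y => g y l) = fun y => pd j g y l := by
  funext y
  have hd : DifferentiableAt ℝ g y := (hg.differentiable (by simp)).differentiableAt
  exact congrArg (fun T => T (Pi.single j 1)) (hasFDerivAt_pi'.1 hd.hasFDerivAt l).fderiv

lemma pdl_pi {ι : Type*} [Fintype ι] {F : ι → Type*} [∀ i, NormedAddCommGroup (F i)] [∀ i, NormedSpace ℝ (F i)] {g : Spc → ∀ i, F i} (hg : ContDiff ℝ (⊤ : ℕ∞) g) (w : List (Fin 3)) (l : ι) :
    pdl w (fun y => g y l) = fun y => pdl w g y l := by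
  induction w with
  | nil => rfl
  | cons j w ih => rw [pdl_cons, ih, pd_pi (pdl_smooth hg w), pdl_cons]

lemma dxl_eq_pdl (w : List (Fin 3)) (f : Fn) (t : ℝ) : dxl w f t = pdl w (f t) := by
  induction w with
  | nil => rfl
  | cons j w ih => rw [dxl_cons, pdl_cons, ← ih, dx]

lemma n4_lower {g : Spc → Spc} (hg : ContDiff ℝ (⊤ : ℕ∞) g) (w : List (Fin 3)) (l : Fin 3) {B : ℝ}
    (h : (∫ x in Tdom, ‖iteratedFDeriv ℝ w.length g x‖ ^ (4 : ℝ)) ^ ((1 : ℝ) / 4) ≤ B) : n4 (pdl w fun y => g y l) ≤ B := by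
  rw [n4_iter hg] at h
  refine (n4_mono ?_ (iter_cont hg _) fun x => ?_).trans h
  · rw [pdl_pi hg]; exact (continuous_apply l).comp (pdl_smooth hg w).continuous
  · rw [pdl_pi hg, abs_norm]
    exact (norm_le_pi_norm (pdl w g x) l).trans (pdl_le hg w x)

lemma n4_abs {g : Spc → ℝ} (hg : Continuous g) : n4 (fun x => |g x|) ≤ n4 g := n4_mono hg.abs hg fun x => by simp

lemma norm_le_sum2 (M : Fin 3 → Fin 3 → ℝ) : ‖M‖ ≤ ∑ d : Fin 3 × Fin 3, |M d.1 d.2| := by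
  have h0 : 0 ≤ ∑ d : Fin 3 × Fin 3, |M d.1 d.2| := Finset.sum_nonneg fun _ _ => abs_nonneg _
  refine (pi_norm_le_iff_of_nonneg h0).2 fun j => (pi_norm_le_iff_of_nonneg h0).2 fun l => ?_
  exact Finset.single_le_sum (f := fun d : Fin 3 × Fin 3 => |M d.1 d.2|) (fun _ _ => abs_nonneg _) (Finset.mem_univ (j, l))

lemma n4_upper {g : Spc → Fin 3 → Fin 3 → ℝ} (hg : ContDiff ℝ (⊤ : ℕ∞) g) (k : ℕ) {B : ℝ}
    (h : ∀ m (w : List (Fin 3)), w.length = k → ∀ j l, n4 (pdl (m :: w) fun y => g y j l) ≤ B) :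
    (∫ x in Tdom, ‖iteratedFDeriv ℝ (k + 1) g x‖ ^ (4 : ℝ)) ^ ((1 : ℝ) / 4) ≤ 9 * 3 ^ (k + 1) * B := by
  rw [n4_iter hg]
  have hs : ∀ j l, ContDiff ℝ (⊤ : ℕ∞) fun y => g y j l := fun j l => contDiff_pi.1 (contDiff_pi.1 hg j) l
  have hc : ∀ (r : Fin (k + 1) → Fin 3) (d : Fin 3 × Fin 3), Continuous (pdl (List.ofFn r) fun y => g y d.1 d.2) := fun r d =>
    (pdl_smooth (hs _ _) _).continuous
  have h1 : ∀ x, ‖iteratedFDeriv ℝ (k + 1) g x‖ ≤ (∑ p : (Fin (k + 1) → Fin 3) × (Fin 3 × Fin 3), fun x => |pdl (List.ofFn p.1) (fun y => g y p.2.1 p.2.2) x|) x := fun x => by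
    rw [Finset.sum_apply, Fintype.sum_prod_type]
    refine (iter_le hg (k + 1) x).trans (Finset.sum_le_sum fun r _ => (norm_le_sum2 _).trans (le_of_eq ?_))
    refine Finset.sum_congr rfl fun d _ => ?_
    rw [pdl_pi (contDiff_pi.1 hg d.1) _ d.2, pdl_pi hg]
  refine (n4_mono (iter_cont hg _) (g := ∑ p : (Fin (k + 1) → Fin 3) × (Fin 3 × Fin 3), fun x => |pdl (List.ofFn p.1) (fun y => g y p.2.1 p.2.2) x|) ?_ fun x => ?_).trans ?_
  · rw [show (∑ p : (Fin (k + 1) → Fin 3) × (Fin 3 × Fin 3), fun x => |pdl (List.ofFn p.1) (fun y => g y p.2.1 p.2.2) x|) = fun x => ∑ p : (Fin (k + 1) → Fin 3) × (Fin 3 × Fin 3), |pdl (List.ofFn p.1) (fun y => g y p.2.1 p.2.2) x| from by funext x; simp]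
    exact continuous_finsetSum _ fun p _ => (hc p.1 p.2).abs
  · rw [abs_norm]; exact (h1 x).trans (le_abs_self _)
  · refine (n4_sum _ fun p _ => (hc p.1 p.2).abs).trans ?_
    refine (Finset.sum_le_sum (g := fun _ => B) fun p _ => (n4_abs (hc p.1 p.2)).trans ?_).trans ?_
    · rw [List.ofFn_succ]
      exact h _ _ (by simp) _ _
    · simp [Fintype.card_prod]
      apply le_of_eq; ring

end TE

namespace TE
open scoped Topology

lemma lin_sel {X Y : Type*} [AddCommGroup X] [Module ℝ X] [AddCommGroup Y] [Module ℝ Y] (P : X → Y → Prop)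
    (hadd : ∀ x y x' y', P x y → P x' y' → P (x + x') (y + y')) (hsmul : ∀ (c : ℝ) x y, P x y → P (c • x) (c • y))
    (hne : ∃ x y, P x y) : ∃ T : X →ₗ[ℝ] Y, ∀ x, (∃ y, P x y) → P x (T x) := by
  let R : Submodule ℝ (X × Y) :=
    { carrier := {p | P p.1 p.2}
      add_mem' := fun {p q} hp hq => hadd _ _ _ _ hp hq
      zero_mem' := by
        obtain ⟨x, y, h⟩ := hne
        have := hsmul 0 x y h
        rw [zero_smul, zero_smul] at this
        exact this
      smul_mem' := fun c p hp => hsmul c _ _ hp }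
  let f : R →ₗ[ℝ] X := (LinearMap.fst ℝ X Y).comp R.subtype
  obtain ⟨g, hg⟩ := f.rangeRestrict.exists_rightInverse_of_surjective (LinearMap.range_rangeRestrict f)
  obtain ⟨T, hT⟩ := (((LinearMap.snd ℝ X Y).comp R.subtype).comp g).exists_extend
  refine ⟨T, fun x ⟨y, h⟩ => ?_⟩
  have hx : x ∈ LinearMap.range f := ⟨⟨(x, y), h⟩, rfl⟩
  have h1 : T x = (g ⟨x, hx⟩ : X × Y).2 := congrArg (fun F => F ⟨x, hx⟩) hT
  have h2 : (g ⟨x, hx⟩ : X × Y).1 = x := congrArg Subtype.val (congrArg (fun F => F ⟨x, hx⟩) hg)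
  have h3 : P (g ⟨x, hx⟩ : X × Y).1 (g ⟨x, hx⟩ : X × Y).2 := (g ⟨x, hx⟩).2
  rw [h2, ← h1] at h3
  exact h3

def cmp (U : ℝ → Spc → Spc) (l : Fin 3) : Fn := fun t x => U t x l

lemma pd_csmul {g : Spc → ℝ} (hg : ContDiff ℝ (⊤ : ℕ∞) g) (c : ℝ) (j : Fin 3) : pd j (c • g) = c • pd j g := by
  funext x
  have hd : DifferentiableAt ℝ g x := (hg.differentiable (by simp)).differentiableAt
  simp [pd, fderiv_const_smul hd]

lemma pdl_csmul {g : Spc → ℝ} (hg : ContDiff ℝ (⊤ : ℕ∞) g) (c : ℝ) (w : List (Fin 3)) : pdl w (c • g) = c • pdl w g := by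
  induction w with
  | nil => rfl
  | cons j w ih => rw [pdl_cons, ih, pd_csmul (pdl_smooth hg w), pdl_cons]

def vc (χ : ℝ → ℝ) (v : ℝ → Spc → Spc) (i : Fin 3) : Fn := fun t x => χ t * v t x i

lemma slice_cmp {v : ℝ → Spc → Spc} (h : ContDiff ℝ (⊤ : ℕ∞) (fun q : ℝ × Spc => v q.1 q.2)) (t : ℝ) (l : Fin 3) :
    ContDiff ℝ (⊤ : ℕ∞) (fun y => v t y l) :=
  (contDiff_pi.1 h l).comp (contDiff_const.prodMk contDiff_id)

lemma slice_vec {v : ℝ → Spc → Spc} (h : ContDiff ℝ (⊤ : ℕ∞) (fun q : ℝ × Spc => v q.1 q.2)) (t : ℝ) :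
    ContDiff ℝ (⊤ : ℕ∞) (v t) := h.comp (contDiff_const.prodMk contDiff_id)

lemma vc_slice (χ : ℝ → ℝ) (v : ℝ → Spc → Spc) (i : Fin 3) (t : ℝ) : vc χ v i t = χ t • fun y => v t y i := rfl

lemma bdd_of {t0 r : ℝ} {p : ℝ → Prop} (h : ∀ t, r ≤ |t - t0| → p t) : ∀ t, r + |t0| ≤ |t| → p t := fun t ht => by
  refine h t ?_
  have := abs_sub_abs_le_abs_sub t t0
  linarith

lemma isS_vc {χ : ℝ → ℝ} (hχ : ContDiff ℝ (⊤ : ℕ∞) χ) {t0 r : ℝ} (hz : ∀ t, r ≤ |t - t0| → χ t = 0) {v : ℝ → Spc → Spc}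
    (h : ContDiff ℝ (⊤ : ℕ∞) (fun q : ℝ × Spc => v q.1 q.2)) (hp : ∀ t, Per (v t)) (i : Fin 3) : IsS (vc χ v i) := by
  refine isS_of_smooth ((hχ.comp contDiff_fst).mul (contDiff_pi.1 h i)) (fun t x k => ?_) ⟨r + |t0|, fun t ht x => ?_⟩
  · simp only [vc, hp t x k]
  · simp only [vc, bdd_of hz t ht, zero_mul]

lemma vc_div (χ : ℝ → ℝ) {v : ℝ → Spc → Spc} (h : ContDiff ℝ (⊤ : ℕ∞) (fun q : ℝ × Spc => v q.1 q.2))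
    (hd : ∀ t x, (∑ i, pd i (fun y => v t y i) x) = 0) : ∑ i, dx i (vc χ v i) = 0 := by
  funext t x
  simp only [Finset.sum_apply, dx, vc_slice, pd_csmul (slice_cmp h t _), Pi.smul_apply, ← Finset.smul_sum, hd]
  simp

lemma vc_VB {χ : ℝ → ℝ} (hχ : ∀ t, |χ t| ≤ 1) {v : ℝ → Spc → Spc} (h : ContDiff ℝ (⊤ : ℕ∞) (fun q : ℝ × Spc => v q.1 q.2))
    {L : ℕ} {τ Λ : ℝ} (hb : ∀ k : ℕ, k ≤ L → ∀ t x l, ‖iteratedFDeriv ℝ (k + 1) (fun y => v t y l) x‖ ≤ τ⁻¹ * Λ ^ k) :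
    VB (vc χ v) L τ Λ := by
  intro w hw i j t x
  have e : dxl w (dx j (vc χ v i)) t = χ t • pdl (w ++ [j]) (fun y => v t y i) := by
    rw [dxl_eq_pdl, dx, vc_slice, pd_csmul (slice_cmp h t i), pdl_csmul (pd_sm (slice_cmp h t i) j)]
    simp [pdl, List.foldr_append]
  rw [e, Pi.smul_apply, smul_eq_mul, abs_mul]
  refine (mul_le_of_le_one_left (abs_nonneg _) (hχ t)).trans ?_
  have := pdl_le (slice_cmp h t i) (w ++ [j]) x
  rw [List.length_append] at this
  exact this.trans (hb _ hw t x i)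

lemma matD_eq {χ : ℝ → ℝ} {t0 r : ℝ} (h1 : ∀ t, |t - t0| ≤ r → χ t = 1) (v : ℝ → Spc → Spc) {f : Fn} (hf : ∀ t, r < |t - t0| → ∀ x, f t x = 0) :
    matD v f = Dt (vc χ v) f := by
  funext t x
  simp only [matD, Dt, Pi.add_apply, Finset.sum_apply, Pi.mul_apply]
  congr 1
  refine Finset.sum_congr rfl fun i _ => ?_
  rcases le_or_gt |t - t0| r with h | h
  · simp [vc, h1 t h, dx]
  · have := dx_zero_time (hf t h) i x
    simp only [dx] at this
    simp [dx, this]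

lemma isS_cmp {U : ℝ → Spc → Spc} (h : ContDiff ℝ (⊤ : ℕ∞) (fun q : ℝ × Spc => U q.1 q.2)) (hp : ∀ t, Per (U t)) {t0 r : ℝ}
    (hs : ∀ t, r < |t - t0| → ∀ l x, cmp U l t x = 0) (l : Fin 3) : IsS (cmp U l) := by
  refine isS_of_smooth (contDiff_pi.1 h l) (fun t x k => ?_) ⟨(r + 1) + |t0|, fun t ht x => ?_⟩
  · simp only [cmp, hp t x k]
  · exact bdd_of (r := r + 1) (t0 := t0) (p := fun t => cmp U l t x = 0) (fun t ht => hs t (by linarith) l x) t ht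

def asm (η : ℝ → ℝ) (Λ : ℝ) (U : ℝ → Spc → Spc) (Q : Fin 3 × Fin 3 → Fn) : ℝ → Spc → Fin 3 → Fin 3 → ℝ :=
  fun t x j l => Qf η Λ (cmp U) Q (j, l) t x

lemma T_ex (η : ℝ → ℝ) (Λ ts : ℝ) {v : Fin 3 → Fn} (hv : ∀ i, IsS (v i)) (hd : ∑ i, dx i (v i) = 0)
    (sv : ∃ R, ∀ i t, R ≤ |t| → ∀ x, v i t x = 0) :
    ∃ T : (ℝ → Spc → Spc) →ₗ[ℝ] (ℝ → Spc → Fin 3 → Fin 3 → ℝ), ∀ U, (∀ l, IsS (cmp U l)) →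
      (∃ R, ∀ l t, R ≤ |t| → ∀ x, cmp U l t x = 0) → ∃ Q, Sol v (Lo Λ (cmp U)) ts Q ∧ T U = asm η Λ U Q := by
  have hex : ∀ U, (∀ l, IsS (cmp U l)) → (∃ R, ∀ l t, R ≤ |t| → ∀ x, cmp U l t x = 0) → ∃ Q, Sol v (Lo Λ (cmp U)) ts Q := by
    rintro U hU ⟨R, hR⟩
    obtain ⟨R', hR'⟩ := sv
    exact sol_ex hv hd (IsS.Lo hU Λ) (R := max R R') (fun i t ht x => hR' i t ((le_max_right _ _).trans ht) x) 
      (fun i t ht x => Op_zero_time (hR i t ((le_max_left _ _).trans ht)) x) ts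
  suffices hh : ∃ T : (ℝ → Spc → Spc) →ₗ[ℝ] (ℝ → Spc → Fin 3 → Fin 3 → ℝ), ∀ U, (∃ Y, (∀ l, IsS (cmp U l)) ∧ ∃ Q, Sol v (Lo Λ (cmp U)) ts Q ∧ Y = asm η Λ U Q) →
      ((∀ l, IsS (cmp U l)) ∧ ∃ Q, Sol v (Lo Λ (cmp U)) ts Q ∧ T U = asm η Λ U Q) by
    obtain ⟨T, hT⟩ := hh
    refine ⟨T, fun U hU hs => ?_⟩
    obtain ⟨Q, hQ⟩ := hex U hU hs
    exact (hT U ⟨_, hU, Q, hQ, rfl⟩).2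
  refine lin_sel (fun (U : ℝ → Spc → Spc) (Y : ℝ → Spc → Fin 3 → Fin 3 → ℝ) =>
    (∀ l, IsS (cmp U l)) ∧ ∃ Q, Sol v (Lo Λ (cmp U)) ts Q ∧ Y = asm η Λ U Q) ?_ ?_ ?_
  · rintro U _ U' _ ⟨hU, Q, hQ, rfl⟩ ⟨hU', Q', hQ', rfl⟩
    have e1 : cmp (U + U') = cmp U + cmp U' := rfl
    have e2 : Lo Λ (cmp U + cmp U') = Lo Λ (cmp U) + Lo Λ (cmp U') := by
      funext l
      exact op_add (Fg_sym _) (hU l) (hU' l)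
    refine ⟨fun l => (hU l).add (hU' l), Q + Q', ?_, ?_⟩
    · rw [e1, e2]
      exact Sol.add hv (IsS.Lo hU Λ) (IsS.Lo hU' Λ) hQ hQ'
    · funext t x j l
      simp only [asm, e1, Qf, Qh_add hU hU', Pi.add_apply, Pi.mul_apply]
      ring
  · rintro c U _ ⟨hU, Q, hQ, rfl⟩
    have e1 : cmp (c • U) = c • cmp U := rfl
    have e2 : Lo Λ (c • cmp U) = c • Lo Λ (cmp U) := by
      funext l
      exact op_smul (Fg_sym _) (hU l) c
    refine ⟨fun l => (hU l).smul c, c • Q, ?_, ?_⟩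
    · rw [e1, e2]
      exact Sol.smul hv (IsS.Lo hU Λ) hQ c
    · funext t x j l
      simp only [asm, e1, Qf, Qh_smul hU, Pi.add_apply, Pi.mul_apply, Pi.smul_apply, smul_eq_mul]
      ring
  · have h0 : ∀ l, IsS (cmp 0 l) := fun l => isS_zero
    obtain ⟨Q, hQ⟩ := hex 0 h0 ⟨0, fun l t _ x => rfl⟩
    exact ⟨0, _, h0, Q, hQ, rfl⟩

lemma cut_mk {b : ℝ → ℝ} {K : ℝ} (hb : ContDiff ℝ (⊤ : ℕ∞) b) (h1 : ∀ s, |s| ≤ 1 → b s = 1) (h0 : ∀ s, 3 / 2 ≤ |s| → b s = 0)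
    (hle : ∀ s, |b s| ≤ 1) (hK : ∀ s, |deriv b s| ≤ K) (t0 : ℝ) {τ : ℝ} (τ0 : 0 < τ) :
    Cut (fun t => b ((t - t0) / τ)) t0 τ K := by
  have hs : ContDiff ℝ (⊤ : ℕ∞) (fun t => b ((t - t0) / τ)) := hb.comp ((contDiff_id.sub contDiff_const).div_const τ)
  have hz : ∀ t, 3 * τ / 2 ≤ |t - t0| → b ((t - t0) / τ) = 0 := fun t ht => by
    refine h0 _ ?_
    rw [abs_div, abs_of_pos τ0, le_div_iff₀ τ0]; linarith
  refine ⟨isS_tf hs (bdd_of hz), fun t => hle _, fun t => ?_, fun t ht => ?_, hz⟩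
  · have hd : HasDerivAt (fun t => (t - t0) / τ) (1 / τ) t := ((hasDerivAt_id t).sub_const t0).div_const τ
    have hc := ((hb.differentiable (by simp)).differentiableAt (x := (t - t0) / τ)).hasDerivAt.comp t hd
    have : deriv (fun t => b ((t - t0) / τ)) t = deriv b ((t - t0) / τ) * (1 / τ) := hc.deriv
    rw [this, abs_mul, one_div, abs_of_pos (inv_pos.2 τ0)]
    exact mul_le_mul_of_nonneg_right (hK _) (inv_pos.2 τ0).le
  · refine h1 _ ?_
    rw [abs_div, abs_of_pos τ0, div_le_one τ0]; exact ht

end TE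

/-- Solution of the divergence equation `∂ⱼ Qʲˡ = Uˡ` by a transport-elliptic
equation, with L⁴ bounds on spatial derivatives of `Q` and of its material
derivative, and support control in time. -/
theorem transport_elliptic (L : ℕ) (hL : 1 ≤ L) :
    ∃ C : ℝ, 0 < C ∧
      ∀ (τ Λ t₀ : ℝ), 0 < τ → 0 < Λ →
      ∀ v : ℝ → Spc → Spc,
        ContDiff ℝ (⊤ : ℕ∞) (fun q : ℝ × Spc => v q.1 q.2) →
        (∀ t, Per (v t)) →
        (∀ t x, (∑ i, pd i (fun y => v t y i) x) = 0) →
        (∀ k : ℕ, k ≤ L → ∀ t x l,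
          ‖iteratedFDeriv ℝ (k + 1) (fun y => v t y l) x‖ ≤ τ⁻¹ * Λ ^ k) →
      ∃ T : (ℝ → Spc → Spc) →ₗ[ℝ] (ℝ → Spc → Fin 3 → Fin 3 → ℝ),
        ∀ (A : ℝ), 0 < A →
        ∀ U : ℝ → Spc → Spc,
          ContDiff ℝ (⊤ : ℕ∞) (fun q : ℝ × Spc => U q.1 q.2) →
          (∀ t, Per (U t)) →
          (∀ t, t ∉ Set.Icc (t₀ - τ) (t₀ + τ) → ∀ x, U t x = 0) →
          (∀ t l, (∫ x in Tdom, U t x l) = 0) →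
          (∀ k : ℕ, k ≤ L → ∀ t,
            (∫ x in Tdom, ‖iteratedFDeriv ℝ k (U t) x‖ ^ (4 : ℝ)) ^ ((1 : ℝ)/4)
              ≤ A * Λ ^ k) →
          (∀ k : ℕ, k + 1 ≤ L → ∀ t,
            (∫ x in Tdom,
              ‖iteratedFDeriv ℝ k
                (fun y => (fun l => matD v (fun s z => U s z l) t y : Spc)) x‖ ^ (4 : ℝ))
              ^ ((1 : ℝ)/4) ≤ A * τ⁻¹ * Λ ^ k) →
          (ContDiff ℝ (⊤ : ℕ∞) (fun q : ℝ × Spc => T U q.1 q.2) ∧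
           (∀ t, Per (T U t)) ∧
           (∀ t x j l, T U t x j l = T U t x l j) ∧
           (∀ t x l, (∑ j, pd j (fun y => T U t y j l) x) = U t x l) ∧
           (∀ t j l, (∫ x in Tdom, T U t x j l) = 0) ∧
           (∀ t, t ∉ Set.Icc (t₀ - 3*τ/2) (t₀ + 3*τ/2) → ∀ x, T U t x = 0) ∧
           (∀ k : ℕ, k ≤ L → ∀ t,
             (∫ x in Tdom, ‖iteratedFDeriv ℝ (k + 1) (T U t) x‖ ^ (4 : ℝ)) ^ ((1 : ℝ)/4)
               ≤ C * A * Λ ^ k) ∧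
           (∀ k : ℕ, k + 1 ≤ L → ∀ t,
             (∫ x in Tdom,
               ‖iteratedFDeriv ℝ (k + 1)
                 (fun y => (fun j l => matD v (fun s z => T U s z j l) t y)) x‖ ^ (4 : ℝ))
               ^ ((1 : ℝ)/4) ≤ C * A * τ⁻¹ * Λ ^ k)) := by
  obtain ⟨b, K, K0, hb, hb1, hb0, hble, hbK⟩ := TE.bump_ex
  obtain ⟨C, hC1, hC⟩ := TE.fin_est L hL K K0
  have hC0 : 0 < C := by linarith
  refine ⟨9 * 3 ^ (L + 1) * C, by positivity, fun τ Λ t₀ τ0 Λ0 v hv hvp hvd hvb => ?_⟩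
  let η : ℝ → ℝ := fun t => b ((t - t₀) / τ)
  let χ : ℝ → ℝ := fun t => b ((t - t₀) / (2 * τ))
  have hη : TE.Cut η t₀ τ K := TE.cut_mk hb hb1 hb0 hble hbK t₀ τ0
  have hχ : TE.Cut χ t₀ (2 * τ) K := TE.cut_mk hb hb1 hb0 hble hbK t₀ (by positivity)
  have hχs : ContDiff ℝ (⊤ : ℕ∞) χ := hb.comp ((contDiff_id.sub contDiff_const).div_const (2 * τ))
  have hw : ∀ i, TE.IsS (TE.vc χ v i) := TE.isS_vc hχs hχ.zero hv hvp
  have hwd := TE.vc_div χ hv hvd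
  have hVB : TE.VB (TE.vc χ v) L τ Λ := TE.vc_VB hχ.le hv hvb
  obtain ⟨T, hT⟩ := TE.T_ex η Λ (t₀ - 2 * τ) hw hwd ⟨3 * (2 * τ) / 2 + |t₀|, fun i t ht x => by
    have := TE.bdd_of hχ.zero t ht
    simp only [TE.vc, this, zero_mul]⟩
  refine ⟨T, fun A A0 U hU hUp hUs hU0 hU1 hU2 => ?_⟩
  have hs : ∀ t, τ < |t - t₀| → ∀ l x, TE.cmp U l t x = 0 := fun t ht l x => by
    have : U t x = 0 := hUs t (fun hm => by
      have : |t - t₀| ≤ τ := abs_le.2 ⟨by linarith [hm.1], by linarith [hm.2]⟩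
      linarith) x
    simp [TE.cmp, this]
  have hUS := TE.isS_cmp hU hUp hs
  obtain ⟨Q, hQ, hTU⟩ := hT U hUS ⟨(τ + 1) + |t₀|, fun l t ht x =>
    TE.bdd_of (r := τ + 1) (t0 := t₀) (p := fun t => TE.cmp U l t x = 0) (fun t ht => hs t (by linarith) l x) t ht⟩
  have hmU : ∀ l, matD v (fun s z => U s z l) = TE.Dt (TE.vc χ v) (TE.cmp U l) := fun l =>
    TE.matD_eq (f := TE.cmp U l) hχ.one v fun t ht x => hs t (by linarith) l x
  have b1 : ∀ w : List (Fin 3), w.length ≤ L → ∀ l t, TE.n4 (TE.dxl w (TE.cmp U l) t) ≤ A * Λ ^ w.length := fun w hw l t => by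
    rw [TE.dxl_eq_pdl]
    exact TE.n4_lower (TE.slice_vec hU t) w l (hU1 _ hw t)
  have b2 : ∀ w : List (Fin 3), w.length + 1 ≤ L → ∀ l t,
      TE.n4 (TE.dxl w (TE.Dt (TE.vc χ v) (TE.cmp U l)) t) ≤ A * τ⁻¹ * Λ ^ w.length := fun w hwl l t => by
    rw [TE.dxl_eq_pdl, ← hmU]
    refine TE.n4_lower (g := fun y => (fun l => matD v (fun s z => U s z l) t y : Spc)) ?_ w l (hU2 _ hwl t)
    refine contDiff_pi.2 fun l => ?_
    rw [hmU]
    exact ((hUS l).Dt hw).slice t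
  have hest := hC (TE.vc χ v) (TE.cmp U) t₀ τ Λ A η Q hw hwd hUS τ0 Λ0 A0.le hVB b1 b2 hη hQ
  have hF := fun d => TE.IsS.Qf hη.isS hUS hQ.isS Λ d
  have hsupp := fun d t (ht : 3 * τ / 2 ≤ |t - t₀|) x => TE.Qf_supp (Λ := Λ) (Q := Q) τ0 hη hs d ht x
  have hmQ : ∀ j l, matD v (fun s z => TE.asm η Λ U Q s z j l) = TE.Dt (TE.vc χ v) (TE.Qf η Λ (TE.cmp U) Q (j, l)) := fun j l =>
    TE.matD_eq (f := TE.Qf η Λ (TE.cmp U) Q (j, l)) hχ.one v fun t ht x => hsupp _ t (by linarith) x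
  have hpow : ∀ k, k ≤ L → (3 : ℝ) ^ (k + 1) ≤ 3 ^ (L + 1) := fun k hk => pow_le_pow_right₀ (by norm_num) (by omega)
  rw [hTU]
  refine ⟨?_, ?_, ?_, ?_, ?_, ?_, ?_, ?_⟩
  · exact contDiff_pi.2 fun j => contDiff_pi.2 fun l => (hF (j, l)).contDiff
  · intro t x k
    funext j l
    exact (hF (j, l)).per t x k
  · intro t x j l
    simp only [TE.asm, TE.Qf_symm hw hwd hUS hQ j l]
  · intro t x l
    have := congrFun (congrFun (TE.Qf_div τ0 hη hw hwd hUS (fun l t => hU0 t l) hs hQ l) t) x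
    simp only [Finset.sum_apply] at this
    exact this
  · intro t j l
    exact TE.Qf_mean hη.isS hw hwd hUS hQ (j, l) t
  · intro t ht x
    funext j l
    refine hsupp (j, l) t ?_ x
    by_contra hcon
    push Not at hcon
    rw [abs_lt] at hcon
    exact ht ⟨by linarith [hcon.1], by linarith [hcon.2]⟩
  · intro k hk t
    have hp : ∀ m (w : List (Fin 3)), w.length = k → ∀ j l, TE.n4 (TE.pdl (m :: w) fun y => TE.asm η Λ U Q t y j l) ≤ C * A * Λ ^ k := by
      rintro m w rfl j l
      have := (hest t m (j, l)).1 w hk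
      rw [TE.dxl_dx (hF _), ← TE.dxl_cons, TE.dxl_eq_pdl] at this
      exact this
    refine (TE.n4_upper (contDiff_pi.2 fun j => contDiff_pi.2 fun l => (hF (j, l)).slice t) k hp).trans ?_
    have h0 : 0 ≤ C * A * Λ ^ k := by positivity
    calc 9 * 3 ^ (k + 1) * (C * A * Λ ^ k) ≤ 9 * 3 ^ (L + 1) * (C * A * Λ ^ k) := by
          have := mul_le_mul_of_nonneg_right (hpow k hk) h0
          linarith
      _ = _ := by ring
  · intro k hk t
    have hp : ∀ m (w : List (Fin 3)), w.length = k → ∀ j l,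
        TE.n4 (TE.pdl (m :: w) fun y => matD v (fun s z => TE.asm η Λ U Q s z j l) t y) ≤ C * A * τ⁻¹ * Λ ^ k := by
      rintro m w rfl j l
      have := (hest t m (j, l)).2 w hk
      rw [TE.dxl_dx ((hF _).Dt hw), ← TE.dxl_cons, TE.dxl_eq_pdl, ← hmQ] at this
      exact this
    refine (TE.n4_upper (g := fun y => (fun j l => matD v (fun s z => TE.asm η Λ U Q s z j l) t y))
      (contDiff_pi.2 fun j => contDiff_pi.2 fun l => ?_) k hp).trans ?_
    · rw [hmQ]
      exact ((hF (j, l)).Dt hw).slice t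
    have h0 : 0 ≤ C * A * τ⁻¹ * Λ ^ k := by positivity
    calc 9 * 3 ^ (k + 1) * (C * A * τ⁻¹ * Λ ^ k) ≤ 9 * 3 ^ (L + 1) * (C * A * τ⁻¹ * Λ ^ k) := by
          have := mul_le_mul_of_nonneg_right (hpow k (by omega)) h0
          linarith
      _ = _ := by ring
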